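/- arXiv:1404.0654 — 7 statements merged into one kernel-verified Lean document; each statement's English description precedes it below -/
import Mathlib

section
/- For every prime power q and every integer c ≥ 1 there exists a constant α > 0 such that the following holds for all n: if f : F_q^n → F_q is a polynomial (with each individual variable degree at most q-1) having at most n^c monomials with nonzero coefficients, then there exists a linear subspace U ⊆ F_q^n of dimension at least α · √n such that the restriction f|_U has degree at most 2(q-1)c. -/
open MvPolynomial

/-- `restDegLE F n f u U D` expresses that the restriction of the polynomial `f` to the
affine subspace `u + U` has degree at most `D`: for every basis `v` of `U`, the function
`x ↦ f (u + ∑ i, x i • v i)` is computed by a polynomial of total degree at most `D`. -/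
def restDegLE (F : Type) [Field F] (n : ℕ) (f : MvPolynomial (Fin n) F)
    (u : Fin n → F) (U : Submodule F (Fin n → F)) (D : ℕ) : Prop :=
  ∀ (k : ℕ) (v : Fin k → (Fin n → F)), LinearIndependent F v →
    Submodule.span F (Set.range v) = U →
    ∃ g : MvPolynomial (Fin k) F, g.totalDegree ≤ D ∧
      ∀ x : Fin k → F, eval x g = eval (u + ∑ i, x i • v i) f

/-- The number of functions `φ` whose graph, embedded by `e`, contains a given set `T`. -/
theorem card_graph_superset_mul_le {s m : ℕ} {β : Type*} [DecidableEq β]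
    (e : Fin s × Fin m ↪ β) (T : Finset β) :
    (Finset.univ.filter fun φ : Fin s → Fin m =>
      T ⊆ Finset.univ.image fun i => e (i, φ i)).card * m ^ T.card ≤ m ^ s := by
  set A := Finset.univ.filter fun φ : Fin s → Fin m =>
      T ⊆ Finset.univ.image fun i => e (i, φ i) with hA
  rcases A.eq_empty_or_nonempty with h | ⟨φ₀, h₀⟩
  · simp [h]
  let I : Finset (Fin s) := Finset.univ.filter fun i => e (i, φ₀ i) ∈ T
  have hT : T.card ≤ I.card := by
    have : T ⊆ I.image fun i => e (i, φ₀ i) := by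
      intro t ht
      obtain ⟨i, -, hi⟩ := Finset.mem_image.1 ((Finset.mem_filter.1 h₀).2 ht)
      exact Finset.mem_image.2 ⟨i, by simp [I, hi, ht], hi⟩
    exact (Finset.card_le_card this).trans Finset.card_image_le
  have hsub : A ⊆ Fintype.piFinset fun i => if i ∈ I then {φ₀ i} else Finset.univ := by
    intro φ hφ
    rw [Fintype.mem_piFinset]
    intro i
    split_ifs with hi
    · obtain ⟨j, -, hj⟩ := Finset.mem_image.1
        ((Finset.mem_filter.1 hφ).2 (Finset.mem_filter.1 hi).2)
      have := e.injective hj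
      simp only [Prod.mk.injEq] at this
      obtain ⟨rfl, h2⟩ := this
      simp [h2]
    · simp
  have hcard := Finset.card_le_card hsub
  have hpi : (Fintype.piFinset fun i => if i ∈ I then {φ₀ i} else Finset.univ).card
      = m ^ (s - I.card) := by
    rw [Fintype.card_piFinset]
    have : ∀ i, (if i ∈ I then ({φ₀ i} : Finset (Fin m)) else Finset.univ).card
        = if i ∈ I then 1 else m := by
      intro i; split_ifs <;> simp
    simp only [this, Finset.prod_ite, Finset.prod_const_one, Finset.prod_const, one_mul]
    congr 1
    rw [Finset.filter_not, Finset.filter_mem_eq_inter, Finset.univ_inter,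
      ← Finset.compl_eq_univ_sdiff, Finset.card_compl, Fintype.card_fin]
  rw [hpi] at hcard
  have hI : I.card ≤ s := by simpa using Finset.card_le_univ I
  rcases Nat.eq_zero_or_pos s with rfl | hs
  · have : T.card = 0 := by omega
    simpa [this] using hcard
  have hm : 0 < m := (φ₀ ⟨0, hs⟩).pos
  calc A.card * m ^ T.card ≤ m ^ (s - I.card) * m ^ I.card :=
        Nat.mul_le_mul hcard (Nat.pow_le_pow_right hm hT)
    _ = m ^ s := by rw [← pow_add, Nat.sub_add_cancel hI]

/-- A family of fewer than `m ^ t` sets admits a set of size `s` containing none of its members of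
size at least `t`, as soon as the ground type has room for `s` blocks of size `m`. -/
theorem exists_card_eq_forall_subset_card_lt {s m t : ℕ} {β : Type*} [DecidableEq β]
    (e : Fin s × Fin m ↪ β) (𝒯 : Finset (Finset β)) (hm : 0 < m) (h𝒯 : 𝒯.card < m ^ t) :
    ∃ S : Finset β, S.card = s ∧ ∀ T ∈ 𝒯, T ⊆ S → T.card < t := by
  by_contra! hcon
  let B : Finset β → Finset (Fin s → Fin m) := fun T =>
    Finset.univ.filter fun φ => T ⊆ Finset.univ.image fun i => e (i, φ i)
  have hcover : (Finset.univ : Finset (Fin s → Fin m)) ⊆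
      (𝒯.filter fun T => t ≤ T.card).biUnion B := by
    intro φ _
    obtain ⟨T, hT, hTS, hTt⟩ := hcon (Finset.univ.image fun i => e (i, φ i)) (by
      rw [Finset.card_image_of_injective, Finset.card_univ, Fintype.card_fin]
      intro i j hij
      exact (Prod.mk.inj (e.injective hij)).1)
    exact Finset.mem_biUnion.2 ⟨T, Finset.mem_filter.2 ⟨hT, hTt⟩, by simpa [B] using hTS⟩
  have h1 : m ^ s ≤ ∑ T ∈ 𝒯.filter fun T => t ≤ T.card, (B T).card := by
    simpa using (Finset.card_le_card hcover).trans Finset.card_biUnion_le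
  have h2 : (∑ T ∈ 𝒯.filter fun T => t ≤ T.card, (B T).card) * m ^ t ≤ 𝒯.card * m ^ s := by
    rw [Finset.sum_mul]
    calc _ ≤ ∑ T ∈ 𝒯.filter fun T => t ≤ T.card, m ^ s :=
          Finset.sum_le_sum fun T hT =>
            (Nat.mul_le_mul_left _ (Nat.pow_le_pow_right hm (Finset.mem_filter.1 hT).2)).trans
              (card_graph_superset_mul_le e T)
      _ ≤ _ := by
          rw [Finset.sum_const, smul_eq_mul]
          exact Nat.mul_le_mul_right _ (Finset.card_filter_le _ _)
  have h3 : 𝒯.card * m ^ s < m ^ t * m ^ s := Nat.mul_lt_mul_of_pos_right h𝒯 (by positivity)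
  have h4 := Nat.mul_le_mul_right (m ^ t) h1
  rw [mul_comm] at h4
  omega

/-- If every monomial of `f` supported in `S` involves at most `d` variables, each with exponent at
most `a`, then `f` has degree at most `a * d` on the coordinate subspace of `S`. -/
theorem restDegLE_span_single {F : Type} [Field F] {n : ℕ} (f : MvPolynomial (Fin n) F)
    (S : Finset (Fin n)) (a d : ℕ) (ha : ∀ m ∈ f.support, ∀ i, m i ≤ a)
    (hS : ∀ m ∈ f.support, m.support ⊆ S → m.support.card ≤ d) :
    restDegLE F n f 0
      (Submodule.span F (Set.range fun i : S => (Pi.single (i : Fin n) 1 : Fin n → F)))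
      (a * d) := by
  intro k v _ hspan
  have hv : ∀ j, ∀ i ∉ S, v j i = 0 := by
    intro j i hi
    have hle : Submodule.span F (Set.range fun i : S => (Pi.single (i : Fin n) 1 : Fin n → F))
        ≤ LinearMap.ker (LinearMap.proj i : (Fin n → F) →ₗ[F] F) := by
      rw [Submodule.span_le]
      rintro _ ⟨l, rfl⟩
      have : i ≠ l := fun h => hi (h ▸ l.2)
      simp [this]
    exact hle (hspan ▸ Submodule.subset_span ⟨j, rfl⟩)
  refine ⟨∑ m ∈ f.support with m.support ⊆ S, C (coeff m f) *
    ∏ i ∈ m.support, (∑ j, C (v j i) * X j) ^ m i, ?_, fun x => ?_⟩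
  · refine totalDegree_finsetSum_le fun m hm => ?_
    obtain ⟨hm, hmS⟩ := Finset.mem_filter.1 hm
    refine (totalDegree_mul _ _).trans ?_
    rw [totalDegree_C, zero_add]
    refine (totalDegree_finsetProd _ _).trans ?_
    calc _ ≤ ∑ i ∈ m.support, a := Finset.sum_le_sum fun i _ => by
            refine (totalDegree_pow _ _).trans ?_
            have : (∑ j, C (v j i) * X j : MvPolynomial (Fin k) F).totalDegree ≤ 1 := by
              refine totalDegree_finsetSum_le fun j _ => (totalDegree_mul _ _).trans ?_
              simp
            exact (Nat.mul_le_mul (ha m hm i) this).trans_eq (mul_one a)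
      _ = a * m.support.card := by rw [Finset.sum_const, smul_eq_mul, mul_comm]
      _ ≤ a * d := Nat.mul_le_mul_left _ (hS m hm hmS)
  · rw [eval_eq (X := (0 + ∑ i, x i • v i)) (f := f), map_sum, Finset.sum_filter]
    refine Finset.sum_congr rfl fun m _ => ?_
    split_ifs with hmS
    · simp [map_prod, mul_comm]
    · obtain ⟨i, hi, hiS⟩ := Finset.not_subset.1 hmS
      rw [Finset.prod_eq_zero hi, mul_zero]
      have : (0 + ∑ j, x j • v j) i = 0 := by
        simp [hv _ i hiS]
      rw [this, zero_pow (Finsupp.mem_support_iff.1 hi)]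

theorem finrank_span_single (F : Type*) [Field F] {n : ℕ} (S : Finset (Fin n)) :
    Module.finrank F
      (Submodule.span F (Set.range fun i : S => (Pi.single (i : Fin n) 1 : Fin n → F)))
      = S.card := by
  have h : LinearIndependent F fun i : S => (Pi.single (i : Fin n) 1 : Fin n → F) := by
    have := (Pi.basisFun F (Fin n)).linearIndependent.comp (fun i : S => (i : Fin n))
      Subtype.val_injective
    convert this using 1
    ext i : 1
    simp
  simpa using finrank_span_eq_card h

/-- A sparse family of sets in `Fin n` leaves a set of size of order `√n` which contains only
members of bounded size. -/
theorem exists_sqrt_le_card_forall_subset_card_le {n c : ℕ} (hc : 1 ≤ c)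
    (𝒯 : Finset (Finset (Fin n))) (h𝒯 : 𝒯.card ≤ n ^ c) :
    ∃ S : Finset (Fin n), 1 / 4 * Real.sqrt n ≤ S.card ∧
      ∀ T ∈ 𝒯, T ⊆ S → T.card ≤ 2 * c := by
  have hlt : n < (Nat.sqrt n + 1) ^ 2 := by
    rw [pow_two]; exact Nat.lt_succ_sqrt n
  have hsqrt : Real.sqrt n ≤ (Nat.sqrt n : ℝ) + 1 := by
    rw [Real.sqrt_le_left (by positivity)]
    exact_mod_cast hlt.le
  rcases Nat.lt_or_ge (Nat.sqrt n) 2 with hr | hr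
  · rcases Nat.eq_zero_or_pos n with rfl | hn
    · exact ⟨∅, by simp, fun T _ hT => by simp [Finset.subset_empty.1 hT]⟩
    · refine ⟨{⟨0, hn⟩}, ?_, fun T _ hT => ?_⟩
      · have : (Nat.sqrt n : ℝ) ≤ 1 := by exact_mod_cast Nat.le_of_lt_succ hr
        rw [Finset.card_singleton, Nat.cast_one]
        linarith
      · have := Finset.card_le_card hT
        rw [Finset.card_singleton] at this
        omega
  · obtain ⟨s, hs⟩ : ∃ s, Nat.sqrt n = s + 1 := ⟨Nat.sqrt n - 1, by omega⟩
    have hle : s * (s + 2) ≤ n := by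
      have := Nat.sqrt_le n
      rw [hs] at this
      nlinarith
    rw [hs] at hlt
    obtain ⟨S, hScard, hS⟩ := exists_card_eq_forall_subset_card_lt (t := 2 * c + 1)
      (finProdFinEquiv.toEmbedding.trans (Fin.castLEEmb hle)) 𝒯 (by omega) (by
        calc 𝒯.card ≤ n ^ c := h𝒯
          _ ≤ ((s + 2) ^ 2) ^ c := Nat.pow_le_pow_left hlt.le c
          _ = (s + 2) ^ (2 * c) := (pow_mul _ _ _).symm
          _ < (s + 2) ^ (2 * c + 1) := Nat.pow_lt_pow_right (by omega) (by omega))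
    refine ⟨S, ?_, fun T hT hTS => Nat.le_of_lt_succ (hS T hT hTS)⟩
    have h1 : (1 : ℝ) ≤ s := by exact_mod_cast (by omega : 1 ≤ s)
    rw [hs] at hsqrt
    push_cast at hsqrt
    rw [hScard]
    linarith

theorem stmt_6 (q c : ℕ) (hq : IsPrimePow q) (hc : 1 ≤ c)
    (F : Type) [Field F] [Fintype F] (hF : Fintype.card F = q) :
    ∃ α : ℝ, 0 < α ∧
      ∀ (n : ℕ) (f : MvPolynomial (Fin n) F),
        (∀ m ∈ f.support, ∀ i, m i ≤ q - 1) →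
        f.support.card ≤ n ^ c →
        ∃ U : Submodule F (Fin n → F),
          α * Real.sqrt n ≤ (Module.finrank F ↥U : ℝ) ∧
          restDegLE F n f 0 U (2 * (q - 1) * c) := by
  refine ⟨1 / 4, by norm_num, fun n f hf hcard => ?_⟩
  obtain ⟨S, hScard, hS⟩ := exists_sqrt_le_card_forall_subset_card_le hc
    (f.support.image Finsupp.support) (Finset.card_image_le.trans hcard)
  refine ⟨_, (finrank_span_single F S).symm ▸ hScard, ?_⟩
  rw [show 2 * (q - 1) * c = (q - 1) * (2 * c) by ring]
  exact restDegLE_span_single f S _ _ hf fun m hm =>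
    hS _ (Finset.mem_image_of_mem _ hm)
end

section
/- There exist constants c > 0 and c' > 0 such that the following holds. For all integers n and d with 2 ≤ d < n/2, there exists a polynomial f : F_2^n → F_2 of total degree at most d such that for every affine subspace u₀ + U ⊆ F_2^n of dimension k with k ≥ c · d · n^{1/(d-1)}, the bias of f on u₀ + U satisfies |2^{-k} · Σ_{x ∈ u₀+U} (-1)^{f(x)}| ≤ 2^{-c' · k / d}. -/
open MvPolynomial

/-- The coset `u₀ + U` of a linear subspace `U`, as a finset. -/
noncomputable def cosetFinset {F : Type} [Field F] [Fintype F] {n : ℕ}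
    (u₀ : Fin n → F) (U : Submodule F (Fin n → F)) : Finset (Fin n → F) :=
  (Set.toFinite {x : Fin n → F | ∃ u ∈ U, x = u₀ + u}).toFinset

/-- Few subsets of a set of size `16 * s` have fewer than `s` elements. -/
lemma card_filter_card_lt_le (s : ℕ) :
    (Finset.univ.filter fun T : Finset (Fin (16 * s)) => T.card < s).card ≤ 64 ^ s := by
  have h1 := Fin.sum_pow_mul_eq_add_pow (n := 16 * s) (R := ℕ) 1 8
  have h2 : (Finset.univ.filter fun T : Finset (Fin (16 * s)) => T.card < s).card * 8 ^ (15 * s)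
      ≤ (1 + 8) ^ (16 * s) := by
    rw [← h1, ← smul_eq_mul, ← Finset.sum_const]
    refine (Finset.sum_le_sum fun T hT => ?_).trans
      (Finset.sum_le_sum_of_subset (Finset.filter_subset _ _))
    have := (Finset.mem_filter.1 hT).2
    rw [one_pow, one_mul]
    exact Nat.pow_le_pow_right (by norm_num) (by omega)
  have h3 : (1 + 8) ^ (16 * s) ≤ 64 ^ s * 8 ^ (15 * s) := by
    rw [pow_mul, pow_mul, ← mul_pow]
    exact Nat.pow_le_pow_left (by norm_num) s
  exact Nat.le_of_mul_le_mul_right (h2.trans h3) (by positivity)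

/-- The values at the indicator vector of `z` of all squarefree monomials of degree `e`. -/
def monomialVec {α : Type} [DecidableEq α] (e : ℕ) (z : Finset α) :
    {S : Finset α // S.card = e} → ZMod 2 :=
  fun S => if S.1 ⊆ z then 1 else 0

lemma choose_le_finrank_of_shatters {α : Type} [Fintype α] [DecidableEq α] (e : ℕ)
    (A : Submodule (ZMod 2) ({S : Finset α // S.card = e} → ZMod 2)) (𝒜 : Finset (Finset α))
    (h𝒜 : ∀ z ∈ 𝒜, monomialVec e z ∈ A) (T : Finset α) (hT : 𝒜.Shatters T) :
    T.card.choose e ≤ Module.finrank (ZMod 2) A := by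
  have key : ∀ S : T.powersetCard e, ∃ u ∈ 𝒜, T ∩ u = S.1 := fun S =>
    hT (Finset.mem_powersetCard.1 S.2).1
  choose u hu huT using key
  let b : T.powersetCard e → A := fun S => ⟨monomialVec e (u S), h𝒜 _ (hu S)⟩
  have hb : ∀ S S' : T.powersetCard e,
      (b S).1 ⟨S'.1, (Finset.mem_powersetCard.1 S'.2).2⟩ = if S = S' then 1 else 0 := by
    intro S S'
    obtain ⟨hS1, hS2⟩ := Finset.mem_powersetCard.1 S.2
    obtain ⟨hS1', hS2'⟩ := Finset.mem_powersetCard.1 S'.2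
    have : S'.1 ⊆ u S ↔ S = S' := by
      constructor
      · intro h
        have h' : S'.1 ⊆ S.1 := huT S ▸ Finset.subset_inter hS1' h
        exact Subtype.ext (Finset.eq_of_subset_of_card_le h' (by omega)).symm
      · rintro rfl
        conv_lhs => rw [← huT S]
        exact Finset.inter_subset_right
    simp [b, monomialVec, this]
  have hli : LinearIndependent (ZMod 2) b := by
    rw [Fintype.linearIndependent_iff]
    intro g hg S'
    have := congrFun (congrArg Subtype.val hg) ⟨S'.1, (Finset.mem_powersetCard.1 S'.2).2⟩
    simpa [Finset.sum_apply, hb] using this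
  have := hli.fintype_card_le_finrank
  rwa [Fintype.card_coe, Finset.card_powersetCard] at this

lemma card_monomialVec_mem_le (s e : ℕ)
    (A : Submodule (ZMod 2) ({S : Finset (Fin (16 * s)) // S.card = e} → ZMod 2))
    [DecidablePred fun z => monomialVec e z ∈ A]
    (hA : Module.finrank (ZMod 2) A < s.choose e) :
    (Finset.univ.filter fun z : Finset (Fin (16 * s)) => monomialVec e z ∈ A).card ≤ 64 ^ s := by
  refine (Finset.card_le_card_shatterer _).trans (le_trans (Finset.card_le_card fun T hT => ?_)
    (card_filter_card_lt_le s))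
  rw [Finset.mem_shatterer] at hT
  have h := choose_le_finrank_of_shatters e A _ (fun z hz => (Finset.mem_filter.1 hz).2) T hT
  simp only [Finset.mem_filter, Finset.mem_univ, true_and]
  by_contra hs
  exact absurd (hA.trans_le (Nat.choose_le_choose e (not_lt.1 hs))) (not_lt.2 h)

/-- If few vectors `w z` lie in any given subspace of small dimension, then the span of `t` random
such vectors is rarely of small dimension. -/
lemma sum_half_pow_finrank_sup_span_le {Z W : Type} [Fintype Z] [AddCommGroup W]
    [Module (ZMod 2) W] [Module.Finite (ZMod 2) W] (w : Z → W) (h r : ℕ) (p q : ℝ)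
    (hp : ∀ A : Submodule (ZMod 2) W, Module.finrank (ZMod 2) A < r →
      ((Nat.card {z // w z ∈ A} : ℕ) : ℝ) ≤ p * Fintype.card Z)
    (hq : p + (1 / 2) ^ h ≤ q) (hq0 : 0 ≤ q) (t : ℕ) (A : Submodule (ZMod 2) W) :
    ∑ z : Fin t → Z,
        (1 / 2 : ℝ) ^ (h * Module.finrank (ZMod 2) ↥(A ⊔ Submodule.span (ZMod 2) (Set.range (w ∘ z))))
      ≤ (Fintype.card Z : ℝ) ^ t *
        ((1 / 2) ^ (h * r) + q ^ t * (1 / 2) ^ (h * Module.finrank (ZMod 2) A)) := by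
  classical
  induction t generalizing A with
  | zero =>
    rw [Fintype.sum_unique, Set.range_eq_empty, Submodule.span_empty, sup_bot_eq]
    simp
  | succ t ih =>
    by_cases hA : r ≤ Module.finrank (ZMod 2) A
    · calc _ ≤ ∑ z : Fin (t + 1) → Z, (1 / 2 : ℝ) ^ (h * r) := by
            refine Finset.sum_le_sum fun z _ => ?_
            refine pow_le_pow_of_le_one (by norm_num) (by norm_num) (Nat.mul_le_mul_left _ ?_)
            exact hA.trans (Submodule.finrank_mono le_sup_left)
        _ = (Fintype.card Z : ℝ) ^ (t + 1) * (1 / 2) ^ (h * r) := by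
            simp
        _ ≤ _ := by
            gcongr
            have : 0 ≤ q ^ (t + 1) * (1 / 2) ^ (h * Module.finrank (ZMod 2) A) := by positivity
            linarith
    · push Not at hA
      rw [← (Fin.consEquiv fun _ => Z).sum_comp, Fintype.sum_prod_type]
      have step : ∀ z : Z, (1 / 2 : ℝ) ^ (h * Module.finrank (ZMod 2)
          ↥(A ⊔ Submodule.span (ZMod 2) {w z})) ≤
          (1 / 2) ^ (h * Module.finrank (ZMod 2) A) *
            ((if w z ∈ A then 1 else 0) + (1 / 2) ^ h) := by
        intro z
        split_ifs with hz
        · have hle : A ≤ A ⊔ Submodule.span (ZMod 2) {w z} := le_sup_left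
          have h1 : (1 / 2 : ℝ) ^ (h * Module.finrank (ZMod 2)
              ↥(A ⊔ Submodule.span (ZMod 2) {w z})) ≤
              (1 / 2) ^ (h * Module.finrank (ZMod 2) A) :=
            pow_le_pow_of_le_one (by norm_num) (by norm_num)
              (Nat.mul_le_mul_left _ (Submodule.finrank_mono hle))
          refine h1.trans (le_mul_of_one_le_right (by positivity) ?_)
          have : (0 : ℝ) < (1 / 2) ^ h := by positivity
          linarith
        · rw [zero_add, ← pow_add, ← Nat.mul_succ]
          refine pow_le_pow_of_le_one (by norm_num) (by norm_num) (Nat.mul_le_mul_left _ ?_)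
          refine Nat.succ_le_of_lt (Submodule.finrank_lt_finrank_of_lt ?_)
          rw [lt_iff_le_and_ne]
          refine ⟨le_sup_left, fun heq => hz ?_⟩
          rw [heq]
          exact Submodule.mem_sup_right (Submodule.mem_span_singleton_self _)
      have hsum : ∑ z : Z, (1 / 2 : ℝ) ^ (h * Module.finrank (ZMod 2)
          ↥(A ⊔ Submodule.span (ZMod 2) {w z})) ≤
          (1 / 2) ^ (h * Module.finrank (ZMod 2) A) * (q * Fintype.card Z) := by
        refine (Finset.sum_le_sum fun z _ => step z).trans ?_
        rw [← Finset.mul_sum, Finset.sum_add_distrib, Finset.sum_boole]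
        have := hp A hA
        rw [Nat.card_eq_fintype_card, Fintype.card_subtype] at this
        gcongr
        simp only [Finset.sum_const, Finset.card_univ, nsmul_eq_mul]
        nlinarith [Nat.cast_nonneg (α := ℝ) (Fintype.card Z)]
      calc _ = ∑ z : Z, ∑ y : Fin t → Z, (1 / 2 : ℝ) ^ (h * Module.finrank (ZMod 2)
            ↥((A ⊔ Submodule.span (ZMod 2) {w z}) ⊔
              Submodule.span (ZMod 2) (Set.range (w ∘ y)))) := by
            refine Finset.sum_congr rfl fun z _ => Finset.sum_congr rfl fun y _ => ?_
            have : Set.range (w ∘ (Fin.consEquiv fun _ => Z) (z, y)) =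
                insert (w z) (Set.range (w ∘ y)) := by
              rw [Set.range_comp, Set.range_comp]
              simp [Fin.consEquiv, Fin.range_cons, Set.image_insert_eq]
            rw [this, Submodule.span_insert, sup_assoc]
        _ ≤ ∑ z : Z, (Fintype.card Z : ℝ) ^ t * ((1 / 2) ^ (h * r) + q ^ t *
            (1 / 2) ^ (h * Module.finrank (ZMod 2) ↥(A ⊔ Submodule.span (ZMod 2) {w z}))) :=
            Finset.sum_le_sum fun z _ => ih _
        _ = (Fintype.card Z : ℝ) ^ t * (Fintype.card Z * (1 / 2) ^ (h * r) + q ^ t *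
            ∑ z : Z, (1 / 2) ^ (h * Module.finrank (ZMod 2)
              ↥(A ⊔ Submodule.span (ZMod 2) {w z}))) := by
            rw [← Finset.mul_sum, Finset.sum_add_distrib, ← Finset.mul_sum]
            simp
        _ ≤ (Fintype.card Z : ℝ) ^ t * (Fintype.card Z * (1 / 2) ^ (h * r) + q ^ t *
            ((1 / 2) ^ (h * Module.finrank (ZMod 2) A) * (q * Fintype.card Z))) := by
            gcongr
        _ = _ := by ring
lemma natCard_forall_sum_smul_eq_zero {Z W : Type} [Fintype Z] [AddCommGroup W]
    [Module (ZMod 2) W] (w : Z → W) (h t : ℕ) :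
    ((Nat.card {x : Fin t → (Fin h → ZMod 2) × Z // ∀ j, ∑ i, (x i).1 j • w (x i).2 = 0} : ℕ) : ℝ)
      = 2 ^ (h * t) * ∑ z : Fin t → Z,
        (1 / 2 : ℝ) ^ (h * Module.finrank (ZMod 2) (Submodule.span (ZMod 2) (Set.range (w ∘ z)))) := by
  let K : (Fin t → Z) → Submodule (ZMod 2) (Fin t → ZMod 2) := fun z =>
    LinearMap.ker (Fintype.linearCombination (ZMod 2) (w ∘ z))
  let E : {x : Fin t → (Fin h → ZMod 2) × Z // ∀ j, ∑ i, (x i).1 j • w (x i).2 = 0} ≃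
      Σ z : Fin t → Z, (Fin h → K z) :=
    { toFun := fun x => ⟨fun i => (x.1 i).2, fun j => ⟨fun i => (x.1 i).1 j, x.2 j⟩⟩
      invFun := fun x => ⟨fun i => (fun j => (x.2 j).1 i, x.1 i), fun j => (x.2 j).2⟩
      left_inv := fun x => rfl
      right_inv := fun x => rfl }
  rw [Nat.card_congr E, Nat.card_sigma, Nat.cast_sum, Finset.mul_sum]
  refine Finset.sum_congr rfl fun z _ => ?_
  have h1 : Nat.card (K z) = 2 ^ Module.finrank (ZMod 2) (K z) := by
    rw [Module.natCard_eq_pow_finrank (K := ZMod 2), Nat.card_zmod]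
  have h2 := LinearMap.finrank_range_add_finrank_ker (Fintype.linearCombination (ZMod 2) (w ∘ z))
  rw [Fintype.range_linearCombination, Module.finrank_fin_fun] at h2
  rw [Nat.card_fun, h1, Nat.card_eq_fintype_card, Fintype.card_fin]
  have h3 : h * t = h * Module.finrank (ZMod 2) (Submodule.span (ZMod 2) (Set.range (w ∘ z))) +
      h * Module.finrank (ZMod 2) (K z) := by rw [← mul_add, h2]
  push_cast
  rw [h3, pow_add, mul_right_comm, ← mul_pow, ← pow_mul, mul_comm _ h]
  norm_num

/-- The character `(-1) ^ a` of `ZMod 2`, with real values. -/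
noncomputable def signChar (a : ZMod 2) : ℝ := if a = 0 then 1 else -1

lemma signChar_add (a b : ZMod 2) : signChar (a + b) = signChar a * signChar b := by
  have h01 : ∀ a : ZMod 2, a = 0 ∨ a = 1 := by decide
  have h11 : (1 : ZMod 2) + 1 = 0 := by decide
  rcases h01 a with rfl | rfl <;> rcases h01 b with rfl | rfl <;> simp [signChar, h11]

lemma prod_signChar {ι : Type} (s : Finset ι) (g : ι → ZMod 2) :
    ∏ i ∈ s, signChar (g i) = signChar (∑ i ∈ s, g i) := by
  classical
  induction s using Finset.induction_on with
  | empty => simp [signChar]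
  | insert a s ha ih => rw [Finset.prod_insert ha, Finset.sum_insert ha, signChar_add, ih]

open Classical in
lemma sum_signChar_linearMap {P : Type} [Fintype P] [AddCommGroup P] [Module (ZMod 2) P]
    (l : P →ₗ[ZMod 2] ZMod 2) :
    ∑ f, signChar (l f) = if l = 0 then (Fintype.card P : ℝ) else 0 := by
  split_ifs with h
  · simp [h, signChar]
  · obtain ⟨f₀, hf₀⟩ : ∃ f, l f ≠ 0 := by
      by_contra! hc
      exact h (LinearMap.ext hc)
    have h1 : ∑ f, signChar (l f) = ∑ f, signChar (l (f + f₀)) :=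
      (Equiv.sum_comp (Equiv.addRight f₀) fun f => signChar (l f)).symm
    have h2 : signChar (l f₀) = -1 := by simp [signChar, hf₀]
    simp only [map_add, signChar_add, h2, ← Finset.sum_mul] at h1
    linarith

lemma sum_pow_sum_signChar {P X : Type} [Fintype P] [AddCommGroup P] [Module (ZMod 2) P]
    [Fintype X] (l : X → P →ₗ[ZMod 2] ZMod 2) (t : ℕ) :
    ∑ f, (∑ x, signChar (l x f)) ^ t =
      Fintype.card P * (Nat.card {x : Fin t → X // ∑ i, l (x i) = 0} : ℕ) := by
  classical
  simp only [Fintype.sum_pow, prod_signChar]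
  rw [Finset.sum_comm, Nat.card_eq_fintype_card, Fintype.card_subtype]
  have : ∀ x : Fin t → X, ∑ f, signChar (∑ i, l (x i) f) =
      if ∑ i, l (x i) = 0 then (Fintype.card P : ℝ) else 0 := by
    intro x
    rw [← sum_signChar_linearMap]
    simp
  rw [Finset.sum_congr rfl fun x _ => this x, ← Finset.sum_filter, Finset.sum_const,
    nsmul_eq_mul, mul_comm]

/-- Moment bound for the signed sums of a random element of a space of functions on
`(Fin h → ZMod 2) × Finset (Fin (16 * s))` which contains all products of a linear coordinate and
a squarefree monomial of degree `e` in the remaining variables. -/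
lemma sum_pow_sum_signChar_le {P : Type} [Fintype P] [AddCommGroup P] [Module (ZMod 2) P]
    (h s e r t : ℕ) (l : (Fin h → ZMod 2) × Finset (Fin (16 * s)) → P →ₗ[ZMod 2] ZMod 2)
    (hl : ∀ (j : Fin h) (S : Finset (Fin (16 * s))), S.card = e →
      ∃ f, ∀ x, l x f = x.1 j * (if S ⊆ x.2 then 1 else 0))
    (hr : r ≤ s.choose e) (hs : 1 ≤ s) (hh : 16 * s ≤ h) :
    ∑ f, (∑ x, signChar (l x f)) ^ t ≤
      Fintype.card P * (2 ^ ((h + 16 * s) * t) * ((1 / 2) ^ (h * r) + (1 / 2) ^ (9 * s * t))) := by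
  classical
  rw [sum_pow_sum_signChar]
  refine mul_le_mul_of_nonneg_left ?_ (Nat.cast_nonneg _)
  let w : Finset (Fin (16 * s)) → ({S : Finset (Fin (16 * s)) // S.card = e} → ZMod 2) :=
    monomialVec e
  have hcard : Nat.card {x : Fin t → (Fin h → ZMod 2) × Finset (Fin (16 * s)) //
      ∑ i, l (x i) = 0} ≤ Nat.card {x : Fin t → (Fin h → ZMod 2) × Finset (Fin (16 * s)) //
      ∀ j, ∑ i, (x i).1 j • w (x i).2 = 0} := by
    refine Nat.card_le_card_of_injective (Subtype.map id fun x hx j => ?_)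
      (Subtype.map_injective _ Function.injective_id)
    ext S
    obtain ⟨f, hf⟩ := hl j S.1 S.2
    have := LinearMap.congr_fun hx f
    simpa [LinearMap.sum_apply, hf, Finset.sum_apply, w, monomialVec] using this
  refine (Nat.cast_le.2 hcard).trans ?_
  rw [natCard_forall_sum_smul_eq_zero]
  have hZ : (Fintype.card (Finset (Fin (16 * s))) : ℝ) = 2 ^ (16 * s) := by simp
  have hbound := sum_half_pow_finrank_sup_span_le w h r ((1 / 2) ^ (10 * s)) ((1 / 2) ^ (9 * s))
    (fun A hA => by
      rw [Nat.card_eq_fintype_card, Fintype.card_subtype, hZ]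
      refine (Nat.cast_le.2 (card_monomialVec_mem_le s e A (hA.trans_le hr))).trans (le_of_eq ?_)
      rw [pow_mul, pow_mul, ← mul_pow]
      norm_num)
    (by
      have h1 : (1 / 2 : ℝ) ^ h ≤ (1 / 2) ^ (10 * s) :=
        pow_le_pow_of_le_one (by norm_num) (by norm_num) (by omega)
      have h2 : (1 / 2 : ℝ) ^ (10 * s) ≤ (1 / 2) ^ (9 * s + 1) :=
        pow_le_pow_of_le_one (by norm_num) (by norm_num) (by omega)
      rw [pow_succ] at h2
      linarith) (by positivity) t ⊥
  have hbot : ∀ B : Submodule (ZMod 2) ({S : Finset (Fin (16 * s)) // S.card = e} → ZMod 2),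
      Module.finrank (ZMod 2) ↥(⊥ ⊔ B) = Module.finrank (ZMod 2) B := fun B => by
    rw [bot_sup_eq]
  simp only [hbot, finrank_bot, mul_zero, pow_zero, mul_one, hZ] at hbound
  rw [add_mul, pow_add, mul_assoc, pow_mul 2 (16 * s) t, pow_mul _ (9 * s) t]
  gcongr

/-- The functions on `F₂ⁿ` of degree at most `d`. -/
noncomputable def lowDegreeFunctions (n d : ℕ) :
    Submodule (ZMod 2) ((Fin n → ZMod 2) → ZMod 2) :=
  (restrictTotalDegree (Fin n) (ZMod 2) d).map
    (LinearMap.pi fun x => (aeval x : MvPolynomial (Fin n) (ZMod 2) →ₐ[ZMod 2] ZMod 2).toLinearMap)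

lemma mem_lowDegreeFunctions {n d : ℕ} {F : (Fin n → ZMod 2) → ZMod 2} :
    F ∈ lowDegreeFunctions n d ↔
      ∃ f : MvPolynomial (Fin n) (ZMod 2), f.totalDegree ≤ d ∧ ∀ x, eval x f = F x := by
  simp [lowDegreeFunctions, Submodule.mem_map, mem_restrictTotalDegree, funext_iff, aeval_eq_eval]

lemma exists_affine_polynomial {n : ℕ} (φ : (Fin n → ZMod 2) →ₗ[ZMod 2] ZMod 2)
    (u : Fin n → ZMod 2) :
    ∃ f : MvPolynomial (Fin n) (ZMod 2), f.totalDegree ≤ 1 ∧ ∀ x, eval x f = φ (x - u) := by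
  refine ⟨∑ i, C (φ (Pi.single i 1)) * X i - C (φ u), ?_, fun x => ?_⟩
  · refine (totalDegree_sub_C_le _ _).trans (totalDegree_finsetSum_le fun i _ => ?_)
    refine (totalDegree_mul _ _).trans ?_
    simp
  · rw [map_sub φ]
    have : φ x = ∑ i, φ (Pi.single i 1) * x i := by
      conv_lhs => rw [LinearMap.pi_apply_eq_sum_univ φ x]
      refine Finset.sum_congr rfl fun i _ => ?_
      rw [smul_eq_mul, mul_comm]
      congr 2
      ext j
      simp [Pi.single_apply, eq_comm]
    simp [this]

/-- A vector over `F₂`, encoded by its first coordinates and the support of the remaining ones. -/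
def coordEquiv (h m : ℕ) : (Fin h → ZMod 2) × Finset (Fin m) ≃ (Fin h ⊕ Fin m → ZMod 2) where
  toFun x := Sum.elim x.1 fun i => if i ∈ x.2 then 1 else 0
  invFun c := (c ∘ Sum.inl, Finset.univ.filter fun i => c (Sum.inr i) = 1)
  left_inv x := by
    ext <;> simp
  right_inv c := by
    have h01 : ∀ a : ZMod 2, a = 0 ∨ a = 1 := by decide
    ext i
    rcases i with i | i
    · simp
    · rcases h01 (c (Sum.inr i)) with hc | hc <;> simp [hc]

/-- The points of the affine subspace through `u` spanned by `v`. -/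
noncomputable def affinePoint {n h m : ℕ} (u : Fin n → ZMod 2)
    (v : Fin h ⊕ Fin m → Fin n → ZMod 2) (x : (Fin h → ZMod 2) × Finset (Fin m)) :
    Fin n → ZMod 2 :=
  u + Fintype.linearCombination (ZMod 2) v (coordEquiv h m x)

lemma exists_lowDegreeFunctions_affinePoint {n h m d : ℕ} (u : Fin n → ZMod 2)
    (v : Fin h ⊕ Fin m → Fin n → ZMod 2) (hv : LinearIndependent (ZMod 2) v) (j : Fin h)
    (S : Finset (Fin m)) (hS : S.card + 1 ≤ d) :
    ∃ F : lowDegreeFunctions n d, ∀ x,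
      F.1 (affinePoint u v x) = x.1 j * (if S ⊆ x.2 then 1 else 0) := by
  obtain ⟨g, hg⟩ := LinearMap.exists_leftInverse_of_injective
    (Fintype.linearCombination (ZMod 2) v)
    (LinearMap.ker_eq_bot.2 (linearIndependent_iff_injective_fintypeLinearCombination.1 hv))
  choose p hp1 hp2 using fun c => exists_affine_polynomial (LinearMap.proj c ∘ₗ g) u
  have hpe : ∀ c x, eval (affinePoint u v x) (p c) = coordEquiv h m x c := by
    intro c x
    have := congrFun (LinearMap.congr_fun hg (coordEquiv h m x)) c
    simpa [hp2, affinePoint] using this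
  refine ⟨⟨fun x => eval x (p (Sum.inl j) * ∏ i ∈ S, p (Sum.inr i)),
    mem_lowDegreeFunctions.2 ⟨_, ?_, fun x => rfl⟩⟩, fun x => ?_⟩
  · refine (totalDegree_mul _ _).trans ?_
    have h1 : (∏ i ∈ S, p (Sum.inr i)).totalDegree ≤ S.card := by
      refine (totalDegree_finsetProd _ _).trans ((Finset.sum_le_sum fun i _ => hp1 _).trans ?_)
      simp
    have h2 := hp1 (Sum.inl j)
    omega
  · simp only [map_mul, map_prod, hpe]
    congr 1
    simp [coordEquiv, Finset.prod_ite_zero, Finset.subset_iff]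

lemma sum_cosetFinset_eq {n h m : ℕ} (u : Fin n → ZMod 2)
    (U : Submodule (ZMod 2) (Fin n → ZMod 2)) (b : Module.Basis (Fin h ⊕ Fin m) (ZMod 2) U)
    (g : (Fin n → ZMod 2) → ℝ) :
    ∑ x ∈ cosetFinset u U, g x = ∑ x, g (affinePoint u (fun i => (b i : Fin n → ZMod 2)) x) := by
  classical
  have hli : LinearIndependent (ZMod 2) fun i => (b i : Fin n → ZMod 2) :=
    b.linearIndependent.map' U.subtype (Submodule.ker_subtype U)
  have hinj := linearIndependent_iff_injective_fintypeLinearCombination.1 hli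
  symm
  refine Finset.sum_bij (fun x _ => affinePoint u (fun i => (b i : Fin n → ZMod 2)) x)
    (fun x _ => ?_) (fun x _ y _ hxy => ?_) (fun y hy => ?_) (fun _ _ => rfl)
  · simp only [cosetFinset, Set.Finite.mem_toFinset, Set.mem_ofPred_eq]
    refine ⟨_, ?_, rfl⟩
    rw [Fintype.linearCombination_apply]
    exact Submodule.sum_mem _ fun i _ => U.smul_mem _ (b i).2
  · exact (coordEquiv h m).injective (hinj (add_left_cancel hxy))
  · simp only [cosetFinset, Set.Finite.mem_toFinset, Set.mem_ofPred_eq] at hy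
    obtain ⟨w, hw, rfl⟩ := hy
    refine ⟨(coordEquiv h m).symm (b.repr ⟨w, hw⟩), Finset.mem_univ _, ?_⟩
    have := congrArg Subtype.val (b.sum_repr ⟨w, hw⟩)
    simp only [affinePoint, Equiv.apply_symm_apply, Fintype.linearCombination_apply]
    congr 1
    simpa only [AddSubmonoidClass.coe_finsetSum, Submodule.coe_smul] using this

lemma eight_mul_le_choose {n d k : ℕ} (hd : 2 ≤ d) (hn : 1 ≤ n)
    (hk : 1024 * (d : ℝ) * (n : ℝ) ^ ((1 : ℝ) / ((d : ℝ) - 1)) ≤ k) :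
    8 * n ≤ (k / 32).choose (d - 1) ∧ 32 ≤ k := by
  obtain ⟨e, rfl⟩ : ∃ e, d = e + 1 := ⟨d - 1, by omega⟩
  have he : 1 ≤ e := by omega
  have he' : (1 : ℝ) ≤ e := by exact_mod_cast he
  have hn' : (1 : ℝ) ≤ n := by exact_mod_cast hn
  set x : ℝ := (n : ℝ) ^ ((1 : ℝ) / (((e + 1 : ℕ) : ℝ) - 1)) with hx
  have hx1 : 1 ≤ x := Real.one_le_rpow hn' (by push_cast; rw [add_sub_cancel_right]; positivity)
  have hxe : x ^ e = n := by
    rw [hx, ← Real.rpow_natCast, ← Real.rpow_mul (by positivity)]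
    push_cast
    rw [add_sub_cancel_right, one_div_mul_cancel (by positivity), Real.rpow_one]
  push_cast at hk
  have hk1024 : (1024 : ℝ) * (e + 1) ≤ k := le_trans (by nlinarith) hk
  have hk' : 1024 * (e + 1) ≤ k := by exact_mod_cast hk1024
  refine ⟨?_, by omega⟩
  rw [Nat.add_sub_cancel]
  have hk1 : k ≤ 128 * (k / 32 + 1 - e) := by omega
  have hk2 : (k : ℝ) ≤ 128 * ((k / 32 + 1 - e : ℕ) : ℝ) := by exact_mod_cast hk1
  have hs : 8 * e * x ≤ ((k / 32 + 1 - e : ℕ) : ℝ) := by nlinarith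
  have hfac : ((e.factorial : ℕ) : ℝ) ≤ (e : ℝ) ^ e := by exact_mod_cast Nat.factorial_le_pow e
  have hpos : (0 : ℝ) < (e.factorial : ℕ) := by exact_mod_cast e.factorial_pos
  have h8 : (8 : ℝ) ≤ 8 ^ e := le_self_pow₀ (by norm_num) (by omega)
  have hc := Nat.pow_le_choose (α := ℝ) e (k / 32)
  rw [div_le_iff₀ hpos] at hc
  have h1 : (8 * e * x) ^ e ≤ ((k / 32 + 1 - e : ℕ) : ℝ) ^ e := by gcongr
  rw [mul_pow, mul_pow, hxe] at h1
  have h2 : (8 * n : ℝ) * (e.factorial : ℕ) ≤ ((k / 32).choose e : ℕ) * (e.factorial : ℕ) := by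
    refine le_trans ?_ (h1.trans hc)
    calc (8 * n : ℝ) * (e.factorial : ℕ) ≤ 8 ^ e * n * (e : ℝ) ^ e := by gcongr
      _ = _ := by ring
  exact_mod_cast le_of_mul_le_mul_right h2 hpos

open Classical in
/-- Few functions of low degree have a large signed sum on a given affine subspace. -/
lemma card_filter_lt_sum_pow_le {n h s e d : ℕ} (hd : e + 1 ≤ d) (hr : 8 * n ≤ s.choose e)
    (hs : 1 ≤ s) (hh : 16 * s ≤ h) (hhs : h ≤ 48 * s) (u : Fin n → ZMod 2)
    (v : Fin h ⊕ Fin (16 * s) → Fin n → ZMod 2) (hv : LinearIndependent (ZMod 2) v)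
    [Fintype (lowDegreeFunctions n d)] :
    ((Finset.univ.filter fun F : lowDegreeFunctions n d =>
        (2 : ℝ) ^ ((h + 16 * s) * (64 * n)) * (1 / 2) ^ (n * (h + 16 * s)) <
          (∑ x, signChar (F.1 (affinePoint u v x))) ^ (64 * n)).card : ℝ) ≤
      Fintype.card (lowDegreeFunctions n d) * (2 * (1 / 2) ^ (3 * n * (h + 16 * s))) := by
  set k := h + 16 * s with hk
  have hmom := sum_pow_sum_signChar_le h s e (8 * n) (64 * n)
    (fun x => LinearMap.proj (affinePoint u v x) ∘ₗ (lowDegreeFunctions n d).subtype)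
    (fun j S hS => exists_lowDegreeFunctions_affinePoint u v hv j S (by omega)) hr hs hh
  simp only [LinearMap.coe_comp, Function.comp_apply, Submodule.coe_subtype,
    LinearMap.proj_apply] at hmom
  have h1 : (1 / 2 : ℝ) ^ (h * (8 * n)) ≤ (1 / 2) ^ (4 * n * k) :=
    pow_le_pow_of_le_one (by norm_num) (by norm_num) (by nlinarith)
  have h2 : (1 / 2 : ℝ) ^ (9 * s * (64 * n)) ≤ (1 / 2) ^ (4 * n * k) :=
    pow_le_pow_of_le_one (by norm_num) (by norm_num) (by nlinarith)
  set B := Finset.univ.filter fun F : lowDegreeFunctions n d =>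
        (2 : ℝ) ^ (k * (64 * n)) * (1 / 2) ^ (n * k) <
          (∑ x, signChar (F.1 (affinePoint u v x))) ^ (64 * n) with hB
  have hmarkov : (B.card : ℝ) * ((2 : ℝ) ^ (k * (64 * n)) * (1 / 2) ^ (n * k)) ≤
      ∑ F : lowDegreeFunctions n d, (∑ x, signChar (F.1 (affinePoint u v x))) ^ (64 * n) := by
    rw [← nsmul_eq_mul, ← Finset.sum_const]
    refine (Finset.sum_le_sum fun F hF => (Finset.mem_filter.1 hF).2.le).trans
      (Finset.sum_le_sum_of_subset_of_nonneg (Finset.subset_univ _) fun F _ _ => ?_)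
    exact Even.pow_nonneg ⟨32 * n, by ring⟩ _
  have hpos : (0 : ℝ) < (2 : ℝ) ^ (k * (64 * n)) * (1 / 2) ^ (n * k) := by positivity
  refine le_of_mul_le_mul_right ((hmarkov.trans hmom).trans ?_) hpos
  calc _ ≤ (Fintype.card (lowDegreeFunctions n d) : ℝ) *
        (2 ^ (k * (64 * n)) * ((1 / 2) ^ (4 * n * k) + (1 / 2) ^ (4 * n * k))) := by gcongr
    _ = _ := by
      have : (1 / 2 : ℝ) ^ (4 * n * k) = (1 / 2) ^ (3 * n * k) * (1 / 2) ^ (n * k) := by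
        rw [← pow_add]
        ring
      rw [this]
      ring

/-- Some function of low degree has small signed sums on all affine subspaces of large dimension. -/
lemma exists_lowDegreeFunctions_sum_pow_le (n d : ℕ) (hd : 2 ≤ d) (hn : 1 ≤ n) :
    ∃ F : lowDegreeFunctions n d, ∀ k ≤ n, 8 * n ≤ (k / 32).choose (d - 1) → 32 ≤ k →
      ∀ (u : Fin n → ZMod 2)
        (v : Fin (k - 16 * (k / 32)) ⊕ Fin (16 * (k / 32)) → Fin n → ZMod 2),
        LinearIndependent (ZMod 2) v →
        (∑ x, signChar (F.1 (affinePoint u v x))) ^ (64 * n) ≤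
          (2 : ℝ) ^ (k * (64 * n)) * (1 / 2) ^ (n * k) := by
  classical
  have : Fintype (lowDegreeFunctions n d) := Fintype.ofFinite _
  by_contra! hcon
  let I := Σ k : Fin (n + 1), (Fin n → ZMod 2) ×
    (Fin (k - 16 * (k / 32)) ⊕ Fin (16 * (k / 32)) → Fin n → ZMod 2)
  let B : I → Finset (lowDegreeFunctions n d) := fun i =>
    if 8 * n ≤ ((i.1 : ℕ) / 32).choose (d - 1) ∧ 32 ≤ (i.1 : ℕ) ∧
      LinearIndependent (ZMod 2) i.2.2 then
      Finset.univ.filter fun F => (2 : ℝ) ^ ((i.1 : ℕ) * (64 * n)) * (1 / 2) ^ (n * (i.1 : ℕ)) <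
        (∑ x, signChar (F.1 (affinePoint i.2.1 i.2.2 x))) ^ (64 * n)
    else ∅
  have hB : ∀ i : I, ((B i).card : ℝ) ≤ Fintype.card (lowDegreeFunctions n d) *
      ((1 / 2) ^ (n * (i.1 + 1)) * (2 * (1 / 2) ^ (3 * n))) := by
    rintro ⟨⟨k, hk⟩, u, v⟩
    simp only [B]
    split_ifs with hi
    · obtain ⟨h1, h2, h3⟩ := hi
      have hkk : k - 16 * (k / 32) + 16 * (k / 32) = k := by omega
      have := card_filter_lt_sum_pow_le (h := k - 16 * (k / 32)) (s := k / 32) (d := d)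
        (e := d - 1) (by omega) h1 (by omega) (by omega)
        (by omega) u v h3
      rw [hkk] at this
      refine this.trans (mul_le_mul_of_nonneg_left ?_ (Nat.cast_nonneg _))
      have : (1 / 2 : ℝ) ^ (3 * n * k) ≤ (1 / 2) ^ (n * (k + 1) + 3 * n) :=
        pow_le_pow_of_le_one (by norm_num) (by norm_num) (by nlinarith)
      rw [pow_add] at this
      linarith
    · simp only [Finset.card_empty, Nat.cast_zero]
      positivity
  have hcover : (Finset.univ : Finset (lowDegreeFunctions n d)) ⊆ Finset.univ.biUnion B := by
    intro F _
    obtain ⟨k, hk, h1, h2, u, v, hv, hlt⟩ := hcon F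
    refine Finset.mem_biUnion.2 ⟨⟨⟨k, by omega⟩, u, v⟩, Finset.mem_univ _, ?_⟩
    simp only [B]
    rw [if_pos ⟨h1, h2, hv⟩]
    exact Finset.mem_filter.2 ⟨Finset.mem_univ _, hlt⟩
  have hle : (Fintype.card (lowDegreeFunctions n d) : ℝ) ≤ ∑ i, ((B i).card : ℝ) := by
    exact_mod_cast (Finset.card_le_card hcover).trans Finset.card_biUnion_le
  have hsum : ∑ i : I, (1 / 2 : ℝ) ^ (n * (i.1 + 1)) * (2 * (1 / 2) ^ (3 * n)) =
      (n + 1) * (2 * (1 / 2) ^ (3 * n)) := by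
    rw [← Finset.sum_mul, Fintype.sum_sigma]
    congr 1
    have : ∀ k : Fin (n + 1), ∑ _y : (Fin n → ZMod 2) ×
        (Fin (k - 16 * (k / 32)) ⊕ Fin (16 * (k / 32)) → Fin n → ZMod 2),
        (1 / 2 : ℝ) ^ (n * ((k : ℕ) + 1)) = 1 := by
      intro k
      have hkk : (k : ℕ) - 16 * (k / 32) + 16 * (k / 32) = k := by omega
      rw [Finset.sum_const, Finset.card_univ, nsmul_eq_mul]
      simp only [Fintype.card_prod, Fintype.card_fun, Fintype.card_sum, Fintype.card_fin,
        ZMod.card, hkk]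
      push_cast
      rw [← pow_mul, ← pow_add, show n + n * (k : ℕ) = n * (k + 1) by ring, ← mul_pow]
      norm_num
    simp only [this]
    simp
  have htot := hle.trans (Finset.sum_le_sum fun i _ => hB i)
  rw [← Finset.mul_sum, hsum] at htot
  have hP : (0 : ℝ) < Fintype.card (lowDegreeFunctions n d) := by
    exact_mod_cast Fintype.card_pos
  have h1 : 1 ≤ ((n : ℝ) + 1) * (2 * (1 / 2) ^ (3 * n)) := le_of_mul_le_mul_left (by linarith) hP
  have h2 : ((n : ℝ) + 1) ≤ 2 ^ n := by exact_mod_cast Nat.lt_two_pow_self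
  have h3 : (2 : ℝ) ≤ 2 ^ n := le_self_pow₀ (by norm_num) (by omega)
  have h4 : (1 / 2 : ℝ) ^ (3 * n) * 2 ^ n * 2 ^ n = (1 / 2) ^ n := by
    have hinv : (1 / 2 : ℝ) ^ n * 2 ^ n = 1 := by
      rw [← mul_pow]
      norm_num
    rw [mul_comm 3 n, pow_mul]
    linear_combination (1 / 2 : ℝ) ^ n * ((1 / 2 : ℝ) ^ n * 2 ^ n + 1) * hinv
  have h5 : (1 / 2 : ℝ) ^ n ≤ 1 / 2 := pow_le_of_le_one (by norm_num) (by norm_num) (by omega)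
  have h6 : ((n : ℝ) + 1) * (2 * (1 / 2) ^ (3 * n)) ≤ 2 ^ n * (2 ^ n * (1 / 2) ^ (3 * n)) := by
    gcongr
  linarith

theorem stmt_8 : ∃ c c' : ℝ, 0 < c ∧ 0 < c' ∧
    ∀ (n d : ℕ), 2 ≤ d → 2 * d < n →
    ∃ f : MvPolynomial (Fin n) (ZMod 2), f.totalDegree ≤ d ∧
      ∀ (k : ℕ) (u₀ : Fin n → ZMod 2) (U : Submodule (ZMod 2) (Fin n → ZMod 2)),
        Module.finrank (ZMod 2) ↥U = k →
        c * (d : ℝ) * (n : ℝ) ^ ((1 : ℝ) / ((d : ℝ) - 1)) ≤ (k : ℝ) →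
        |(2 : ℝ) ^ (-(k : ℝ)) *
            ∑ x ∈ cosetFinset u₀ U, (if eval x f = 0 then (1 : ℝ) else -1)| ≤
          (2 : ℝ) ^ (-(c' * (k : ℝ) / (d : ℝ))) := by
  refine ⟨1024, 1 / 64, by norm_num, by norm_num, fun n d hd hdn => ?_⟩
  obtain ⟨F, hF⟩ := exists_lowDegreeFunctions_sum_pow_le n d hd (by omega)
  obtain ⟨f, hfd, hf⟩ := mem_lowDegreeFunctions.1 F.2
  refine ⟨f, hfd, fun k u₀ U hU hk => ?_⟩
  obtain ⟨hchoose, hk32⟩ := eight_mul_le_choose hd (by omega) hk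
  have hkn : k ≤ n := by
    rw [← hU]
    exact (Submodule.finrank_le U).trans_eq (Module.finrank_fin_fun _)
  let b : Module.Basis (Fin (k - 16 * (k / 32)) ⊕ Fin (16 * (k / 32))) (ZMod 2) U :=
    (Module.finBasisOfFinrankEq (ZMod 2) U (n := k - 16 * (k / 32) + 16 * (k / 32))
      (by omega)).reindex finSumFinEquiv.symm
  have hb := hF k hkn hchoose hk32 u₀ (fun i => (b i : Fin n → ZMod 2))
    (b.linearIndependent.map' U.subtype (Submodule.ker_subtype U))
  rw [← sum_cosetFinset_eq u₀ U b fun x => signChar (F.1 x)] at hb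
  simp only [← hf] at hb
  change (∑ x ∈ cosetFinset u₀ U, if eval x f = 0 then (1 : ℝ) else -1) ^ (64 * n) ≤ _ at hb
  set T := ∑ x ∈ cosetFinset u₀ U, if eval x f = 0 then (1 : ℝ) else -1
  have hn0 : 64 * n ≠ 0 := by omega
  have hsmall : |(2 : ℝ) ^ (-(k : ℝ)) * T| ≤ (2 : ℝ) ^ (-((k : ℝ) / 64)) := by
    refine le_of_pow_le_pow_left₀ hn0 (by positivity) ?_
    rw [Even.pow_abs ⟨32 * n, by ring⟩, mul_pow]
    calc _ ≤ ((2 : ℝ) ^ (-(k : ℝ))) ^ (64 * n) *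
          ((2 : ℝ) ^ (k * (64 * n)) * (1 / 2) ^ (n * k)) := by gcongr
      _ = _ := by
        rw [← Real.rpow_natCast ((2 : ℝ) ^ (-(k : ℝ))), ← Real.rpow_mul (by norm_num),
          ← Real.rpow_natCast 2, one_div, inv_pow, ← Real.rpow_natCast 2,
          ← Real.rpow_neg (by norm_num), ← Real.rpow_add (by norm_num),
          ← Real.rpow_add (by norm_num), ← Real.rpow_natCast ((2 : ℝ) ^ (-((k : ℝ) / 64))),
          ← Real.rpow_mul (by norm_num)]
        congr 1
        push_cast
        ring
  refine hsmall.trans (Real.rpow_le_rpow_of_exponent_le (by norm_num) (neg_le_neg ?_))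
  have hd1 : (1 : ℝ) ≤ d := by exact_mod_cast (by omega : 1 ≤ d)
  calc 1 / 64 * (k : ℝ) / d ≤ 1 / 64 * (k : ℝ) := div_le_self (by positivity) hd1
    _ = (k : ℝ) / 64 := by ring
end

section
/- Let q be a prime power, let f : F_q^n → F_q be any function, and let U ⊆ F_q^n be a linear subspace with basis Δ₁, …, Δ_k. Then there exists a family of polynomials (f_α)_{α ∈ {0,1,…,q-1}^k}, f_α : F_q^n → F_q, such that: (1) for every α ∈ {0,1,…,q-1}^k, deg(f_α) ≤ deg(f) − wt(α), where wt(α) = Σ_i α_i; and (2) for every x ∈ F_q^n, f is identically zero on the coset x + U if and only if f_α(x) = 0 for every α ∈ {0,1,…,q-1}^k. -/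
open MvPolynomial

/-- Substituting polynomials of total degree at most one does not increase the total degree. -/
theorem totalDegree_aeval_le_of_totalDegree_le_one {σ τ R : Type*} [CommSemiring R]
    (g : σ → MvPolynomial τ R) (hg : ∀ i, (g i).totalDegree ≤ 1) (f : MvPolynomial σ R) :
    (aeval g f).totalDegree ≤ f.totalDegree := by
  rw [aeval_def, eval₂_eq]
  refine totalDegree_finsetSum_le fun m hm => ?_
  refine (totalDegree_mul _ _).trans ?_
  rw [algebraMap_eq, totalDegree_C, zero_add]
  refine (totalDegree_finsetProd _ _).trans (le_trans ?_ (le_totalDegree hm))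
  refine Finset.sum_le_sum fun i _ => (totalDegree_pow _ _).trans ?_
  simpa using Nat.mul_le_mul_left (m i) (hg i)

/-- Over a finite field every power map agrees with one of exponent less than the cardinality,
and this exponent need not exceed the original one. -/
theorem exists_reduced_exponent {F : Type*} [Field F] [Fintype F] {q : ℕ}
    (hF : Fintype.card F = q) (m : ℕ) :
    ∃ r : Fin q, (r : ℕ) ≤ m ∧ ∀ y : F, y ^ m = y ^ (r : ℕ) := by
  induction m using Nat.strong_induction_on with
  | _ m ih =>
    have hq : 1 < q := hF ▸ Fintype.one_lt_card
    by_cases hm : m < q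
    · exact ⟨⟨m, hm⟩, le_rfl, fun _ => rfl⟩
    · obtain ⟨r, hr, h⟩ := ih (m - q + 1) (by omega)
      refine ⟨r, by omega, fun y => ?_⟩
      have hy : y ^ q = y := hF ▸ FiniteField.pow_card y
      rw [← h y, pow_succ]
      nth_rw 3 [← hy]
      rw [← pow_add, Nat.sub_add_cancel (not_lt.1 hm)]

/-- A reduced polynomial expression over a finite field vanishes identically if and only if all of
its coefficients do. -/
theorem forall_sum_mul_prod_pow_eq_zero_iff.{u} {F ι : Type u} [Field F] [Fintype F] [Fintype ι]
    [DecidableEq ι] {q : ℕ} (hF : Fintype.card F = q) (c : (ι → Fin q) → F) :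
    (∀ y : ι → F, ∑ α, c α * ∏ j, y j ^ (α j : ℕ) = 0) ↔ ∀ α, c α = 0 := by
  refine ⟨fun h α => ?_, fun h y => by simp [h]⟩
  let e : (ι → Fin q) → ι →₀ ℕ := fun α => Finsupp.equivFunOnFinite.symm fun j => (α j : ℕ)
  have he : Function.Injective e := fun a b hab => by
    ext j
    exact DFunLike.congr_fun hab j
  let G : MvPolynomial ι F := ∑ α, monomial (e α) (c α)
  have hG : G = 0 := by
    refine eq_zero_of_eval_eq_zero _ _ G (fun y => ?_) ?_
    · simpa [G, eval_monomial, Finsupp.prod_fintype, e] using h y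
    · refine Submodule.sum_mem _ fun α _ => ?_
      rw [mem_restrictDegree]
      intro s hs i
      rw [Finset.mem_singleton.1 (support_monomial_subset hs), hF]
      exact Nat.le_sub_one_of_lt (α i).isLt
  simpa [G, coeff_sum, coeff_monomial, he.eq_iff] using congr_arg (coeff (e α)) hG

theorem stmt_9 (q n k : ℕ) (hq : IsPrimePow q)
    (F : Type) [Field F] [Fintype F] (hF : Fintype.card F = q)
    (f : MvPolynomial (Fin n) F) (hf : ∀ m ∈ f.support, ∀ i, m i ≤ q - 1)
    (U : Submodule F (Fin n → F)) (Δ : Fin k → (Fin n → F))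
    (hΔ : LinearIndependent F Δ) (hspan : Submodule.span F (Set.range Δ) = U) :
    ∃ fα : (Fin k → Fin q) → MvPolynomial (Fin n) F,
      (∀ α, fα α = 0 ∨
        ((fα α).totalDegree : ℤ) ≤ (f.totalDegree : ℤ) - ∑ i, ((α i : ℕ) : ℤ)) ∧
      ∀ x : Fin n → F,
        (∀ u ∈ U, eval (x + u) f = 0) ↔ ∀ α, eval x (fα α) = 0 := by
  classical
  choose r hr hpow using exists_reduced_exponent (F := F) hF
  let g : Fin n → MvPolynomial (Fin n ⊕ Fin k) F :=
    fun i => X (Sum.inl i) + ∑ j, C (Δ j i) * X (Sum.inr j)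
  have hg : ∀ i, (g i).totalDegree ≤ 1 := fun i => by
    refine (totalDegree_add _ _).trans (max_le (by simp) ?_)
    refine totalDegree_finsetSum_le fun j _ => (totalDegree_mul _ _).trans ?_
    simp
  let P := aeval g f
  let red : (Fin n ⊕ Fin k →₀ ℕ) → Fin k → Fin q := fun m j => r (m (Sum.inr j))
  let fα : (Fin k → Fin q) → MvPolynomial (Fin n) F := fun α =>
    ∑ m ∈ P.support with red m = α, C (P.coeff m) * ∏ i, X i ^ m (Sum.inl i)
  have hP : ∀ (x : Fin n → F) (y : Fin k → F),
      eval (x + ∑ j, y j • Δ j) f = eval (Sum.elim x y) P := fun x y => by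
    rw [← coe_aeval_eq_eval (Sum.elim x y), RingHom.coe_coe, ← AlgHom.comp_apply, comp_aeval,
      ← coe_aeval_eq_eval, RingHom.coe_coe]
    congr 2
    ext i
    simp [g, mul_comm]
  have hexpand : ∀ (x : Fin n → F) (y : Fin k → F),
      eval (x + ∑ j, y j • Δ j) f = ∑ α, eval x (fα α) * ∏ j, y j ^ (α j : ℕ) := fun x y => by
    rw [hP, eval_eq', ← Finset.sum_fiberwise P.support red]
    refine Finset.sum_congr rfl fun α _ => ?_
    rw [map_sum, Finset.sum_mul]
    refine Finset.sum_congr rfl fun m hm => ?_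
    rw [← (Finset.mem_filter.1 hm).2]
    simp [Fintype.prod_sum_type, red, ← hpow, mul_assoc]
  refine ⟨fα, fun α => ?_, fun x => ?_⟩
  · by_cases hα : (P.support.filter fun m => red m = α).Nonempty
    · right
      have key : ∀ m ∈ P.support, red m = α →
          ∑ i, m (Sum.inl i) + ∑ j, (α j : ℕ) ≤ f.totalDegree := fun m hm hmα => by
        have h := (le_totalDegree hm).trans (totalDegree_aeval_le_of_totalDegree_le_one g hg f)
        rw [Finsupp.sum_fintype _ _ fun _ => rfl, Fintype.sum_sum_type] at h
        refine le_trans (Nat.add_le_add_left (Finset.sum_le_sum fun j _ => ?_) _) h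
        exact hmα ▸ hr _
      have hle : (fα α).totalDegree ≤ f.totalDegree - ∑ j, (α j : ℕ) := by
        refine totalDegree_finsetSum_le fun m hm => (totalDegree_mul _ _).trans ?_
        rw [totalDegree_C, zero_add]
        refine (totalDegree_finsetProd _ _).trans ?_
        simp only [totalDegree_X_pow]
        have := key m (Finset.mem_filter.1 hm).1 (Finset.mem_filter.1 hm).2
        omega
      obtain ⟨m, hm⟩ := hα
      have := key m (Finset.mem_filter.1 hm).1 (Finset.mem_filter.1 hm).2
      rw [← Nat.cast_sum]
      omega
    · left
      simp only [fα, Finset.not_nonempty_iff_eq_empty.1 hα, Finset.sum_empty]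
  · rw [← forall_sum_mul_prod_pow_eq_zero_iff hF, ← hspan]
    simp only [← hexpand, Submodule.mem_span_range_iff_exists_fun, forall_exists_index,
      forall_apply_eq_imp_iff]
end

section
/- Let q be a prime power, let f : F_q^n → F_q be a polynomial of total degree d, and let U ⊆ F_q^n be a linear subspace. Suppose there exists u₀ ∈ F_q^n such that the restriction of f to the affine subspace u₀ + U has degree at most d − 1. Then for every u₁ ∈ F_q^n, the restriction of f to the affine subspace u₁ + U has degree at most d − 1. -/
open MvPolynomial

/-- `A` and `B` have degree at most `m` and the same homogeneous component of degree `m`. -/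
def AgreeInTopDegree {σ R : Type*} [CommRing R] (A B : MvPolynomial σ R) (m : ℕ) : Prop :=
  A.totalDegree ≤ m ∧ B.totalDegree ≤ m ∧ (A = B ∨ (A - B).totalDegree + 1 ≤ m)

namespace AgreeInTopDegree

variable {σ R : Type*} [CommRing R]

theorem one : AgreeInTopDegree (1 : MvPolynomial σ R) 1 0 := by
  simp [AgreeInTopDegree]

theorem mul {A B A' B' : MvPolynomial σ R} {m m' : ℕ} (h : AgreeInTopDegree A B m)
    (h' : AgreeInTopDegree A' B' m') : AgreeInTopDegree (A * A') (B * B') (m + m') := by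
  obtain ⟨hA, hB, hAB⟩ := h
  obtain ⟨hA', hB', hAB'⟩ := h'
  refine ⟨(totalDegree_mul _ _).trans (by lia), (totalDegree_mul _ _).trans (by lia), ?_⟩
  have key : A * A' - B * B' = (A - B) * A' + B * (A' - B') := by ring
  have h₁ := totalDegree_mul (A - B) A'
  have h₂ := totalDegree_mul B (A' - B')
  rcases hAB with rfl | hAB <;> rcases hAB' with rfl | hAB'
  · exact Or.inl rfl
  · right
    rw [key, sub_self, zero_mul, zero_add]
    lia
  · right
    rw [key, sub_self, mul_zero, add_zero]
    lia
  · right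
    rw [key]
    have := totalDegree_add ((A - B) * A') (B * (A' - B'))
    lia

theorem pow {A B : MvPolynomial σ R} {m : ℕ} (h : AgreeInTopDegree A B m) (k : ℕ) :
    AgreeInTopDegree (A ^ k) (B ^ k) (k * m) := by
  induction k with
  | zero => simpa using one
  | succ k ih => simpa only [pow_succ, Nat.succ_mul] using ih.mul h

theorem prod {ι : Type*} (s : Finset ι) {A B : ι → MvPolynomial σ R} {m : ι → ℕ}
    (h : ∀ i ∈ s, AgreeInTopDegree (A i) (B i) (m i)) :
    AgreeInTopDegree (∏ i ∈ s, A i) (∏ i ∈ s, B i) (∑ i ∈ s, m i) := by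
  classical
  induction s using Finset.induction_on with
  | empty => simpa using one
  | insert a s ha ih =>
    simp only [Finset.prod_insert ha, Finset.sum_insert ha]
    exact (h a (by simp)).mul (ih fun i hi => h i (by simp [hi]))

theorem totalDegree_sub_le {A B : MvPolynomial σ R} {m : ℕ} (h : AgreeInTopDegree A B m) :
    (A - B).totalDegree ≤ m - 1 := by
  rcases h.2.2 with rfl | h
  · simp
  · lia

theorem add_C {l : MvPolynomial σ R} (hl : l.totalDegree ≤ 1) (a b : R) :
    AgreeInTopDegree (C a + l) (C b + l) 1 := by
  refine ⟨(totalDegree_add _ _).trans (by simpa using hl),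
    (totalDegree_add _ _).trans (by simpa using hl), Or.inr ?_⟩
  rw [add_sub_add_right_eq_sub, ← C_sub, totalDegree_C]

end AgreeInTopDegree

/-- Substitutions that agree in degree one change a polynomial only in degrees below the top. -/
theorem totalDegree_aeval_sub_aeval_le {σ τ R : Type*} [CommRing R]
    (A B : τ → MvPolynomial σ R) (h : ∀ i, AgreeInTopDegree (A i) (B i) 1)
    (f : MvPolynomial τ R) :
    (aeval A f - aeval B f).totalDegree ≤ f.totalDegree - 1 := by
  rw [aeval_def, aeval_def, eval₂_eq, eval₂_eq, ← Finset.sum_sub_distrib]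
  refine totalDegree_finsetSum_le fun s hs => ?_
  rw [← mul_sub, algebraMap_eq]
  refine (totalDegree_mul _ _).trans ?_
  rw [totalDegree_C, zero_add]
  have hp := AgreeInTopDegree.prod s.support fun i _ => (h i).pow (s i)
  refine hp.totalDegree_sub_le.trans (Nat.sub_le_sub_right ?_ 1)
  simpa [Finsupp.sum] using le_totalDegree hs

theorem stmt_10 (q n d : ℕ) (hq : IsPrimePow q)
    (F : Type) [Field F] [Fintype F] (hF : Fintype.card F = q)
    (f : MvPolynomial (Fin n) F) (hf : f.totalDegree = d)
    (U : Submodule F (Fin n → F))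
    (u₀ : Fin n → F) (h : restDegLE F n f u₀ U (d - 1)) :
    ∀ u₁ : Fin n → F, restDegLE F n f u₁ U (d - 1) := by
  intro u₁ k v hv hU
  obtain ⟨g, hg, hgf⟩ := h k v hv hU
  let L : (Fin n → F) → Fin n → MvPolynomial (Fin k) F :=
    fun u j => C (u j) + ∑ i, X i * C (v i j)
  have hL : ∀ u x, eval x (aeval (L u) f) = eval (u + ∑ i, x i • v i) f := by
    intro u x
    have hx : (fun j => eval x (L u j)) = u + ∑ i, x i • v i := by
      ext j
      simp [L]
    have hC : (eval x).comp C = RingHom.id F := by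
      ext
      simp
    rw [map_aeval, algebraMap_eq, hx, hC]
    rfl
  have hlin : ∀ j, (∑ i, X i * C (v i j) : MvPolynomial (Fin k) F).totalDegree ≤ 1 :=
    fun j => totalDegree_finsetSum_le fun i _ =>
      (totalDegree_mul _ _).trans (by simp)
  refine ⟨g + (aeval (L u₁) f - aeval (L u₀) f), ?_, fun x => ?_⟩
  · refine (totalDegree_add _ _).trans (max_le hg ?_)
    rw [← hf]
    exact totalDegree_aeval_sub_aeval_le _ _
      (fun j => AgreeInTopDegree.add_C (hlin j) _ _) f
  · rw [map_add, map_sub, hL, hL, hgf]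
    ring
end

section
/- There exists a universal constant α > 0 such that the following holds for every prime power q, all positive integers n, d, t, and every ε ≥ 0. Let f : F_q^n → F_q be an affine extractor for dimension ⌊α · n^{1/(d-1)!} / t^e⌋ with bias ε (where e is the base of the natural logarithm). Then for all polynomials g₁, …, g_t : F_q^n → F_q, each of total degree at most d, whose common zero set V = {x ∈ F_q^n : g₁(x) = ⋯ = g_t(x) = 0} is nonempty, the statistical distance between f(X), where X is uniformly distributed on V, and the uniform distribution on F_q is at most ε. -/
open MvPolynomial
open scoped Classical

/-- The distribution of `f x`, for `x` uniform on `S`, is within statistical distance `ε`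
of the uniform distribution on `F`. -/
def CloseToUniform {F : Type} [Fintype F] {D : Type} (f : D → F) (S : Finset D)
    (ε : ℝ) : Prop :=
  ∀ A : Finset F,
    |((S.filter fun x => f x ∈ A).card : ℝ) / (S.card : ℝ) -
        (A.card : ℝ) / (Fintype.card F : ℝ)| ≤ ε

/-- `f` is an affine extractor for dimension `k` with bias `ε`. -/
def AffineExtractor {F : Type} [Field F] [Fintype F] {n : ℕ}
    (f : (Fin n → F) → F) (k : ℕ) (ε : ℝ) : Prop :=
  ∀ (u₀ : Fin n → F) (U : Submodule F (Fin n → F)),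
    Module.finrank F ↥U = k → CloseToUniform f (cosetFinset u₀ U) ε

/-- Total degree, counted jointly in the inner and the outer variables, is at most `D`. -/
def JointDegreeLE {F σ τ : Type*} [CommSemiring F] (D : ℕ)
    (P : MvPolynomial σ (MvPolynomial τ F)) : Prop :=
  ∀ a b, coeff b (coeff a P) ≠ 0 → a.degree + b.degree ≤ D

namespace JointDegreeLE

variable {F σ τ : Type*} [CommSemiring F] {D E : ℕ} {P Q : MvPolynomial σ (MvPolynomial τ F)}

theorem mono (hP : JointDegreeLE D P) (h : D ≤ E) : JointDegreeLE E P :=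
  fun a b hab => (hP a b hab).trans h

theorem add (hP : JointDegreeLE D P) (hQ : JointDegreeLE D Q) : JointDegreeLE D (P + Q) := by
  intro a b h
  rw [coeff_add, coeff_add] at h
  by_cases h' : coeff b (coeff a P) = 0
  · exact hQ a b (by simpa [h'] using h)
  · exact hP a b h'

theorem zero : JointDegreeLE D (0 : MvPolynomial σ (MvPolynomial τ F)) := by
  intro a b h
  simp at h

theorem sum {ι : Type*} (s : Finset ι) (f : ι → MvPolynomial σ (MvPolynomial τ F))
    (h : ∀ i ∈ s, JointDegreeLE D (f i)) : JointDegreeLE D (∑ i ∈ s, f i) :=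
  Finset.sum_induction f (JointDegreeLE D) (fun _ _ => add) zero h

theorem mul (hP : JointDegreeLE D P) (hQ : JointDegreeLE E Q) :
    JointDegreeLE (D + E) (P * Q) := by
  intro a b h
  rw [coeff_mul, coeff_sum] at h
  obtain ⟨x, hx, hne⟩ := Finset.exists_ne_zero_of_sum_ne_zero h
  rw [coeff_mul] at hne
  obtain ⟨y, hy, hne'⟩ := Finset.exists_ne_zero_of_sum_ne_zero hne
  have h₁ := hP x.1 y.1 (left_ne_zero_of_mul hne')
  have h₂ := hQ x.2 y.2 (right_ne_zero_of_mul hne')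
  rw [Finset.HasAntidiagonal.mem_antidiagonal] at hx hy
  rw [← hx, ← hy, map_add, map_add]
  omega

theorem C_C (c : F) : JointDegreeLE 0 (C (C c) : MvPolynomial σ (MvPolynomial τ F)) := by
  intro a b h
  rw [coeff_C] at h
  split_ifs at h with ha
  · rw [coeff_C] at h
    split_ifs at h with hb
    · simp [← ha, ← hb]
    · simp at h
  · simp at h

theorem X_outer (i : σ) : JointDegreeLE 1 (X i : MvPolynomial σ (MvPolynomial τ F)) := by
  intro a b h
  rw [coeff_X] at h
  split_ifs at h with ha
  · rw [coeff_one] at h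
    split_ifs at h with hb
    · simp [← ha, ← hb]
    · simp at h
  · simp at h

theorem C_X (i : τ) : JointDegreeLE 1 (C (X i) : MvPolynomial σ (MvPolynomial τ F)) := by
  intro a b h
  rw [coeff_C] at h
  split_ifs at h with ha
  · rw [coeff_X] at h
    split_ifs at h with hb
    · simp [← ha, ← hb]
    · simp at h
  · simp at h

theorem pow (hP : JointDegreeLE D P) (k : ℕ) : JointDegreeLE (k * D) (P ^ k) := by
  induction k with
  | zero => simpa using C_C (σ := σ) (τ := τ) (1 : F)
  | succ k ih => rw [pow_succ, Nat.succ_mul]; exact ih.mul hP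

theorem prod {ι : Type*} (s : Finset ι) (f : ι → MvPolynomial σ (MvPolynomial τ F)) (e : ι → ℕ)
    (h : ∀ i ∈ s, JointDegreeLE (e i) (f i)) : JointDegreeLE (∑ i ∈ s, e i) (∏ i ∈ s, f i) := by
  induction s using Finset.induction_on with
  | empty => simpa using C_C (σ := σ) (τ := τ) (1 : F)
  | insert i s hi ih =>
    rw [Finset.sum_insert hi, Finset.prod_insert hi]
    exact (h i (Finset.mem_insert_self i s)).mul
      (ih fun j hj => h j (Finset.mem_insert_of_mem hj))

theorem aeval {ι : Type*} {v : ι → MvPolynomial σ (MvPolynomial τ F)}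
    (hv : ∀ i, JointDegreeLE 1 (v i)) (p : MvPolynomial ι F) :
    JointDegreeLE p.totalDegree (MvPolynomial.aeval v p) := by
  rw [aeval_def, eval₂_eq]
  refine sum _ _ fun s hs => ?_
  have h₁ : JointDegreeLE (∑ i ∈ s.support, s i) (∏ i ∈ s.support, v i ^ s i) :=
    prod _ _ _ fun i _ => by simpa using (hv i).pow (s i)
  have h₂ := (C_C (σ := σ) (τ := τ) (coeff s p)).mul h₁
  rw [zero_add] at h₂
  exact h₂.mono (le_totalDegree hs)

theorem totalDegree_coeff_le (hP : JointDegreeLE D P) (a : σ →₀ ℕ) :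
    (coeff a P).totalDegree ≤ D := by
  refine Finset.sup_le fun b hb => ?_
  exact (Nat.le_add_left b.degree a.degree).trans (hP a b (mem_support_iff.mp hb))

theorem coeff_eq_C_of_le (hP : JointDegreeLE D P) {a : σ →₀ ℕ} (ha : D ≤ a.degree) :
    coeff a P = C (coeff 0 (coeff a P)) := by
  ext b
  rw [coeff_C]
  split_ifs with hb
  · rw [hb]
  · by_contra hne
    have h₁ := hP a b hne
    have h₂ : b.degree = 0 := by omega
    exact hb ((Finsupp.degree_eq_zero_iff b).mp h₂).symm

theorem coeff_eq_zero_of_lt (hP : JointDegreeLE D P) {a : σ →₀ ℕ} (ha : D < a.degree) :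
    coeff a P = 0 := by
  ext b
  by_contra hne
  have := hP a b hne
  omega

end JointDegreeLE

/-- Coordinate `j` of the linear map `y ↦ ∑ l, y l • u l`. -/
noncomputable def linSubst {F : Type*} [CommSemiring F] {m n : ℕ} (u : Fin m → Fin n → F)
    (j : Fin n) : MvPolynomial (Fin m) F :=
  ∑ l, C (u l j) * X l

/-- Coordinate `j` of `y ↦ z + ∑ l, y l • u l`, with `z` a generic point. -/
noncomputable def genericSubst {F : Type*} [CommSemiring F] {m n : ℕ} (u : Fin m → Fin n → F)
    (j : Fin n) : MvPolynomial (Fin m) (MvPolynomial (Fin n) F) :=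
  ∑ l, C (C (u l j)) * X l + C (X j)

section Substitution

variable {F : Type*} [CommRing F] {m n : ℕ} (u : Fin m → Fin n → F)

theorem jointDegreeLE_genericSubst (j : Fin n) : JointDegreeLE 1 (genericSubst u j) :=
  (JointDegreeLE.sum _ _ fun l _ => by
    simpa using (JointDegreeLE.C_C (u l j)).mul (JointDegreeLE.X_outer l)).add
      (JointDegreeLE.C_X j)

theorem map_eval_aeval_genericSubst (z : Fin n → F) (p : MvPolynomial (Fin n) F) :
    map (eval z) (aeval (genericSubst u) p) = aeval (fun j => linSubst u j + C (z j)) p := by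
  induction p using MvPolynomial.induction_on with
  | C a =>
    rw [algHom_C, algHom_C]
    change map (eval z) (C (C a)) = C a
    simp
  | add p q hp hq => simp only [map_add, hp, hq]
  | mul_X p i hp => simp [hp, genericSubst, linSubst]

theorem eval_aeval_add_C (z : Fin n → F) (y : Fin m → F) (p : MvPolynomial (Fin n) F) :
    eval y (aeval (fun j => linSubst u j + C (z j)) p) = eval (z + ∑ l, y l • u l) p := by
  induction p using MvPolynomial.induction_on with
  | C a =>
    rw [algHom_C]
    change eval y (C a) = _
    simp
  | add p q hp hq => simp only [map_add, hp, hq]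
  | mul_X p i hp =>
    rw [map_mul, map_mul, map_mul, hp]
    simp [linSubst, mul_comm, add_comm]

/-- If the leading form of `p` vanishes on the span of `u`, then restricting `p` to any translate
of this span lowers the degree. -/
theorem totalDegree_aeval_add_C_le {d : ℕ} {p : MvPolynomial (Fin n) F}
    (hp : p.totalDegree ≤ d + 1)
    (hu : aeval (linSubst u) (homogeneousComponent (d + 1) p) = 0) (z : Fin n → F) :
    (aeval (fun j => linSubst u j + C (z j)) p).totalDegree ≤ d := by
  have key : ∀ a : Fin m →₀ ℕ, d < a.degree → coeff a (aeval (genericSubst u) p) = 0 := by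
    intro a ha
    have hr : (p - homogeneousComponent (d + 1) p).totalDegree ≤ d := by
      refine Finset.sup_le fun s hs => ?_
      rw [mem_support_iff, coeff_sub, coeff_homogeneousComponent] at hs
      change s.degree ≤ d
      split_ifs at hs with h
      · simp at hs
      · have h₁ : s.degree ≤ p.totalDegree :=
          le_totalDegree (mem_support_iff.mpr (by simpa using hs))
        omega
    have h₁ := (JointDegreeLE.aeval (jointDegreeLE_genericSubst u)
      (p - homogeneousComponent (d + 1) p)).coeff_eq_zero_of_lt (hr.trans_lt ha)
    have h₂ := ((JointDegreeLE.aeval (jointDegreeLE_genericSubst u)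
      (homogeneousComponent (d + 1) p)).mono
        (homogeneousComponent_isHomogeneous (d + 1) p).totalDegree_le).coeff_eq_C_of_le ha
    have h₃ := map_eval_aeval_genericSubst u 0 (homogeneousComponent (d + 1) p)
    simp only [Pi.zero_apply, map_zero, add_zero] at h₃
    rw [hu] at h₃
    have h₄ := congrArg (coeff a) h₃
    rw [coeff_map, coeff_zero, h₂, eval_C] at h₄
    rw [h₄, map_zero] at h₂
    rw [map_sub, coeff_sub, h₂, sub_zero] at h₁
    exact h₁
  rw [← map_eval_aeval_genericSubst]
  refine Finset.sup_le fun a ha => ?_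
  change a.degree ≤ d
  by_contra! hlt
  rw [mem_support_iff, coeff_map, key a hlt] at ha
  simp at ha

end Substitution

theorem exists_finset_degree_le (σ : Type*) [Fintype σ] (e : ℕ) :
    ∃ S : Finset (σ →₀ ℕ), S.card ≤ (Fintype.card σ + 1) ^ e ∧ ∀ a, a.degree ≤ e → a ∈ S := by
  induction e with
  | zero =>
    refine ⟨{0}, by simp, fun a ha => ?_⟩
    rw [Finset.mem_singleton, ← Finsupp.degree_eq_zero_iff]
    omega
  | succ e ih =>
    obtain ⟨S, hS, hmem⟩ := ih
    refine ⟨(S ×ˢ (Finset.univ : Finset (Option σ))).image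
      fun x => x.1 + x.2.elim 0 fun i => Finsupp.single i 1, ?_, fun a ha => ?_⟩
    · refine Finset.card_image_le.trans ?_
      rw [Finset.card_product, Finset.card_univ, Fintype.card_option, pow_succ]
      exact Nat.mul_le_mul_right _ hS
    · rw [Finset.mem_image]
      by_cases h0 : a = 0
      · exact ⟨(0, none), by simp [hmem 0 (by simp)], by simp [h0]⟩
      · obtain ⟨i, hi⟩ := Finsupp.ne_iff.mp h0
        have hle : Finsupp.single i 1 ≤ a := by
          rw [Finsupp.single_le_iff]
          exact Nat.one_le_iff_ne_zero.mpr hi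
        have hadd : a - Finsupp.single i 1 + Finsupp.single i 1 = a := tsub_add_cancel_of_le hle
        refine ⟨(a - Finsupp.single i 1, some i), ?_, hadd⟩
        have hdeg := congrArg Finsupp.degree hadd
        rw [map_add, Finsupp.degree_single] at hdeg
        simpa using hmem _ (by omega)

/-- Chevalley–Warning: polynomials without constant term and of small total degree have a common
nontrivial zero. -/
theorem exists_ne_zero_forall_eval_eq_zero {F : Type*} [Field F] [Fintype F] {ι : Type*}
    [Fintype ι] {n : ℕ} (f : ι → MvPolynomial (Fin n) F) (hdeg : ∑ i, (f i).totalDegree < n)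
    (h0 : ∀ i, eval 0 (f i) = 0) : ∃ z, z ≠ 0 ∧ ∀ i, eval z (f i) = 0 := by
  obtain ⟨p, hp⟩ := CharP.exists F
  have hprime : p.Prime := CharP.char_is_prime F p
  have hdvd := char_dvd_card_solutions_of_fintype_sum_lt (K := F) p (f := f) (by simpa using hdeg)
  have hpos : 0 < Fintype.card {x : Fin n → F // ∀ i, eval x (f i) = 0} :=
    Fintype.card_pos_iff.mpr ⟨⟨0, h0⟩⟩
  have hlt : 1 < Fintype.card {x : Fin n → F // ∀ i, eval x (f i) = 0} :=
    hprime.one_lt.trans_le (Nat.le_of_dvd hpos hdvd)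
  obtain ⟨⟨z, hz⟩, hne⟩ := Fintype.exists_ne_of_one_lt_card hlt ⟨0, h0⟩
  exact ⟨z, fun h => hne (Subtype.ext h), hz⟩

theorem MvPolynomial.aeval_const_mul_of_isHomogeneous {F K : Type*} [CommSemiring F]
    [CommSemiring K] [Algebra F K] {σ : Type*} {h : MvPolynomial σ F} {d : ℕ} (hh : h.IsHomogeneous d) (c : K)
    (v : σ → K) : aeval (fun j => c * v j) h = c ^ d * aeval v h := by
  rw [aeval_def, aeval_def, eval₂_eq, eval₂_eq, Finset.mul_sum]
  refine Finset.sum_congr rfl fun s hs => ?_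
  have hs' : ∑ i ∈ s.support, s i = d := (hh.degree_eq_sum_deg_support hs).symm
  simp only [mul_pow]
  rw [Finset.prod_mul_distrib, Finset.prod_pow_eq_pow_sum, hs']
  ring

section Extend

variable {F : Type*} [Field F] {m n : ℕ} {u : Fin m → Fin n → F}

theorem aeval_linSubst_cons_eq_zero {z : Fin n → F} {h : MvPolynomial (Fin n) F} {d : ℕ}
    (hh : h.IsHomogeneous d) (hu : aeval (linSubst u) h = 0)
    (hz : aeval (fun j => linSubst u j + C (z j)) h = 0) :
    aeval (linSubst (Fin.cons z u : Fin (m + 1) → Fin n → F)) h = 0 := by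
  let K := AlgebraicClosure F
  refine map_injective (algebraMap F K) (algebraMap F K).injective ?_
  rw [map_zero]
  refine MvPolynomial.funext fun x => ?_
  rw [eval_map, ← aeval_def, map_zero, comp_aeval_apply]
  by_cases hx : x 0 = 0
  · have h₁ := congrArg (aeval (fun l : Fin m => x l.succ)) hu
    rw [comp_aeval_apply, map_zero] at h₁
    rw [← h₁]
    congr 2
    ext j
    simp [linSubst, Fin.sum_univ_succ, hx]
  · have h₁ := congrArg (aeval (fun l : Fin m => (x 0)⁻¹ * x l.succ)) hz
    rw [comp_aeval_apply, map_zero] at h₁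
    have h₂ := aeval_const_mul_of_isHomogeneous hh (x 0)
      (fun j => aeval (fun l : Fin m => (x 0)⁻¹ * x l.succ) (linSubst u j + C (z j)))
    rw [h₁, mul_zero] at h₂
    rw [← h₂]
    congr 2
    ext j
    simp only [linSubst, Fin.sum_univ_succ, map_add, map_sum, map_mul, aeval_X, algHom_C,
      Fin.cons_zero, Fin.cons_succ, mul_add]
    rw [add_comm (algebraMap F K (z j) * x 0), Finset.mul_sum, mul_comm (x 0)]
    congr 1
    refine Finset.sum_congr rfl fun l _ => ?_
    rw [mul_left_comm (x 0), mul_inv_cancel_left₀ hx]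

theorem exists_leftInverse_functionals (hu : LinearIndependent F u) :
    ∃ c : Fin m → Fin n → F, ∀ z, z ∈ Submodule.span F (Set.range u) →
      (∀ l, ∑ j, c l j * z j = 0) → z = 0 := by
  obtain ⟨π, hπ⟩ := (Fintype.linearCombination F u).exists_leftInverse_of_injective
    (LinearMap.ker_eq_bot.mpr (linearIndependent_iff_injective_fintypeLinearCombination.mp hu))
  refine ⟨fun l j => π (Pi.single j 1) l, fun z hz h => ?_⟩
  rw [← Fintype.range_linearCombination] at hz
  obtain ⟨y, rfl⟩ := hz
  set w := Fintype.linearCombination F u y with hw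
  have h₁ : π w = y := LinearMap.congr_fun hπ y
  have h₂ : π w = 0 := by
    ext l
    rw [LinearMap.pi_apply_eq_sum_univ π w]
    simp only [Finset.sum_apply, Pi.smul_apply, smul_eq_mul, Pi.zero_apply]
    refine (Finset.sum_congr rfl fun j _ => ?_).trans (h l)
    have h₃ : (fun i => if j = i then 1 else 0) = (Pi.single j 1 : Fin n → F) := by
      ext i
      simp [Pi.single_apply, eq_comm]
    rw [mul_comm, h₃]
  rw [hw, ← h₁, h₂, map_zero]

variable [Fintype F]

theorem exists_linearIndependent_cons {ι : Type*} [Fintype ι] {e : ℕ}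
    {h : ι → MvPolynomial (Fin n) F} (hh : ∀ i, (h i).IsHomogeneous (e + 1))
    (hu : LinearIndependent F u) (hvan : ∀ i, aeval (linSubst u) (h i) = 0)
    (hn : Fintype.card ι * ((e + 1) * (m + 1) ^ e) + m < n) :
    ∃ z : Fin n → F, LinearIndependent F (Fin.cons z u : Fin (m + 1) → Fin n → F) ∧
      ∀ i, aeval (linSubst (Fin.cons z u : Fin (m + 1) → Fin n → F)) (h i) = 0 := by
  obtain ⟨S, hS, hmem⟩ := exists_finset_degree_le (Fin m) e
  rw [Fintype.card_fin] at hS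
  obtain ⟨c, hc⟩ := exists_leftInverse_functionals hu
  have hJ : ∀ i, JointDegreeLE (e + 1) (aeval (genericSubst u) (h i)) := fun i =>
    (JointDegreeLE.aeval (jointDegreeLE_genericSubst u) (h i)).mono (hh i).totalDegree_le
  have hconst : ∀ i a, eval 0 (coeff a (aeval (genericSubst u) (h i))) = 0 := by
    intro i a
    have h₁ := map_eval_aeval_genericSubst u 0 (h i)
    simp only [Pi.zero_apply, map_zero, add_zero] at h₁
    rw [hvan i] at h₁
    rw [← coeff_map, h₁, coeff_zero]
  let f : (ι × S) ⊕ Fin m → MvPolynomial (Fin n) F :=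
    Sum.elim (fun x => coeff x.2.1 (aeval (genericSubst u) (h x.1)))
      fun l => ∑ j, C (c l j) * X j
  have hdeg : ∑ i, (f i).totalDegree < n := by
    refine lt_of_le_of_lt ?_ hn
    rw [Fintype.sum_sum_type]
    refine Nat.add_le_add ?_ ?_
    · refine (Finset.sum_le_card_nsmul _ _ (e + 1) fun x _ =>
        (hJ x.1).totalDegree_coeff_le x.2.1).trans ?_
      rw [Finset.card_univ, Fintype.card_prod, Fintype.card_coe, smul_eq_mul, mul_assoc,
        mul_comm S.card]
      exact Nat.mul_le_mul_left _ (Nat.mul_le_mul_left _ hS)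
    · refine (Finset.sum_le_card_nsmul _ _ 1 fun l _ => ?_).trans (by simp)
      refine totalDegree_finsetSum_le fun j _ => ?_
      refine (totalDegree_mul _ _).trans ?_
      rw [totalDegree_C, totalDegree_X]
  have h0 : ∀ i, eval 0 (f i) = 0 := by
    rintro (x | l)
    · exact hconst _ _
    · simp [f]
  obtain ⟨z, hz0, hz⟩ := exists_ne_zero_forall_eval_eq_zero f hdeg h0
  refine ⟨z, linearIndependent_finCons.mpr ⟨hu, fun hspan => hz0 (hc z hspan fun l => ?_)⟩,
    fun i => aeval_linSubst_cons_eq_zero (hh i) (hvan i) ?_⟩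
  · simpa [f] using hz (Sum.inr l)
  · rw [← map_eval_aeval_genericSubst]
    ext a
    rw [coeff_map, coeff_zero]
    by_cases ha : a.degree ≤ e
    · exact hz (Sum.inl (i, ⟨a, hmem a ha⟩))
    · have h₁ := hconst i a
      rw [(hJ i).coeff_eq_C_of_le (by omega)] at h₁ ⊢
      rwa [eval_C] at h₁ ⊢

/-- Forms of the same degree vanish identically on a common subspace of large dimension. -/
theorem exists_linearIndependent_aeval_eq_zero {ι : Type*} [Fintype ι] {e : ℕ}
    {h : ι → MvPolynomial (Fin n) F} (hh : ∀ i, (h i).IsHomogeneous (e + 1)) (M : ℕ)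
    (hn : Fintype.card ι * ((e + 1) * M ^ e) + M ≤ n) :
    ∃ u : Fin M → Fin n → F, LinearIndependent F u ∧ ∀ i, aeval (linSubst u) (h i) = 0 := by
  induction M with
  | zero =>
    refine ⟨Fin.elim0, linearIndependent_empty_type, fun i => ?_⟩
    have h₁ : linSubst (Fin.elim0 : Fin 0 → Fin n → F) = fun _ => 0 * 0 := by
      ext j : 1
      simp [linSubst]
    rw [h₁, aeval_const_mul_of_isHomogeneous (hh i)]
    simp
  | succ M ih =>
    obtain ⟨u, hu, hvan⟩ := ih (le_trans (by gcongr <;> omega) hn)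
    obtain ⟨z, hz⟩ := exists_linearIndependent_cons hh hu hvan (by omega)
    exact ⟨_, hz⟩

end Extend

section Averaging

theorem sum_sum_add_eq_card_mul_sum {G Y : Type*} [AddCommGroup G] [Fintype G] [Fintype Y]
    (φ : Y → G) (w : G → ℝ) : ∑ x, ∑ y, w (x + φ y) = Fintype.card Y * ∑ x, w x := by
  rw [Finset.sum_comm]
  have h : ∀ y, ∑ x, w (x + φ y) = ∑ x, w x := fun y =>
    Fintype.sum_equiv (Equiv.addRight (φ y)) _ _ fun _ => rfl
  simp [h]

/-- A bound for the sum of `w` over `S` follows from bounds over its intersections with all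
translates of a fixed family. -/
theorem abs_sum_filter_le_of_translates {G Y : Type*} [AddCommGroup G] [Fintype G] [Fintype Y]
    [Nonempty Y] (φ : Y → G) (p : G → Prop) [DecidablePred p] (w : G → ℝ) (ε : ℝ)
    (h : ∀ x, |∑ y with p (x + φ y), w (x + φ y)| ≤
      ε * (Finset.univ.filter fun y => p (x + φ y)).card) :
    |∑ x with p x, w x| ≤ ε * (Finset.univ.filter p).card := by
  have hY : (0 : ℝ) < Fintype.card Y := by exact_mod_cast Fintype.card_pos
  refine le_of_mul_le_mul_left ?_ hY
  have h₁ := sum_sum_add_eq_card_mul_sum φ fun x => if p x then w x else 0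
  have h₂ := sum_sum_add_eq_card_mul_sum φ fun x => if p x then (1 : ℝ) else 0
  simp only [← Finset.sum_filter] at h₁ h₂
  simp only [Finset.sum_const, nsmul_eq_mul, mul_one] at h₂
  calc (Fintype.card Y : ℝ) * |∑ x with p x, w x|
      = |∑ x, ∑ y with p (x + φ y), w (x + φ y)| := by rw [h₁, abs_mul, abs_of_pos hY]
    _ ≤ ∑ x, |∑ y with p (x + φ y), w (x + φ y)| := Finset.abs_sum_le_sum_abs _ _
    _ ≤ ∑ x, ε * (Finset.univ.filter fun y => p (x + φ y)).card :=
      Finset.sum_le_sum fun x _ => h x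
    _ = Fintype.card Y * (ε * (Finset.univ.filter p).card) := by
      rw [← Finset.mul_sum, h₂]
      ring

end Averaging

/-- An ambient dimension in which `t` polynomials of degree at most `d` become simultaneously
constant on affine subspaces of dimension `k`, found by lowering the degree one step at a time. -/
def requiredDim (k t : ℕ) : ℕ → ℕ
  | 0 => k
  | d + 1 => t * ((d + 1) * requiredDim k t d ^ d) + requiredDim k t d

section Variety

variable {F : Type*} [Field F] [Fintype F]

theorem abs_sum_zeroLocus_le {k t : ℕ} {ε : ℝ} (d : ℕ) : ∀ {n : ℕ}, requiredDim k t d ≤ n →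
    ∀ w : (Fin n → F) → ℝ,
    (∀ (x : Fin n → F) (u : Fin k → Fin n → F), LinearIndependent F u →
      |∑ y : Fin k → F, w (x + ∑ l, y l • u l)| ≤ ε * Fintype.card (Fin k → F)) →
    ∀ g : Fin t → MvPolynomial (Fin n) F, (∀ i, (g i).totalDegree ≤ d) →
    |∑ x with ∀ i, eval x (g i) = 0, w x| ≤
      ε * (Finset.univ.filter fun x => ∀ i, eval x (g i) = 0).card := by
  induction d with
  | zero =>
    intro n hn w hw g hg
    have hconst : ∀ i x, eval x (g i) = coeff 0 (g i) := by
      intro i x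
      conv_lhs => rw [totalDegree_eq_zero_iff_eq_C.mp (Nat.le_zero.mp (hg i))]
      exact eval_C _
    simp only [hconst]
    by_cases h : ∀ i, coeff 0 (g i) = 0
    · refine abs_sum_filter_le_of_translates
        (fun y : Fin k → F => ∑ l, y l • (Pi.single (Fin.castLE hn l) 1 : Fin n → F))
        (fun _ => ∀ i, coeff 0 (g i) = 0) w ε fun x => ?_
      have hu : LinearIndependent F fun l => (Pi.single (Fin.castLE hn l) 1 : Fin n → F) := by
        have h₁ := (Pi.basisFun F (Fin n)).linearIndependent.comp _ (Fin.castLE_injective hn)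
        simpa [Function.comp_def] using h₁
      simpa [h] using hw x _ hu
    · simp [h]
  | succ d ih =>
    intro n hn w hw g hg
    obtain ⟨u, hu, hvan⟩ := exists_linearIndependent_aeval_eq_zero
      (h := fun i => homogeneousComponent (d + 1) (g i))
      (fun i => homogeneousComponent_isHomogeneous (d + 1) (g i)) (requiredDim k t d)
      (by rw [Fintype.card_fin]; exact hn)
    refine abs_sum_filter_le_of_translates
      (fun y : Fin (requiredDim k t d) → F => ∑ l, y l • u l)
      (fun x => ∀ i, eval x (g i) = 0) w ε fun x => ?_
    have h₁ := ih le_rfl (fun y => w (x + ∑ l, y l • u l)) (fun y v hv => ?_)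
      (fun i => aeval (fun j => linSubst u j + C (x j)) (g i))
      (fun i => totalDegree_aeval_add_C_le u (hg i) (hvan i) x)
    · simpa only [eval_aeval_add_C] using h₁
    · have h₂ := hw (x + ∑ l, y l • u l) (fun r => Fintype.linearCombination F u (v r))
        (hv.map' _ (LinearMap.ker_eq_bot.mpr
          (linearIndependent_iff_injective_fintypeLinearCombination.mp hu)))
      convert h₂ using 4 with s
      rw [add_assoc]
      congr 2
      have h₃ := (Fintype.linearCombination F u).map_add y (∑ r, s r • v r)
      rw [map_sum] at h₃
      simpa only [map_smul, Fintype.linearCombination_apply] using h₃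

end Variety

section Numerics

theorem requiredDim_pos {k t : ℕ} (hk : 0 < k) (d : ℕ) : 0 < requiredDim k t d := by
  induction d with
  | zero => exact hk
  | succ d ih => exact Nat.add_pos_right _ ih

theorem requiredDim_succ_le {k t : ℕ} (hk : 0 < k) (ht : 0 < t) (e : ℕ) :
    requiredDim k t (e + 2) ≤ t * (4 * requiredDim k t (e + 1)) ^ (e + 1) := by
  change t * ((e + 2) * requiredDim k t (e + 1) ^ (e + 1)) + requiredDim k t (e + 1) ≤ _
  have hM := requiredDim_pos (t := t) hk (e + 1)
  set M := requiredDim k t (e + 1)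
  have h₁ : M ≤ t * M ^ (e + 1) :=
    (Nat.le_self_pow (Nat.succ_ne_zero e) M).trans (Nat.le_mul_of_pos_left _ ht)
  have h₂ : e + 3 ≤ 4 ^ (e + 1) := by
    clear_value M
    clear h₁ hM
    induction e with
    | zero => norm_num
    | succ e ih => rw [pow_succ]; omega
  calc t * ((e + 2) * M ^ (e + 1)) + M
      ≤ t * ((e + 2) * M ^ (e + 1)) + t * M ^ (e + 1) := by gcongr
    _ = t * ((e + 3) * M ^ (e + 1)) := by ring
    _ ≤ t * (4 ^ (e + 1) * M ^ (e + 1)) := by gcongr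
    _ = t * (4 * M) ^ (e + 1) := by rw [mul_pow]

theorem requiredDim_le_rpow {k t : ℕ} (hk : 0 < k) (ht : 0 < t) (e : ℕ) :
    (requiredDim k t (e + 1) : ℝ) ≤
      (2 * k * 4 ^ (∑ j ∈ Finset.range e, (1 : ℝ) / (j.factorial : ℝ)) *
        (t : ℝ) ^ (∑ j ∈ Finset.range (e + 1), (1 : ℝ) / (j.factorial : ℝ))) ^ e.factorial := by
  have ht' : (0 : ℝ) < t := by exact_mod_cast ht
  induction e with
  | zero =>
    have h₁ : t + k ≤ 2 * k * t := by nlinarith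
    have h₂ : requiredDim k t 1 = t + k := by simp [requiredDim]
    rw [zero_add, h₂]
    simpa using (by exact_mod_cast h₁ : ((t : ℝ) + k) ≤ 2 * k * t)
  | succ e ih =>
    have hroot : ∀ x : ℝ, 0 < x → ∀ m : ℕ, 0 < m → (x ^ ((1 : ℝ) / m)) ^ m = x := by
      intro x hx m hm
      rw [one_div]
      exact Real.rpow_inv_natCast_pow hx.le hm.ne'
    have h₁ : (requiredDim k t (e + 2) : ℝ) ≤ t * (4 * requiredDim k t (e + 1)) ^ (e + 1) := by
      exact_mod_cast requiredDim_succ_le hk ht e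
    have h₀ := mul_le_mul_of_nonneg_left (pow_le_pow_left₀ (by positivity)
      (mul_le_mul_of_nonneg_left ih (zero_le_four (α := ℝ))) (e + 1)) ht'.le
    refine h₁.trans (h₀.trans (le_of_eq ?_))
    have hA : (4 : ℝ) ^ (∑ j ∈ Finset.range (e + 1), (1 : ℝ) / (j.factorial : ℝ)) =
        4 ^ (∑ j ∈ Finset.range e, (1 : ℝ) / (j.factorial : ℝ)) *
          4 ^ ((1 : ℝ) / (e.factorial : ℝ)) := by
      rw [Finset.sum_range_succ, Real.rpow_add (by norm_num)]
    have hB : (t : ℝ) ^ (∑ j ∈ Finset.range (e + 1 + 1), (1 : ℝ) / (j.factorial : ℝ)) =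
        (t : ℝ) ^ (∑ j ∈ Finset.range (e + 1), (1 : ℝ) / (j.factorial : ℝ)) *
          (t : ℝ) ^ ((1 : ℝ) / ((e + 1).factorial : ℝ)) := by
      rw [Finset.sum_range_succ, Real.rpow_add ht']
    rw [hA, hB, mul_pow 4, ← pow_mul]
    have h₂ := hroot 4 (by norm_num) e.factorial e.factorial_pos
    have h₃ := hroot t ht' (e + 1).factorial (e + 1).factorial_pos
    set A := (4 : ℝ) ^ (∑ j ∈ Finset.range e, (1 : ℝ) / (j.factorial : ℝ))
    set B := (t : ℝ) ^ (∑ j ∈ Finset.range (e + 1), (1 : ℝ) / (j.factorial : ℝ))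
    have hfac : (e + 1).factorial = e.factorial * (e + 1) := by
      rw [Nat.factorial_succ, mul_comm]
    set a := (4 : ℝ) ^ ((1 : ℝ) / e.factorial)
    set b := (t : ℝ) ^ ((1 : ℝ) / (e + 1).factorial)
    rw [show 2 * (k : ℝ) * (A * a) * (B * b) = b * (a * (2 * k * A * B)) by ring, mul_pow b, h₃,
      mul_pow a, hfac, pow_mul a, h₂]

theorem requiredDim_le {k t : ℕ} (hk : 0 < k) (ht : 0 < t) (e : ℕ) :
    (requiredDim k t (e + 1) : ℝ) ≤ (128 * k * (t : ℝ) ^ Real.exp 1) ^ e.factorial := by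
  have hsum : ∀ m, ∑ j ∈ Finset.range m, (1 : ℝ) / (j.factorial : ℝ) ≤ Real.exp 1 := fun m => by
    simpa using Real.sum_le_exp_of_nonneg zero_le_one m
  have ht' : (1 : ℝ) ≤ t := by exact_mod_cast ht
  refine (requiredDim_le_rpow hk ht e).trans ?_
  have h₁ : (4 : ℝ) ^ (∑ j ∈ Finset.range e, (1 : ℝ) / (j.factorial : ℝ)) ≤ 64 := by
    refine (Real.rpow_le_rpow_of_exponent_le (by norm_num)
      ((hsum e).trans (Real.exp_one_lt_d9.le.trans (by norm_num : _ ≤ (3 : ℝ))))).trans ?_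
    norm_num
  have h₂ := Real.rpow_le_rpow_of_exponent_le ht' (hsum (e + 1))
  calc _ ≤ (2 * (k : ℝ) * 64 * (t : ℝ) ^ Real.exp 1) ^ e.factorial := by gcongr
    _ = _ := by ring_nf

theorem requiredDim_floor_le {n t e : ℕ} (ht : 0 < t)
    (hk : 0 < ⌊(1 / 128 : ℝ) * (n : ℝ) ^ ((1 : ℝ) / (e.factorial : ℝ)) /
      (t : ℝ) ^ Real.exp 1⌋₊) :
    requiredDim ⌊(1 / 128 : ℝ) * (n : ℝ) ^ ((1 : ℝ) / (e.factorial : ℝ)) /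
      (t : ℝ) ^ Real.exp 1⌋₊ t (e + 1) ≤ n := by
  have ht' : (0 : ℝ) < (t : ℝ) ^ Real.exp 1 := Real.rpow_pos_of_pos (by exact_mod_cast ht) _
  have h₁ := Nat.floor_le (a := (1 / 128 : ℝ) * (n : ℝ) ^ ((1 : ℝ) / (e.factorial : ℝ)) /
    (t : ℝ) ^ Real.exp 1) (by positivity)
  set k := ⌊(1 / 128 : ℝ) * (n : ℝ) ^ ((1 : ℝ) / (e.factorial : ℝ)) / (t : ℝ) ^ Real.exp 1⌋₊
  rw [le_div_iff₀ ht'] at h₁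
  have h₂ : 128 * k * (t : ℝ) ^ Real.exp 1 ≤ (n : ℝ) ^ ((1 : ℝ) / (e.factorial : ℝ)) := by
    linarith
  have h₃ : ((n : ℝ) ^ ((1 : ℝ) / (e.factorial : ℝ))) ^ e.factorial = n := by
    rw [one_div]
    exact Real.rpow_inv_natCast_pow n.cast_nonneg e.factorial_pos.ne'
  have h₄ : (requiredDim k t (e + 1) : ℝ) ≤ n :=
    (requiredDim_le hk ht e).trans (h₃ ▸ pow_le_pow_left₀ (by positivity) h₂ _)
  exact_mod_cast h₄

end Numerics

section Extractor

theorem sum_indicator_sub_density {F D : Type} [Fintype F] (f : D → F) (S : Finset D)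
    (A : Finset F) :
    ∑ x ∈ S, ((if f x ∈ A then (1 : ℝ) else 0) - (A.card : ℝ) / (Fintype.card F : ℝ)) =
      (S.filter fun x => f x ∈ A).card - S.card * ((A.card : ℝ) / (Fintype.card F : ℝ)) := by
  rw [Finset.sum_sub_distrib, Finset.sum_boole, Finset.sum_const, nsmul_eq_mul]

theorem closeToUniform_iff {F D : Type} [Fintype F] (f : D → F) {S : Finset D}
    (hS : S.Nonempty) (ε : ℝ) :
    CloseToUniform f S ε ↔ ∀ A : Finset F,
      |∑ x ∈ S, ((if f x ∈ A then (1 : ℝ) else 0) - (A.card : ℝ) / (Fintype.card F : ℝ))| ≤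
        ε * S.card := by
  have hpos : (0 : ℝ) < S.card := by exact_mod_cast hS.card_pos
  refine forall_congr' fun A => ?_
  rw [sum_indicator_sub_density, ← div_le_iff₀ hpos, ← abs_of_pos hpos, ← abs_div,
    abs_of_pos hpos, sub_div, mul_div_cancel_left₀ _ hpos.ne']

theorem AffineExtractor.abs_sum_le {F : Type} [Field F] [Fintype F] {n k : ℕ}
    {f : (Fin n → F) → F} {ε : ℝ} (hf : AffineExtractor f k ε) (A : Finset F)
    (x : Fin n → F) (u : Fin k → Fin n → F) (hu : LinearIndependent F u) :
    |∑ y : Fin k → F, ((if f (x + ∑ l, y l • u l) ∈ A then (1 : ℝ) else 0) -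
      (A.card : ℝ) / (Fintype.card F : ℝ))| ≤ ε * Fintype.card (Fin k → F) := by
  have hinj : Function.Injective fun y : Fin k → F => x + ∑ l, y l • u l := by
    intro y y' h
    exact linearIndependent_iff_injective_fintypeLinearCombination.mp hu
      (by simpa [Fintype.linearCombination_apply] using h)
  have hcoset : cosetFinset x (Submodule.span F (Set.range u)) =
      Finset.univ.image fun y : Fin k → F => x + ∑ l, y l • u l := by
    ext z
    simp only [cosetFinset, Set.Finite.mem_toFinset, Set.mem_ofPred_eq, Finset.mem_image,
      Finset.mem_univ, true_and, Submodule.mem_span_range_iff_exists_fun]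
    constructor
    · rintro ⟨_, ⟨y, rfl⟩, rfl⟩
      exact ⟨y, rfl⟩
    · rintro ⟨y, rfl⟩
      exact ⟨_, ⟨y, rfl⟩, rfl⟩
  have h := hf x (Submodule.span F (Set.range u))
    (by rw [finrank_span_eq_card hu, Fintype.card_fin])
  rw [hcoset, closeToUniform_iff f (Finset.univ_nonempty.image _)] at h
  have h₁ := h A
  rwa [Finset.sum_image hinj.injOn, Finset.card_image_of_injective _ hinj, Finset.card_univ] at h₁

end Extractor

theorem stmt_11 : ∃ α : ℝ, 0 < α ∧
    ∀ (q : ℕ), IsPrimePow q →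
    ∀ (n d t : ℕ), 0 < n → 0 < d → 0 < t →
    ∀ (ε : ℝ), 0 ≤ ε →
    ∀ (F : Type) [Field F] [Fintype F], Fintype.card F = q →
    ∀ f : (Fin n → F) → F,
      AffineExtractor f
        ⌊α * (n : ℝ) ^ ((1 : ℝ) / (Nat.factorial (d - 1) : ℝ)) /
          (t : ℝ) ^ (Real.exp 1)⌋₊ ε →
      ∀ g : Fin t → MvPolynomial (Fin n) F, (∀ i, (g i).totalDegree ≤ d) →
        ∀ V : Finset (Fin n → F),
          (∀ x, x ∈ V ↔ ∀ i, eval x (g i) = 0) →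
          V.Nonempty →
          CloseToUniform f V ε := by
  refine ⟨1 / 128, by norm_num, ?_⟩
  intro q _ n d t _ hd ht ε _ F _ _ _ f hf g hg V hV hVne
  obtain ⟨e, rfl⟩ := Nat.exists_eq_succ_of_ne_zero hd.ne'
  rw [Nat.succ_sub_one] at hf
  have hV' : V = Finset.univ.filter fun x => ∀ i, eval x (g i) = 0 := by
    ext x
    simp [hV]
  rw [closeToUniform_iff f hVne]
  intro A
  have hext := hf.abs_sum_le A
  rcases Nat.eq_zero_or_pos ⌊(1 / 128 : ℝ) * (n : ℝ) ^ ((1 : ℝ) / (e.factorial : ℝ)) /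
      (t : ℝ) ^ Real.exp 1⌋₊ with hk | hk
  · rw [hk] at hext
    refine (Finset.abs_sum_le_sum_abs _ _).trans
      ((Finset.sum_le_card_nsmul _ _ ε fun x _ => ?_).trans (by rw [nsmul_eq_mul, mul_comm]))
    simpa using hext x Fin.elim0 linearIndependent_empty_type
  · rw [hV']
    exact abs_sum_zeroLocus_le (e + 1) (requiredDim_floor_le ht hk)
      (fun x => (if f x ∈ A then (1 : ℝ) else 0) - (A.card : ℝ) / (Fintype.card F : ℝ))
      hext g hg
end

section
/- There exists a universal constant α > 0 such that the following holds for every prime power q and all positive integers n, d, t with d < log₂(n/t)/10. Let f : F_q^n → F_q be an affine disperser for dimension ⌈α · d · (n/t)^{1/(d-1)}⌉. Then for all polynomials g₁, …, g_t : F_q^n → F_q, each of total degree at most d, whose common zero set V = {x : g₁(x) = ⋯ = g_t(x) = 0} is nonempty, f is not constant on V. -/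
open MvPolynomial

/-- `f` is an affine disperser for dimension `k`: `f` is non-constant on every affine
subspace `u₀ + U` with `dim U = k`. -/
def AffineDisperser {F : Type} [Field F] {n : ℕ} (f : (Fin n → F) → F) (k : ℕ) : Prop :=
  ∀ (u₀ : Fin n → F) (U : Submodule F (Fin n → F)), Module.finrank F ↥U = k →
    ∃ u ∈ U, ∃ v ∈ U, f (u₀ + u) ≠ f (u₀ + v)

lemma sum_none_le_choose (κ : Type) [Fintype κ] (d : ℕ) (hd : 0 < d) :
    ∑ s ∈ (Finsupp.finite_of_degree_le (σ := Option κ) d).toFinset, s none ≤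
      (Fintype.card κ + d + 1).choose (d - 1) := by
  classical
  have hcard : (Finset.finsuppAntidiag (Finset.univ : Finset (Option (Option (Option κ))))
      (d - 1)).card = (Fintype.card κ + d + 1).choose (d - 1) := by
    rw [Finset.card_finsuppAntidiag_nat_eq_choose]
    simp only [Finset.card_univ, Fintype.card_option]
    congr 1
    omega
  rw [← hcard]
  have hsum : ∑ s ∈ (Finsupp.finite_of_degree_le (σ := Option κ) d).toFinset, s none =
      ((Finsupp.finite_of_degree_le (σ := Option κ) d).toFinset.sigma
        fun s => Finset.range (s none)).card := by
    simp
  rw [hsum]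
  refine Finset.card_le_card_of_injOn
    (fun x => Finsupp.equivFunOnFinite.symm fun o => match o with
      | none => x.2
      | some none => x.1 none - 1 - x.2
      | some (some none) => d - x.1.degree
      | some (some (some i)) => x.1 (some i)) ?_ ?_
  · rintro ⟨s, l⟩ h
    simp only [Finset.coe_sigma, Set.mem_sigma_iff, Finset.mem_coe, Set.Finite.mem_toFinset,
      Set.mem_ofPred_eq, Finset.mem_range] at h
    obtain ⟨h1, h2⟩ := h
    rw [Finsupp.degree_eq_sum, Fintype.sum_option] at h1
    simp only [Finset.mem_coe, Finset.mem_finsuppAntidiag, Finset.subset_univ, and_true,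
      Finsupp.equivFunOnFinite_symm_apply_apply, Fintype.sum_option, Finsupp.degree_eq_sum]
    omega
  · rintro ⟨s, l⟩ h ⟨s', l'⟩ h' heq
    simp only [Finset.coe_sigma, Set.mem_sigma_iff, Finset.mem_coe, Set.Finite.mem_toFinset,
      Set.mem_ofPred_eq, Finset.mem_range] at h h'
    have heq' := Finsupp.equivFunOnFinite.symm.injective heq
    have h0 := congrFun heq' none
    have h1 := congrFun heq' (some none)
    have h2 := fun i => congrFun heq' (some (some (some i)))
    simp only at h0 h1 h2
    have : s = s' := by
      ext o
      cases o with
      | none => omega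
      | some i => exact h2 i
    subst this
    subst h0
    rfl

lemma totalDegree_aeval_le {R S σ τ : Type*} [CommSemiring R] [CommSemiring S] [Algebra R S]
    (h : σ → MvPolynomial τ S) (hh : ∀ l, (h l).totalDegree ≤ 1) (g : MvPolynomial σ R) :
    (aeval h g).totalDegree ≤ g.totalDegree := by
  rw [aeval_def, eval₂_eq]
  refine totalDegree_finsetSum_le fun s hs => ?_
  refine (totalDegree_mul _ _).trans ?_
  rw [MvPolynomial.algebraMap_apply, totalDegree_C, zero_add]
  refine (totalDegree_finsetProd _ _).trans (le_trans ?_ (le_totalDegree hs))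
  refine Finset.sum_le_sum fun i _ => (totalDegree_pow _ _).trans ?_
  exact (Nat.mul_le_mul_left _ (hh i)).trans (by simp)

/-- The coefficients of `P` have degree at most the exponent of the distinguished variable. -/
def CoeffDegreeLE {F σ κ : Type*} [CommSemiring F]
    (P : MvPolynomial (Option κ) (MvPolynomial σ F)) : Prop :=
  ∀ s, (coeff s P).totalDegree ≤ s none

namespace CoeffDegreeLE

variable {F σ κ : Type*} [CommSemiring F]

lemma C_C (a : F) :
    CoeffDegreeLE (C (C a) : MvPolynomial (Option κ) (MvPolynomial σ F)) := by
  classical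
  intro s
  rw [coeff_C]
  split_ifs <;> simp

lemma X_some (j : κ) :
    CoeffDegreeLE (X (some j) : MvPolynomial (Option κ) (MvPolynomial σ F)) := by
  classical
  intro s
  rw [coeff_X]
  split_ifs <;> simp

lemma X_none_mul_C {L : MvPolynomial σ F} (hL : L.totalDegree ≤ 1) :
    CoeffDegreeLE (X none * C L : MvPolynomial (Option κ) (MvPolynomial σ F)) := by
  classical
  intro s
  rw [mul_comm, coeff_C_mul, coeff_X]
  split_ifs with h
  · subst h
    simpa using hL
  · simp

lemma add {P Q : MvPolynomial (Option κ) (MvPolynomial σ F)}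
    (hP : CoeffDegreeLE P) (hQ : CoeffDegreeLE Q) : CoeffDegreeLE (P + Q) := fun s => by
  rw [coeff_add]
  exact (totalDegree_add _ _).trans (max_le (hP s) (hQ s))

lemma mul {P Q : MvPolynomial (Option κ) (MvPolynomial σ F)}
    (hP : CoeffDegreeLE P) (hQ : CoeffDegreeLE Q) : CoeffDegreeLE (P * Q) := fun s => by
  classical
  rw [coeff_mul]
  refine totalDegree_finsetSum_le fun x hx => (totalDegree_mul _ _).trans ?_
  rw [← Finset.HasAntidiagonal.mem_antidiagonal.mp hx, Finsupp.add_apply]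
  exact add_le_add (hP _) (hQ _)

lemma sum {ι : Type*} (s : Finset ι) {P : ι → MvPolynomial (Option κ) (MvPolynomial σ F)}
    (hP : ∀ i, CoeffDegreeLE (P i)) : CoeffDegreeLE (∑ i ∈ s, P i) := by
  classical
  induction s using Finset.induction_on with
  | empty => intro s; simp
  | insert a s ha ih => rw [Finset.sum_insert ha]; exact (hP a).add ih

lemma aeval {τ : Type*} {h : τ → MvPolynomial (Option κ) (MvPolynomial σ F)}
    (hh : ∀ l, CoeffDegreeLE (h l)) (g : MvPolynomial τ F) :
    CoeffDegreeLE (MvPolynomial.aeval h g) := by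
  induction g using MvPolynomial.induction_on with
  | C a =>
    rw [aeval_C, MvPolynomial.algebraMap_apply, MvPolynomial.algebraMap_eq]
    exact C_C a
  | add p q hp hq => rw [map_add]; exact hp.add hq
  | mul_X p i hp => rw [map_mul, aeval_X]; exact hp.mul (hh i)

end CoeffDegreeLE

/-- The restriction of `g` to the affine subspace `x₀ + span v`, as a polynomial in the
coordinates with respect to `v`. -/
noncomputable def restrictAffine {F : Type*} [Field F] {n : ℕ} {κ : Type*} [Fintype κ]
    (x₀ : Fin n → F) (v : κ → Fin n → F) (g : MvPolynomial (Fin n) F) : MvPolynomial κ F :=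
  aeval (fun l => C (x₀ l) + ∑ j, X j * C (v j l)) g

/-- The restriction of `g` to `x₀ + span (w, v)` with generic `w`. -/
noncomputable def restrictGeneric {F : Type*} [Field F] {n : ℕ} {κ : Type*} [Fintype κ]
    (x₀ : Fin n → F) (v : κ → Fin n → F) (g : MvPolynomial (Fin n) F) :
    MvPolynomial (Option κ) (MvPolynomial (Fin n) F) :=
  aeval (fun l => C (C (x₀ l)) + (X none * C (X l) + ∑ j, X (some j) * C (C (v j l)))) g

section Restrict

variable {F : Type*} [Field F] {n : ℕ} {κ : Type*} [Fintype κ]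

lemma eval_restrictAffine (x₀ : Fin n → F) (v : κ → Fin n → F) (g : MvPolynomial (Fin n) F)
    (c : κ → F) : eval c (restrictAffine x₀ v g) = eval (x₀ + ∑ j, c j • v j) g := by
  rw [restrictAffine, map_aeval]
  have : (eval c).comp (algebraMap F (MvPolynomial κ F)) = RingHom.id F := by
    ext a
    rw [RingHom.comp_apply, MvPolynomial.algebraMap_eq, eval_C, RingHom.id_apply]
  rw [this, eval]
  congr 2
  funext l
  simp [Finset.sum_apply]

lemma map_restrictGeneric (x₀ : Fin n → F) (v : κ → Fin n → F) (g : MvPolynomial (Fin n) F)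
    (w : Fin n → F) : map (eval w) (restrictGeneric x₀ v g) =
      restrictAffine x₀ (fun o : Option κ => o.elim w v) g := by
  rw [restrictGeneric, restrictAffine, map_aeval, aeval_def]
  have : (map (eval w)).comp (algebraMap F (MvPolynomial (Option κ) (MvPolynomial (Fin n) F))) =
      algebraMap F (MvPolynomial (Option κ) F) := by
    refine RingHom.ext fun a => ?_
    simp only [RingHom.comp_apply, MvPolynomial.algebraMap_apply, MvPolynomial.algebraMap_eq,
      map_C, eval_C]
  rw [this, coe_eval₂Hom]
  congr 1
  funext l
  simp [Fintype.sum_option]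

lemma restrictAffine_option_zero (x₀ : Fin n → F) (v : κ → Fin n → F)
    (g : MvPolynomial (Fin n) F) :
    restrictAffine x₀ (fun o : Option κ => o.elim 0 v) g = rename some (restrictAffine x₀ v g) := by
  rw [restrictAffine, restrictAffine, ← AlgHom.comp_apply, comp_aeval]
  congr 2
  funext l
  simp [Fintype.sum_option]

lemma totalDegree_restrictGeneric (x₀ : Fin n → F) (v : κ → Fin n → F)
    (g : MvPolynomial (Fin n) F) : (restrictGeneric x₀ v g).totalDegree ≤ g.totalDegree := by
  have hX : ∀ (o : Option κ) (a : MvPolynomial (Fin n) F),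
      (X o * C a : MvPolynomial (Option κ) (MvPolynomial (Fin n) F)).totalDegree ≤ 1 := fun o a =>
    (totalDegree_mul _ _).trans (by simp)
  refine totalDegree_aeval_le _ (fun l => ?_) g
  refine (totalDegree_add _ _).trans (max_le (by simp) ?_)
  exact (totalDegree_add _ _).trans
    (max_le (hX _ _) (totalDegree_finsetSum_le fun j _ => hX _ _))

lemma coeffDegreeLE_restrictGeneric (x₀ : Fin n → F) (v : κ → Fin n → F)
    (g : MvPolynomial (Fin n) F) : CoeffDegreeLE (restrictGeneric x₀ v g) :=
  CoeffDegreeLE.aeval (fun l => (CoeffDegreeLE.C_C _).add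
    ((CoeffDegreeLE.X_none_mul_C (by simp)).add
      (CoeffDegreeLE.sum _ fun j => (CoeffDegreeLE.X_some j).mul (CoeffDegreeLE.C_C _)))) g

end Restrict

/-- One Chevalley–Warning step: an affine subspace of zeros can be enlarged by one dimension. -/
lemma exists_extend_zero_subspace {F : Type} [Field F] [Fintype F] {n d t : ℕ} (hd : 0 < d)
    (g : Fin t → MvPolynomial (Fin n) F) (hg : ∀ i, (g i).totalDegree ≤ d) (x₀ : Fin n → F)
    {κ : Type} [Fintype κ] (v : κ → Fin n → F) (hv : LinearIndependent F v)
    (hzero : ∀ i, restrictAffine x₀ v (g i) = 0)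
    (hn : t * (Fintype.card κ + d + 1).choose (d - 1) + Fintype.card κ < n) :
    ∃ w : Fin n → F, LinearIndependent F (fun o : Option κ => o.elim w v) ∧
      ∀ i, restrictAffine x₀ (fun o : Option κ => o.elim w v) (g i) = 0 := by
  classical
  obtain ⟨φ, hφ⟩ := (Fintype.linearCombination F v).exists_leftInverse_of_injective
    (by
      rw [LinearMap.ker_eq_bot]
      exact hv.fintypeLinearCombination_injective)
  set S := (Finsupp.finite_of_degree_le (σ := Option κ) d).toFinset with hS
  let Φ : κ → MvPolynomial (Fin n) F := fun j => ∑ l, C (φ (Pi.single l 1) j) * X l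
  have hΦdeg : ∀ j, (Φ j).totalDegree ≤ 1 := fun j =>
    totalDegree_finsetSum_le fun l _ => (totalDegree_mul _ _).trans (by simp)
  have hΦ : ∀ j w, eval w (Φ j) = φ w j := by
    intro j w
    conv_rhs => rw [pi_eq_sum_univ' w]
    simp [Φ, Finset.sum_apply, mul_comm]
  let G : (Fin t × (Option κ →₀ ℕ)) ⊕ κ → MvPolynomial (Fin n) F :=
    Sum.elim (fun p => coeff p.2 (restrictGeneric x₀ v (g p.1))) Φ
  let T : Finset ((Fin t × (Option κ →₀ ℕ)) ⊕ κ) :=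
    (Finset.univ ×ˢ S).disjSum Finset.univ
  have hdeg : ∑ i ∈ T, (G i).totalDegree < Fintype.card (Fin n) := by
    rw [Finset.sum_disjSum, Finset.sum_product, Fintype.card_fin]
    refine lt_of_le_of_lt (add_le_add ?_ ?_) hn
    · calc _ ≤ ∑ i : Fin t, ∑ s ∈ S, s none :=
            Finset.sum_le_sum fun i _ => Finset.sum_le_sum fun s _ =>
              coeffDegreeLE_restrictGeneric x₀ v (g i) s
        _ ≤ _ := by
            rw [Finset.sum_const, Finset.card_univ, Fintype.card_fin, smul_eq_mul]
            exact Nat.mul_le_mul_left _ (sum_none_le_choose κ d hd)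
    · exact (Finset.sum_le_sum fun j _ => hΦdeg j).trans (by simp)
  obtain ⟨p, hp⟩ := CharP.exists F
  have := CharP.char_is_prime F p
  have hdvd := char_dvd_card_solutions_of_sum_lt p hdeg
  have hvan : ∀ w, (∀ i ∈ T, eval w (G i) = 0) →
      φ w = 0 ∧ ∀ i, restrictAffine x₀ (fun o : Option κ => o.elim w v) (g i) = 0 := by
    intro w hw
    refine ⟨funext fun j => ?_, fun i => ?_⟩
    · rw [← hΦ]
      exact hw (Sum.inr j) (by simp [T])
    · rw [← map_restrictGeneric]
      ext s
      rw [coeff_map, coeff_zero]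
      by_cases hs : s ∈ S
      · exact hw (Sum.inl (i, s)) (by simp [T, hs])
      · rw [coeff_eq_zero_of_totalDegree_lt, map_zero]
        refine lt_of_le_of_lt ((totalDegree_restrictGeneric _ _ _).trans (hg i)) ?_
        rw [hS, Set.Finite.mem_toFinset, Set.mem_ofPred_eq, not_le] at hs
        exact hs
  have h0 : ∀ i ∈ T, eval (0 : Fin n → F) (G i) = 0 := by
    rintro (⟨i, s⟩ | j) -
    · simp only [G, Sum.elim_inl]
      rw [← coeff_map, map_restrictGeneric, restrictAffine_option_zero, hzero, map_zero,
        coeff_zero]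
    · simp only [G, Sum.elim_inr]
      rw [hΦ, map_zero, Pi.zero_apply]
  have hpos : 0 < Fintype.card {x : Fin n → F // ∀ i ∈ T, eval x (G i) = 0} :=
    Fintype.card_pos_iff.mpr ⟨⟨0, h0⟩⟩
  have hone : 1 < Fintype.card {x : Fin n → F // ∀ i ∈ T, eval x (G i) = 0} :=
    this.one_lt.trans_le (Nat.le_of_dvd hpos hdvd)
  obtain ⟨⟨w, hw⟩, hne⟩ := Fintype.exists_ne_of_one_lt_card hone ⟨0, h0⟩
  have hw0 : w ≠ 0 := fun h => hne (Subtype.ext h)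
  obtain ⟨hφw, hres⟩ := hvan w hw
  refine ⟨w, ?_, hres⟩
  rw [linearIndependent_option]
  refine ⟨hv, fun hmem => hw0 ?_⟩
  obtain ⟨c, hc⟩ := (Submodule.mem_span_range_iff_exists_fun F).mp hmem
  have hc' : Fintype.linearCombination F v c = w := hc
  have : c = 0 := by
    rw [← hφw, ← hc']
    exact (LinearMap.congr_fun hφ c).symm
  rw [← hc', this, map_zero]

lemma exists_zero_subspace {F : Type} [Field F] [Fintype F] {n d t : ℕ} (hd : 0 < d)
    (g : Fin t → MvPolynomial (Fin n) F) (hg : ∀ i, (g i).totalDegree ≤ d) (x₀ : Fin n → F)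
    (hx₀ : ∀ i, eval x₀ (g i) = 0) (k : ℕ) (hn : t * (k + d).choose (d - 1) + k ≤ n) :
    ∃ (κ : Type) (_ : Fintype κ) (v : κ → Fin n → F), Fintype.card κ = k ∧
      LinearIndependent F v ∧ ∀ i, restrictAffine x₀ v (g i) = 0 := by
  induction k with
  | zero =>
    refine ⟨Empty, inferInstance, Empty.elim, rfl, linearIndependent_empty_type, fun i => ?_⟩
    have h := eval_restrictAffine x₀ Empty.elim (g i) Empty.elim
    rw [Finset.univ_eq_empty, Finset.sum_empty, add_zero, hx₀] at h
    rw [eq_C_of_isEmpty (restrictAffine x₀ Empty.elim (g i))] at h ⊢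
    rw [eval_C] at h
    rw [h, C_0]
  | succ k ih =>
    have hmono : t * (k + d).choose (d - 1) ≤ t * (k + 1 + d).choose (d - 1) :=
      Nat.mul_le_mul_left _ (Nat.choose_le_choose _ (by omega))
    obtain ⟨κ, _, v, hκ, hv, hzero⟩ := ih (by omega)
    obtain ⟨w, hw, hres⟩ := exists_extend_zero_subspace hd g hg x₀ v hv hzero (by
      rw [hκ, show k + d + 1 = k + 1 + d by omega]
      omega)
    exact ⟨Option κ, inferInstance, _, by rw [Fintype.card_option, hκ], hw, hres⟩

lemma AffineDisperser.not_constant_of_le {F : Type} [Field F] [Fintype F] {n d t k : ℕ}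
    (hd : 0 < d) {f : (Fin n → F) → F} (hf : AffineDisperser f k)
    (hn : t * (k + d).choose (d - 1) + k ≤ n)
    (g : Fin t → MvPolynomial (Fin n) F) (hg : ∀ i, (g i).totalDegree ≤ d)
    {x₀ : Fin n → F} (hx₀ : ∀ i, eval x₀ (g i) = 0) :
    ∃ x y, (∀ i, eval x (g i) = 0) ∧ (∀ i, eval y (g i) = 0) ∧ f x ≠ f y := by
  obtain ⟨κ, _, v, hκ, hv, hzero⟩ := exists_zero_subspace hd g hg x₀ hx₀ k hn
  obtain ⟨a, ha, b, hb, hab⟩ := hf x₀ (Submodule.span F (Set.range v))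
    (by rw [finrank_span_eq_card hv, hκ])
  have key : ∀ u ∈ Submodule.span F (Set.range v), ∀ i, eval (x₀ + u) (g i) = 0 := by
    intro u hu i
    obtain ⟨c, rfl⟩ := (Submodule.mem_span_range_iff_exists_fun F).mp hu
    rw [← eval_restrictAffine, hzero, map_zero]
  exact ⟨_, _, key a ha, key b hb, hab⟩

/-- The bound on the dimension needed for the Chevalley–Warning argument. -/
lemma mul_choose_add_le {n d t : ℕ} (hn : 0 < n) (hd : 0 < d) (ht : 0 < t)
    (h : (d : ℝ) < Real.logb 2 ((n : ℝ) / (t : ℝ)) / 10) :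
    t * (⌈(1 / 64 : ℝ) * (d : ℝ) * ((n : ℝ) / (t : ℝ)) ^ ((1 : ℝ) / ((d : ℝ) - 1))⌉₊ + d).choose
        (d - 1) +
      ⌈(1 / 64 : ℝ) * (d : ℝ) * ((n : ℝ) / (t : ℝ)) ^ ((1 : ℝ) / ((d : ℝ) - 1))⌉₊ ≤ n := by
  have htR : (1 : ℝ) ≤ t := by exact_mod_cast ht
  have hnR : (0 : ℝ) < n := by exact_mod_cast hn
  set N : ℝ := (n : ℝ) / t with hN
  have hN0 : 0 < N := by positivity
  have htN : (n : ℝ) = t * N := by rw [hN]; field_simp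
  have hbig : (1024 : ℝ) ^ d ≤ N := by
    have h1 : ((10 * d : ℕ) : ℝ) < Real.logb 2 N := by push_cast; linarith
    rw [Real.lt_logb_iff_rpow_lt (by norm_num) hN0, Real.rpow_natCast, pow_mul] at h1
    norm_num at h1
    exact h1.le
  obtain ⟨e, rfl⟩ : ∃ e, d = e + 1 := ⟨d - 1, by omega⟩
  rw [Nat.add_sub_cancel]
  rcases Nat.eq_zero_or_pos e with rfl | he
  · have h2 : ⌈(1 / 64 : ℝ) * ((0 + 1 : ℕ) : ℝ) * N ^ ((1 : ℝ) / (((0 + 1 : ℕ) : ℝ) - 1))⌉₊ = 1 := by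
      rw [Nat.ceil_eq_iff (by norm_num)]
      norm_num
    rw [h2, Nat.choose_zero_right, mul_one]
    have : (t : ℝ) + 1 ≤ n := by
      rw [htN]
      norm_num at hbig
      nlinarith
    exact_mod_cast this
  have heR : (1 : ℝ) ≤ e := by exact_mod_cast he
  rw [show (((e + 1 : ℕ) : ℝ) - 1) = e by push_cast; ring]
  set M : ℝ := N ^ ((1 : ℝ) / e) with hM
  have hM0 : 0 < M := by positivity
  have hMe : M ^ e = N := by
    rw [hM, one_div]
    exact Real.rpow_inv_natCast_pow hN0.le he.ne'
  have hM1024 : 1024 ≤ M := by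
    by_contra! hlt
    have h1 : M ^ e ≤ 1024 ^ e := pow_le_pow_left₀ hM0.le hlt.le e
    have h2 : (1024 : ℝ) ^ e < 1024 ^ (e + 1) := pow_lt_pow_right₀ (by norm_num) (by omega)
    linarith
  have heM : (e : ℝ) * M ≤ N := by
    obtain ⟨c, rfl⟩ : ∃ c, e = c + 1 := ⟨e - 1, by omega⟩
    rw [← hMe, pow_succ]
    refine mul_le_mul_of_nonneg_right ?_ hM0.le
    have h1 := one_add_mul_le_pow (a := M - 1) (by linarith) c
    have h2 : (0 : ℝ) ≤ c := by positivity
    push_cast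
    rw [add_sub_cancel] at h1
    nlinarith
  set k := ⌈(1 / 64 : ℝ) * ((e + 1 : ℕ) : ℝ) * M⌉₊ with hk
  have hkR : (k : ℝ) ≤ 1 / 64 * (e + 1) * M + 1 := by
    have := (Nat.ceil_lt_add_one (a := (1 / 64 : ℝ) * ((e + 1 : ℕ) : ℝ) * M) (by positivity)).le
    push_cast at this
    simpa [hk] using this
  have hkN : (k : ℝ) ≤ N / 2 := by nlinarith
  have hke : ((k + (e + 1) : ℕ) : ℝ) ≤ e * (M / 24) := by
    push_cast
    nlinarith
  have hchoose : ((k + (e + 1)).choose e : ℝ) ≤ N / 8 := by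
    have hfac : (e : ℝ) ^ e / e.factorial ≤ 3 ^ e := by
      refine (Real.pow_div_factorial_le_exp _ (by positivity) e).trans ?_
      rw [← Real.exp_one_rpow, Real.rpow_natCast]
      exact pow_le_pow_left₀ (Real.exp_pos _).le (by linarith [Real.exp_one_lt_d9]) e
    calc ((k + (e + 1)).choose e : ℝ)
        ≤ ((k + (e + 1) : ℕ) : ℝ) ^ e / e.factorial := Nat.choose_le_pow_div e _
      _ ≤ (e * (M / 24)) ^ e / e.factorial := by gcongr
      _ = (e : ℝ) ^ e / e.factorial * (M / 24) ^ e := by rw [mul_pow]; ring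
      _ ≤ 3 ^ e * (M / 24) ^ e := by gcongr
      _ = N * (1 / 8) ^ e := by rw [← mul_pow, ← hMe, ← mul_pow]; congr 1; ring
      _ ≤ N * (1 / 8) := by
          gcongr
          exact pow_le_of_le_one (by norm_num) (by norm_num) he.ne'
      _ = N / 8 := by ring
  have hfin : (t : ℝ) * (k + (e + 1)).choose e + k ≤ n := by
    rw [htN]
    nlinarith [mul_le_mul_of_nonneg_left hchoose (by linarith : (0 : ℝ) ≤ t)]
  exact_mod_cast hfin

theorem stmt_13 : ∃ α : ℝ, 0 < α ∧
    ∀ (q : ℕ), IsPrimePow q →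
    ∀ (n d t : ℕ), 0 < n → 0 < d → 0 < t →
    (d : ℝ) < Real.logb 2 ((n : ℝ) / (t : ℝ)) / 10 →
    ∀ (F : Type) [Field F] [Fintype F], Fintype.card F = q →
    ∀ f : (Fin n → F) → F,
      AffineDisperser f
        ⌈α * (d : ℝ) * ((n : ℝ) / (t : ℝ)) ^ ((1 : ℝ) / ((d : ℝ) - 1))⌉₊ →
      ∀ g : Fin t → MvPolynomial (Fin n) F, (∀ i, (g i).totalDegree ≤ d) →
        ∀ V : Finset (Fin n → F),
          (∀ x, x ∈ V ↔ ∀ i, eval x (g i) = 0) →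
          V.Nonempty →
          ∃ x ∈ V, ∃ y ∈ V, f x ≠ f y := by
  refine ⟨1 / 64, by norm_num, ?_⟩
  intro q _ n d t hn hd ht h F _ _ _ f hf g hg V hV ⟨x₀, hx₀⟩
  obtain ⟨x, y, hx, hy, hxy⟩ := hf.not_constant_of_le hd (mul_choose_add_le hn hd ht h) g hg
    ((hV x₀).mp hx₀)
  exact ⟨x, (hV x).mpr hx, y, (hV y).mpr hy, hxy⟩
end

section
/- Let p be a prime number. For every integer d ≥ 3 and every δ ∈ (0,1), there exists a constant c = c(d,δ) > 0 such that the following holds for all n and k. Let f : F_p^n → F_p be a polynomial of total degree at most d that is an affine disperser for dimension k. Then f is an affine extractor for dimension ⌈c · k^{d-2}⌉ with bias δ. -/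
open MvPolynomial
open scoped Classical

/-- `f` is given by a polynomial of total degree at most `d`. -/
def IsPolynomialFun {F : Type} [Field F] {n : ℕ} (d : ℕ) (f : (Fin n → F) → F) : Prop :=
  ∃ P : MvPolynomial (Fin n) F, P.totalDegree ≤ d ∧ ∀ x, eval x P = f x

section PolynomialFun

variable {F : Type} [Field F] {n r d : ℕ}

lemma totalDegree_bind₁_le_of_le_one (Q : Fin n → MvPolynomial (Fin r) F)
    (hQ : ∀ i, (Q i).totalDegree ≤ 1) (P : MvPolynomial (Fin n) F) :
    (bind₁ Q P).totalDegree ≤ P.totalDegree := by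
  rw [bind₁, aeval_def, eval₂_eq]
  refine totalDegree_finsetSum_le fun s hs => ?_
  refine (totalDegree_mul _ _).trans ?_
  have h1 : (algebraMap F (MvPolynomial (Fin r) F) (coeff s P)).totalDegree = 0 :=
    totalDegree_C _
  rw [h1, zero_add]
  refine (totalDegree_finsetProd _ _).trans ?_
  refine le_trans ?_ (le_totalDegree hs)
  refine Finset.sum_le_sum fun i _ => ?_
  exact (totalDegree_pow _ _).trans (by nlinarith [hQ i])

lemma IsPolynomialFun.sub {f g : (Fin n → F) → F} (hf : IsPolynomialFun d f)
    (hg : IsPolynomialFun d g) : IsPolynomialFun d (fun x => f x - g x) := by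
  obtain ⟨P, hP, hP'⟩ := hf
  obtain ⟨Q, hQ, hQ'⟩ := hg
  exact ⟨P - Q, (totalDegree_sub _ _).trans (max_le hP hQ), fun x => by simp [hP', hQ']⟩

lemma IsPolynomialFun.const_mul {f : (Fin n → F) → F} (hf : IsPolynomialFun d f) (a : F) :
    IsPolynomialFun d (fun x => a * f x) := by
  obtain ⟨P, hP, hP'⟩ := hf
  refine ⟨C a * P, (totalDegree_mul _ _).trans ?_, fun x => by simp [hP']⟩
  simpa using hP

lemma IsPolynomialFun.comp_affine {f : (Fin n → F) → F} (hf : IsPolynomialFun d f)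
    (a : Fin n → F) (φ : (Fin r → F) →ₗ[F] (Fin n → F)) :
    IsPolynomialFun d (fun t => f (a + φ t)) := by
  obtain ⟨P, hP, hP'⟩ := hf
  let Q : Fin n → MvPolynomial (Fin r) F := fun i =>
    C (a i) + ∑ j, C (φ (Pi.single j 1) i) * X j
  refine ⟨bind₁ Q P, (totalDegree_bind₁_le_of_le_one Q (fun i => ?_) P).trans hP, fun t => ?_⟩
  · refine (totalDegree_add _ _).trans (max_le (by simp) ?_)
    refine totalDegree_finsetSum_le fun j _ => (totalDegree_mul _ _).trans ?_
    simp
  · change _ = f (a + φ t)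
    rw [← hP', eval, eval₂Hom_bind₁]
    have : (fun i => eval₂Hom (RingHom.id F) t (Q i)) = a + φ t := by
      funext i
      have h : φ t = ∑ j, t j • φ (Pi.single j 1) := by
        conv_lhs => rw [pi_eq_sum_univ' t]
        simp [map_sum]
      simp [Q, h, mul_comm]
    rw [this]
    rfl

lemma IsPolynomialFun.fwdDiff {f : (Fin n → F) → F} (hf : IsPolynomialFun d f)
    (u : Fin n → F) : IsPolynomialFun d (fwdDiff u f) := by
  have h := (hf.comp_affine u LinearMap.id).sub hf
  have h' : (fun x => f (u + LinearMap.id (R := F) x) - f x) = _root_.fwdDiff u f := by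
    funext x
    simp [_root_.fwdDiff, add_comm]
  rwa [h'] at h

lemma IsPolynomialFun.fwdDiff_iterate_comp {f : (Fin n → F) → F} (hf : IsPolynomialFun d f)
    (φ : (Fin r → F) →ₗ[F] (Fin n → F)) (s : ℕ) :
    IsPolynomialFun d (fun t => (_root_.fwdDiff (φ t))^[s] f 0) := by
  suffices h : ∀ j : ℕ, IsPolynomialFun d
      (fun t => (_root_.fwdDiff (φ t))^[s] f ((j : F) • φ t)) by
    simpa using h 0
  induction s with
  | zero =>
    intro j
    simpa using hf.comp_affine 0 ((j : F) • φ)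
  | succ s ih =>
    intro j
    have h := (ih (j + 1)).sub (ih j)
    simp only [Function.iterate_succ_apply', _root_.fwdDiff]
    simpa [add_smul] using h

end PolynomialFun

/-- All `k`-fold finite differences of `f` vanish. -/
def FwdDiffVanish {E G : Type} [AddCommGroup E] [AddCommGroup G] : ℕ → (E → G) → Prop
  | 0, f => f = 0
  | k + 1, f => ∀ u, FwdDiffVanish k (fwdDiff u f)

section FwdDiffVanish

variable {E G : Type} [AddCommGroup E] [AddCommGroup G]

lemma FwdDiffVanish.zero (k : ℕ) : FwdDiffVanish k (0 : E → G) := by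
  induction k with
  | zero => rfl
  | succ k ih =>
    intro u
    have : fwdDiff u (0 : E → G) = 0 := by funext x; simp [fwdDiff]
    rwa [this]

lemma FwdDiffVanish.add {k : ℕ} {f g : E → G} (hf : FwdDiffVanish k f)
    (hg : FwdDiffVanish k g) : FwdDiffVanish k (f + g) := by
  induction k generalizing f g with
  | zero => simp_all [FwdDiffVanish]
  | succ k ih =>
    intro u
    rw [fwdDiff_add]
    exact ih (hf u) (hg u)

lemma FwdDiffVanish.const_mul {R : Type} [CommRing R] {k : ℕ} {f : E → R}
    (hf : FwdDiffVanish k f) (a : R) : FwdDiffVanish k (fun x => a * f x) := by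
  induction k generalizing f with
  | zero =>
    have : f = 0 := hf
    subst this
    funext x
    simp
  | succ k ih =>
    intro u
    have : fwdDiff u (fun x => a * f x) = fun x => a * fwdDiff u f x := by
      funext x; simp [fwdDiff, mul_sub]
    rw [this]
    exact ih (hf u)

lemma FwdDiffVanish.shift {k : ℕ} {f : E → G} (hf : FwdDiffVanish k f) (u : E) :
    FwdDiffVanish k (fun x => f (x + u)) := by
  induction k generalizing f with
  | zero =>
    have : f = 0 := hf
    subst this
    rfl
  | succ k ih =>
    intro v
    have : fwdDiff v (fun x => f (x + u)) = fun x => fwdDiff v f (x + u) := by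
      funext x; simp [fwdDiff, add_right_comm]
    rw [this]
    exact ih (hf v)

lemma FwdDiffVanish.succ {k : ℕ} {f : E → G} (hf : FwdDiffVanish k f) :
    FwdDiffVanish (k + 1) f := by
  induction k generalizing f with
  | zero =>
    have : f = 0 := hf
    subst this
    exact FwdDiffVanish.zero 1
  | succ k ih => exact fun u => ih (hf u)

lemma FwdDiffVanish.mono {k l : ℕ} {f : E → G} (hf : FwdDiffVanish k f) (h : k ≤ l) :
    FwdDiffVanish l f := by
  induction h with
  | refl => exact hf
  | step _ ih => exact ih.succ

lemma FwdDiffVanish.mul_coord {F : Type} [Field F] {n k : ℕ} {f : (Fin n → F) → F}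
    (hf : FwdDiffVanish k f) (i : Fin n) : FwdDiffVanish (k + 1) (fun x => f x * x i) := by
  induction k generalizing f with
  | zero =>
    have : f = 0 := hf
    subst this
    have : (fun x : Fin n → F => (0 : (Fin n → F) → F) x * x i) = 0 := by funext x; simp
    rw [this]
    exact FwdDiffVanish.zero 1
  | succ k ih =>
    intro u
    have : fwdDiff u (fun x => f x * x i) =
        (fun x => fwdDiff u f x * x i) + fun x => u i * f (x + u) := by
      funext x; simp [fwdDiff]; ring
    rw [this]
    exact (ih (hf u)).add ((hf.shift u).const_mul _)

lemma FwdDiffVanish.one_const (a : G) : FwdDiffVanish 1 (fun _ : E => a) := by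
  intro u
  funext x
  simp [fwdDiff]

lemma FwdDiffVanish.eval_monomial {F : Type} [Field F] {n : ℕ} (s : Fin n →₀ ℕ) (a : F) :
    FwdDiffVanish (s.degree + 1) (fun x : Fin n → F => eval x (monomial s a)) := by
  obtain ⟨k, hk⟩ : ∃ k, s.degree = k := ⟨_, rfl⟩
  rw [hk]
  induction k generalizing s with
  | zero =>
    rw [Finsupp.degree_eq_zero_iff] at hk
    subst hk
    simpa using FwdDiffVanish.one_const a
  | succ k ih =>
    obtain ⟨i, hi⟩ : ∃ i, s i ≠ 0 := by
      by_contra! h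
      have : s = 0 := by ext i; simpa using h i
      simp [this] at hk
    have hs : s - Finsupp.single i 1 + Finsupp.single i 1 = s :=
      tsub_add_cancel_of_le (by simpa using Nat.one_le_iff_ne_zero.mpr hi)
    have hd : (s - Finsupp.single i 1).degree = k := by
      have := congrArg Finsupp.degree hs
      rw [map_add, Finsupp.degree_single] at this
      omega
    have h := (ih _ hd).mul_coord i
    convert h using 2 with x
    conv_lhs => rw [← hs, monomial_add_single]
    simp

lemma IsPolynomialFun.fwdDiffVanish {F : Type} [Field F] {n d : ℕ} {f : (Fin n → F) → F}
    (hf : IsPolynomialFun d f) : FwdDiffVanish (d + 1) f := by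
  obtain ⟨P, hP, hP'⟩ := hf
  have h : f = ∑ s ∈ P.support, fun x => eval x (monomial s (coeff s P)) := by
    funext x
    rw [← hP' x]
    conv_lhs => rw [P.as_sum]
    simp only [map_sum, Finset.sum_apply]
  rw [h]
  refine Finset.sum_induction _ (FwdDiffVanish (d + 1)) (fun _ _ => FwdDiffVanish.add)
    (FwdDiffVanish.zero _) fun s hs => ?_
  refine (FwdDiffVanish.eval_monomial s _).mono ?_
  have := (le_totalDegree hs).trans hP
  simp only [Finsupp.degree_eq_sum, Finsupp.sum_fintype, implies_true] at *
  omega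

end FwdDiffVanish

section Structure

variable {p : ℕ} [Fact p.Prime]

lemma mem_addSubmonoid_closure_of_mem_span {E : Type} [AddCommGroup E] [Module (ZMod p) E]
    {S : Set E} {x : E} (hx : x ∈ Submodule.span (ZMod p) S) : x ∈ AddSubmonoid.closure S := by
  let W : Submodule (ZMod p) E :=
    { AddSubmonoid.closure S with
      smul_mem' := fun c y hy => by
        have : c • y = c.val • y := by
          rw [← Nat.cast_smul_eq_nsmul (ZMod p), ZMod.natCast_zmod_val]
        rw [this]
        exact (AddSubmonoid.closure S).nsmul_mem hy _ }
  exact (Submodule.span_le (p := W)).2 AddSubmonoid.subset_closure hx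

/-- A dense symmetric set generates its span in a bounded number of steps. -/
lemma span_subset_of_card_lt {E : Type} [AddCommGroup E] [Module (ZMod p) E] [Fintype E]
    (S : ℕ → Set E) (hmono : Monotone S)
    (hadd : ∀ i j x y, x ∈ S i → y ∈ S j → x + y ∈ S (i + j))
    (hneg : ∀ i x, x ∈ S i → -x ∈ S i) (h0 : 0 ∈ S 0) (m : ℕ)
    (hm : Fintype.card E < m * (S 1).ncard) :
    ∀ x ∈ Submodule.span (ZMod p) (S 1), x ∈ S (3 * m) := by
  obtain ⟨i, him, hi⟩ : ∃ i < m, S (3 * i + 2) ⊆ S (3 * i + 1) := by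
    by_contra! h
    have key : ∀ i ≤ m, i * (S 1).ncard ≤ (S (3 * i)).ncard := by
      intro i
      induction i with
      | zero => simp
      | succ i ih =>
        intro hi
        obtain ⟨w, hw2, hw1⟩ := Set.not_subset.1 (h i hi)
        have hdisj : Disjoint (S (3 * i)) ((fun x => w + x) '' S 1) := by
          rw [Set.disjoint_left]
          rintro _ hx ⟨y, hy, rfl⟩
          refine hw1 ?_
          have := hadd _ _ _ _ hx (hneg _ _ hy)
          simpa using this
        have hsub : S (3 * i) ∪ ((fun x => w + x) '' S 1) ⊆ S (3 * (i + 1)) := by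
          rintro x (hx | ⟨y, hy, rfl⟩)
          · exact hmono (by omega) hx
          · exact hadd (3 * i + 2) 1 _ _ hw2 hy
        have hcard := Set.ncard_le_ncard hsub (Set.toFinite _)
        rw [Set.ncard_union_eq hdisj (Set.toFinite _) (Set.toFinite _),
          Set.ncard_image_of_injective _ (add_right_injective w)] at hcard
        have := ih (by omega)
        linarith
    have h1 := key m le_rfl
    have h2 : (S (3 * m)).ncard ≤ Fintype.card E := by
      rw [← Nat.card_eq_fintype_card]
      exact Set.ncard_le_card _
    omega
  intro x hx
  refine hmono (show 3 * i + 1 ≤ 3 * m by omega) ?_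
  refine AddSubmonoid.closure_induction_left (motive := fun x _ => x ∈ S (3 * i + 1))
    (hmono (Nat.zero_le _) h0) (fun u hu y _ hy => ?_) (mem_addSubmonoid_closure_of_mem_span hx)
  refine hi ?_
  have := hadd _ _ _ _ hy hu
  rwa [add_comm u y]

/-- `f` becomes constant after differencing `e` times, where each direction ranges over a
subspace of codimension at most `C` depending on the previous directions. -/
def HereditarilyConstant {E : Type} [AddCommGroup E] [Module (ZMod p) E] (C : ℕ) :
    ℕ → (E → ZMod p) → Prop
  | 0, f => ∀ x y, f x = f y
  | e + 1, f => ∃ W : Submodule (ZMod p) E,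
      Module.finrank (ZMod p) E ≤ Module.finrank (ZMod p) W + C ∧
      ∀ h ∈ W, HereditarilyConstant C e (fwdDiff h f)

namespace HereditarilyConstant

variable {E : Type} [AddCommGroup E] [Module (ZMod p) E]

lemma mono {C C' e : ℕ} {f : E → ZMod p} (hf : HereditarilyConstant C e f) (h : C ≤ C') :
    HereditarilyConstant C' e f := by
  induction e generalizing f with
  | zero => exact hf
  | succ e ih =>
    obtain ⟨W, hW, hW'⟩ := hf
    exact ⟨W, by omega, fun u hu => ih (hW' u hu)⟩

lemma zero (C e : ℕ) : HereditarilyConstant C e (0 : E → ZMod p) := by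
  induction e with
  | zero => exact fun _ _ => rfl
  | succ e ih =>
    refine ⟨⊤, by simp, fun u _ => ?_⟩
    have : fwdDiff u (0 : E → ZMod p) = 0 := by funext x; simp [fwdDiff]
    rwa [this]

lemma shift {C e : ℕ} {f : E → ZMod p} (hf : HereditarilyConstant C e f) (u : E) :
    HereditarilyConstant C e (fun x => f (x + u)) := by
  induction e generalizing f with
  | zero => exact fun _ _ => hf _ _
  | succ e ih =>
    obtain ⟨W, hW, hW'⟩ := hf
    refine ⟨W, hW, fun v hv => ?_⟩
    have : fwdDiff v (fun x => f (x + u)) = fun x => fwdDiff v f (x + u) := by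
      funext x; simp [fwdDiff, add_right_comm]
    rw [this]
    exact ih (hW' v hv)

lemma neg {C e : ℕ} {f : E → ZMod p} (hf : HereditarilyConstant C e f) :
    HereditarilyConstant C e (-f) := by
  induction e generalizing f with
  | zero => exact fun x y => by simp [hf x y]
  | succ e ih =>
    obtain ⟨W, hW, hW'⟩ := hf
    refine ⟨W, hW, fun v hv => ?_⟩
    have : fwdDiff v (-f) = -fwdDiff v f := by
      funext x; simp [fwdDiff]; ring
    rw [this]
    exact ih (hW' v hv)

lemma add [Finite E] {C C' e : ℕ} {f g : E → ZMod p} (hf : HereditarilyConstant C e f)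
    (hg : HereditarilyConstant C' e g) : HereditarilyConstant (C + C') e (f + g) := by
  induction e generalizing f g with
  | zero => exact fun x y => by simp [hf x y, hg x y]
  | succ e ih =>
    obtain ⟨W, hW, hW'⟩ := hf
    obtain ⟨V, hV, hV'⟩ := hg
    refine ⟨W ⊓ V, ?_, fun u hu => ?_⟩
    · have h1 := Submodule.finrank_sup_add_finrank_inf_eq W V
      have h2 := Submodule.finrank_le (W ⊔ V)
      omega
    · rw [fwdDiff_add]
      exact ih (hW' u hu.1) (hV' u hu.2)

end HereditarilyConstant

lemma fwdDiff_add_dir {E G : Type} [AddCommGroup E] [AddCommGroup G] (u v : E) (f : E → G) :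
    fwdDiff (u + v) f = (fun x => fwdDiff u f (x + v)) + fwdDiff v f := by
  funext x
  simp only [fwdDiff, Pi.add_apply]
  rw [add_assoc x v u, add_comm v u]
  abel

lemma fwdDiff_neg_dir {E G : Type} [AddCommGroup E] [AddCommGroup G] (u : E) (f : E → G) :
    fwdDiff (-u) f = -fun x => fwdDiff u f (x + -u) := by
  funext x
  simp [fwdDiff]

lemma fwdDiff_zero_dir {E G : Type} [AddCommGroup E] [AddCommGroup G] (f : E → G) :
    fwdDiff 0 f = 0 := by
  funext x
  simp [fwdDiff]

/-- If many derivatives of `f` are hereditarily constant, then so is `f`. -/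
lemma HereditarilyConstant.of_dense {E : Type} [AddCommGroup E] [Module (ZMod p) E] [Fintype E]
    {C e m : ℕ} {f : E → ZMod p} (B : Set E) (hB : ∀ h ∈ B, HereditarilyConstant C e (fwdDiff h f))
    (hm : Fintype.card E < m * B.ncard) :
    HereditarilyConstant (3 * m * C + m) (e + 1) f := by
  let S : ℕ → Set E := fun j => {h | HereditarilyConstant (j * C) e (fwdDiff h f)}
  have hBS : B ⊆ S 1 := fun h hh => by simpa [S] using hB h hh
  have hcard := Set.ncard_le_ncard hBS (Set.toFinite _)
  have hm' : Fintype.card E < m * (S 1).ncard := hm.trans_le (Nat.mul_le_mul_left _ hcard)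
  have hspan := span_subset_of_card_lt (p := p) S
    (fun i j hij x hx => HereditarilyConstant.mono hx (Nat.mul_le_mul_right _ hij))
    (fun i j x y hx hy => by
      change HereditarilyConstant _ _ _
      rw [fwdDiff_add_dir, add_mul]
      exact (HereditarilyConstant.shift hx _).add hy)
    (fun i x hx => by
      change HereditarilyConstant _ _ _
      rw [fwdDiff_neg_dir]
      exact (HereditarilyConstant.shift hx _).neg)
    (by
      change HereditarilyConstant _ _ _
      rw [fwdDiff_zero_dir]
      exact HereditarilyConstant.zero _ _) m hm'
  refine ⟨Submodule.span (ZMod p) (S 1), ?_, fun h hh => (hspan h hh).mono (by omega)⟩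
  set W := Submodule.span (ZMod p) (S 1) with hW
  have hSW : (S 1).ncard ≤ p ^ Module.finrank (ZMod p) W := by
    have h1 : (S 1).ncard ≤ (W : Set E).ncard :=
      Set.ncard_le_ncard Submodule.subset_span (Set.toFinite _)
    have h2 : (W : Set E).ncard = p ^ Module.finrank (ZMod p) W := by
      rw [← Nat.card_coe_set_eq]
      have := Module.natCard_eq_pow_finrank (K := ZMod p) (V := W)
      rwa [Nat.card_zmod] at this
    omega
  have hE : Fintype.card E = p ^ Module.finrank (ZMod p) E := by
    have := Module.natCard_eq_pow_finrank (K := ZMod p) (V := E)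
    rwa [Nat.card_zmod, Nat.card_eq_fintype_card] at this
  have hp : 1 < p := (Fact.out : p.Prime).one_lt
  have h3 : p ^ Module.finrank (ZMod p) E < p ^ (Module.finrank (ZMod p) W + m) := by
    rw [← hE, pow_add]
    calc Fintype.card E < m * (S 1).ncard := hm'
      _ ≤ p ^ m * p ^ Module.finrank (ZMod p) W :=
        Nat.mul_le_mul (Nat.lt_pow_self hp).le hSW
      _ = _ := mul_comm _ _
  have := (Nat.pow_lt_pow_iff_right hp).1 h3
  omega

lemma norm_sum_stdAddChar_sq_le {E : Type} [AddCommGroup E] [Fintype E] (f : E → ZMod p) :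
    ‖∑ x, ZMod.stdAddChar (f x)‖ ^ 2 ≤ ∑ h, ‖∑ x, ZMod.stdAddChar (fwdDiff h f x)‖ := by
  have key : (starRingEnd ℂ) (∑ x, ZMod.stdAddChar (f x)) * ∑ x, ZMod.stdAddChar (f x) =
      ∑ h, ∑ x, ZMod.stdAddChar (fwdDiff h f x) := by
    rw [map_sum, Finset.sum_mul, Finset.sum_comm]
    refine Finset.sum_congr rfl fun x _ => ?_
    rw [Finset.mul_sum, ← Equiv.sum_comp (Equiv.addLeft x)]
    refine Finset.sum_congr rfl fun h _ => ?_
    rw [AddChar.starComp_apply (by simp [ZMod.ringChar_zmod_n, (Fact.out : p.Prime).pos])]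
    simp [fwdDiff, sub_eq_add_neg, AddChar.map_add_eq_mul, mul_comm]
  calc ‖∑ x, ZMod.stdAddChar (f x)‖ ^ 2
      = ‖(starRingEnd ℂ) (∑ x, ZMod.stdAddChar (f x)) * ∑ x, ZMod.stdAddChar (f x)‖ := by
        rw [norm_mul, RCLike.norm_conj, sq]
    _ = ‖∑ h, ∑ x, ZMod.stdAddChar (fwdDiff h f x)‖ := by rw [key]
    _ ≤ _ := norm_sum_le _ _

lemma norm_sum_stdAddChar_le {E : Type} [Fintype E] (f : E → ZMod p) :
    ‖∑ x, ZMod.stdAddChar (f x)‖ ≤ Fintype.card E := by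
  refine (norm_sum_le _ _).trans ?_
  simp [AddChar.norm_apply]

/-- A biased function with vanishing differences of bounded order is hereditarily constant. -/
lemma exists_hereditarilyConstant_of_biased (e : ℕ) (ε : ℝ) (hε : 0 < ε) :
    ∃ C : ℕ, ∀ (n : ℕ) (f : (Fin n → ZMod p) → ZMod p), FwdDiffVanish (e + 2) f →
      ε * Fintype.card (Fin n → ZMod p) ≤ ‖∑ x, ZMod.stdAddChar (f x)‖ →
      HereditarilyConstant C e f := by
  induction e generalizing ε with
  | zero =>
    refine ⟨0, fun n f hf hb x y => ?_⟩
    by_contra hne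
    set S := ∑ x, ZMod.stdAddChar (f x) with hS
    have hN : (0 : ℝ) < Fintype.card (Fin n → ZMod p) := by
      exact_mod_cast Fintype.card_pos
    have hS0 : S ≠ 0 := by
      intro h
      rw [h, norm_zero] at hb
      nlinarith [mul_pos hε hN]
    have hc : ∀ z, f (z + (x - y)) = f z + (f x - f y) := by
      intro z
      have h := congrFun (hf (x - y) (z - y)) y
      simp only [fwdDiff, Pi.zero_apply] at h
      have h1 : y + (z - y) = z := by abel
      have h2 : y + (x - y) = x := by abel
      rw [h1, h2] at h
      linear_combination h
    have hSS : S = S * ZMod.stdAddChar (f x - f y) := by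
      conv_lhs => rw [hS, ← Equiv.sum_comp (Equiv.addRight (x - y))]
      rw [hS, Finset.sum_mul]
      refine Finset.sum_congr rfl fun z _ => ?_
      rw [← AddChar.map_add_eq_mul, ← hc]
      rfl
    have h1 : ZMod.stdAddChar (f x - f y) = (1 : ℂ) :=
      mul_left_cancel₀ hS0 (by rw [← hSS, mul_one])
    have h2 : f x - f y = 0 := by
      apply ZMod.injective_stdAddChar
      rw [h1, AddChar.map_zero_eq_one]
    exact hne (sub_eq_zero.1 h2)
  | succ e ih =>
    obtain ⟨C, hC⟩ := ih (ε ^ 2 / 2) (by positivity)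
    obtain ⟨m, hm⟩ := exists_nat_gt (2 / ε ^ 2)
    refine ⟨3 * m * C + m, fun n f hf hb => ?_⟩
    set N := Fintype.card (Fin n → ZMod p) with hN
    have hNpos : (0 : ℝ) < N := by
      exact_mod_cast Fintype.card_pos
    let B : Finset (Fin n → ZMod p) :=
      {h | ε ^ 2 / 2 * N ≤ ‖∑ x, ZMod.stdAddChar (fwdDiff h f x)‖}
    have hsum : ∑ h, ‖∑ x, ZMod.stdAddChar (fwdDiff h f x)‖ ≤
        B.card * N + N * (ε ^ 2 / 2 * N) := by
      rw [← Finset.sum_filter_add_sum_filter_not Finset.univ (fun h => h ∈ B)]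
      refine add_le_add ?_ ?_
      · have := Finset.sum_le_card_nsmul (Finset.univ.filter (· ∈ B))
          (fun h => ‖∑ x, ZMod.stdAddChar (fwdDiff h f x)‖) N
          (fun h _ => norm_sum_stdAddChar_le _)
        simpa using this
      · have := Finset.sum_le_card_nsmul (Finset.univ.filter (· ∉ B))
          (fun h => ‖∑ x, ZMod.stdAddChar (fwdDiff h f x)‖) (ε ^ 2 / 2 * N)
          (fun h hh => by
            have : h ∉ B := (Finset.mem_filter.1 hh).2
            simp only [B, Finset.mem_filter, Finset.mem_univ, true_and, not_le] at this
            exact this.le)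
        refine this.trans ?_
        rw [nsmul_eq_mul]
        refine mul_le_mul_of_nonneg_right ?_ (by positivity)
        exact_mod_cast Finset.card_le_univ _
    have hsq : (ε * N) ^ 2 ≤ ∑ h, ‖∑ x, ZMod.stdAddChar (fwdDiff h f x)‖ :=
      (pow_le_pow_left₀ (by positivity) hb 2).trans (norm_sum_stdAddChar_sq_le f)
    have hB : ε ^ 2 / 2 * N ≤ B.card := by
      have : (ε ^ 2 / 2 * N) * N ≤ B.card * N := by nlinarith
      exact le_of_mul_le_mul_right this hNpos
    refine HereditarilyConstant.of_dense (B : Set (Fin n → ZMod p)) (fun h hh => ?_) ?_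
    · refine hC n _ (hf h) ?_
      exact (Finset.mem_filter.1 hh).2
    · rw [Set.ncard_coe_finset]
      have hm' : 1 < m * (ε ^ 2 / 2) := by
        rw [div_lt_iff₀ (by positivity)] at hm
        linarith
      have : (N : ℝ) < m * B.card := by
        calc (N : ℝ) < (m * (ε ^ 2 / 2)) * N := by nlinarith
          _ = m * (ε ^ 2 / 2 * N) := by ring
          _ ≤ m * B.card := by gcongr
      exact_mod_cast this

section IteratedDifferences

variable {E G : Type} [AddCommGroup E] [AddCommGroup G]

instance : LeftCommutative (fwdDiff : E → (E → G) → E → G) where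
  left_comm u v f := by
    funext x
    simp only [fwdDiff, add_right_comm x u v]
    abel

lemma foldr_fwdDiff_replicate (s : ℕ) (u : E) (f : E → G) :
    (List.replicate s u).foldr fwdDiff f = (fwdDiff u)^[s] f := by
  induction s with
  | zero => rfl
  | succ s ih => rw [List.replicate_succ, List.foldr_cons, ih, Function.iterate_succ_apply']

lemma FwdDiffVanish.foldr_eq_zero {k : ℕ} {f : E → G} (hf : FwdDiffVanish k f) (L : List E)
    (hL : k ≤ L.length) : L.foldr fwdDiff f = 0 := by
  have key : FwdDiffVanish (k - L.length) (L.foldr fwdDiff f) := by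
    clear hL
    induction L with
    | nil => exact hf
    | cons u L ih =>
      rw [List.foldr_cons, List.length_cons, ← Nat.sub_sub]
      generalize k - L.length = j at ih
      cases j with
      | zero =>
        have h : L.foldr fwdDiff f = 0 := ih
        rw [h]
        funext x
        simp [fwdDiff]
      | succ j => exact ih u
  rwa [Nat.sub_eq_zero_of_le hL] at key

/-- A function whose iterated differences along `X` vanish at `0` is constant on the span. -/
lemma eq_apply_zero_of_mem_span [Module (ZMod p) E] {X : Set E} {f : E → G}
    (hf : ∀ L : List E, L ≠ [] → (∀ u ∈ L, u ∈ X) → L.foldr fwdDiff f 0 = 0) {v : E}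
    (hv : v ∈ Submodule.span (ZMod p) X) : f v = f 0 := by
  have hv' := mem_addSubmonoid_closure_of_mem_span hv
  clear hv
  induction hv' using AddSubmonoid.closure_induction_left generalizing f with
  | zero => rfl
  | add_left u hu y hy ih =>
    have h1 : fwdDiff u f y = fwdDiff u f 0 := by
      refine ih fun L _ hL => ?_
      have := hf (L ++ [u]) (by simp) (by
        intro w hw
        rcases List.mem_append.1 hw with h | h
        · exact hL w h
        · rwa [List.mem_singleton.1 h])
      simpa using this
    have h2 : fwdDiff u f 0 = 0 := hf [u] (by simp) (by simpa using hu)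
    rw [h2, fwdDiff, sub_eq_zero] at h1
    rw [add_comm, h1, ih hf]

end IteratedDifferences

/-- The lists of length at most `e` with entries in `X`. -/
noncomputable def listsOfLengthLE {E : Type} (X : Finset E) : ℕ → Finset (List E)
  | 0 => {[]}
  | e + 1 => insert [] (Finset.image₂ List.cons X (listsOfLengthLE X e))

lemma mem_listsOfLengthLE {E : Type} {X : Finset E} {e : ℕ} {L : List E}
    (hL : ∀ u ∈ L, u ∈ X) (he : L.length ≤ e) : L ∈ listsOfLengthLE X e := by
  induction e generalizing L with
  | zero => simp_all [listsOfLengthLE]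
  | succ e ih =>
    cases L with
    | nil => simp [listsOfLengthLE]
    | cons u L =>
      refine Finset.mem_insert_of_mem (Finset.mem_image₂_of_mem (hL u (by simp)) ?_)
      exact ih (fun w hw => hL w (by simp [hw])) (by simpa using he)

lemma card_listsOfLengthLE_le {E : Type} (X : Finset E) (e : ℕ) :
    (listsOfLengthLE X e).card ≤ (X.card + 1) ^ e := by
  induction e with
  | zero => simp [listsOfLengthLE]
  | succ e ih =>
    have h1 := Finset.card_insert_le ([] : List E)
      (Finset.image₂ List.cons X (listsOfLengthLE X e))
    have h2 := Finset.card_image₂_le List.cons X (listsOfLengthLE X e)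
    have h3 : 1 ≤ (X.card + 1) ^ e := Nat.one_le_pow _ _ (by omega)
    have h4 := Nat.mul_le_mul_left X.card ih
    calc _ ≤ X.card * (listsOfLengthLE X e).card + 1 := h1.trans (by omega)
      _ ≤ X.card * (X.card + 1) ^ e + (X.card + 1) ^ e := by omega
      _ = _ := by ring

lemma finrank_le_finrank_iInf_add {E ι : Type} [AddCommGroup E] [Module (ZMod p) E] [Finite E]
    (s : Finset ι) (W : ι → Submodule (ZMod p) E) (C : ℕ)
    (hW : ∀ i, Module.finrank (ZMod p) E ≤ Module.finrank (ZMod p) (W i) + C) :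
    Module.finrank (ZMod p) E ≤
      Module.finrank (ZMod p) (⨅ i ∈ s, W i : Submodule (ZMod p) E) + C * s.card := by
  induction s using Finset.induction_on with
  | empty =>
    have : (⨅ i ∈ (∅ : Finset ι), W i) = ⊤ := by simp
    rw [this]
    simp
  | insert i s his ih =>
    rw [Finset.iInf_insert, Finset.card_insert_of_notMem his]
    have h1 := Submodule.finrank_sup_add_finrank_inf_eq (W i) (⨅ i ∈ s, W i)
    have h2 := Submodule.finrank_le (W i ⊔ ⨅ i ∈ s, W i)
    have h3 := hW i
    rw [mul_add, mul_one]
    omega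

/-- The Chevalley–Warning theorem on a subspace: few equations of low degree with the trivial
solution have a nontrivial one. -/
lemma exists_ne_zero_of_card_lt {n d : ℕ} {ι : Type} (s : Finset ι)
    (g : ι → (Fin n → ZMod p) → ZMod p) (hg0 : ∀ i ∈ s, g i 0 = 0)
    (hg : ∀ i ∈ s, ∀ (r : ℕ) (φ : (Fin r → ZMod p) →ₗ[ZMod p] (Fin n → ZMod p)),
      IsPolynomialFun d fun t => g i (φ t))
    (Y : Submodule (ZMod p) (Fin n → ZMod p))
    (hY : s.card * d < Module.finrank (ZMod p) Y) :
    ∃ y ∈ Y, y ≠ 0 ∧ ∀ i ∈ s, g i y = 0 := by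
  set r := Module.finrank (ZMod p) Y with hr
  let b := (Module.finBasis (ZMod p) Y).equivFun.symm
  let φ : (Fin r → ZMod p) →ₗ[ZMod p] (Fin n → ZMod p) := Y.subtype ∘ₗ b.toLinearMap
  have hP : ∀ i, ∃ P : MvPolynomial (Fin r) (ZMod p), i ∈ s →
      P.totalDegree ≤ d ∧ ∀ t, eval t P = g i (φ t) := by
    intro i
    by_cases hi : i ∈ s
    · obtain ⟨P, hP⟩ := hg i hi r φ
      exact ⟨P, fun _ => hP⟩
    · exact ⟨0, fun h => absurd h hi⟩
  choose P hP using hP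
  have hlt : ∑ i ∈ s, (P i).totalDegree < Fintype.card (Fin r) := by
    rw [Fintype.card_fin]
    refine lt_of_le_of_lt (Finset.sum_le_card_nsmul s _ d fun i hi => (hP i hi).1) ?_
    simpa using hY
  have hdvd := char_dvd_card_solutions_of_sum_lt p hlt
  let z : {x : Fin r → ZMod p // ∀ i ∈ s, eval x (P i) = 0} :=
    ⟨0, fun i hi => by rw [(hP i hi).2, map_zero, hg0 i hi]⟩
  have hcard : 1 < Fintype.card {x : Fin r → ZMod p // ∀ i ∈ s, eval x (P i) = 0} :=
    lt_of_lt_of_le (Fact.out : p.Prime).one_lt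
      (Nat.le_of_dvd (Fintype.card_pos_iff.2 ⟨z⟩) hdvd)
  obtain ⟨t, ht⟩ := Fintype.exists_ne_of_one_lt_card hcard z
  refine ⟨φ t.1, (b t.1).2, fun h => ht ?_, fun i hi => ?_⟩
  · apply Subtype.ext
    have h1 : b t.1 = 0 := Subtype.ext h
    simpa using h1
  · rw [← (hP i hi).2]
    exact t.2 i hi

lemma IsPolynomialFun.foldr_fwdDiff {F : Type} [Field F] {n d : ℕ} {f : (Fin n → F) → F}
    (hf : IsPolynomialFun d f) (L : List (Fin n → F)) :
    IsPolynomialFun d (L.foldr _root_.fwdDiff f) := by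
  induction L with
  | nil => exact hf
  | cons u L ih => exact ih.fwdDiff u

/-- The invariant of the greedy construction of a subspace on which `f` is constant. -/
structure IsFlatList {n : ℕ} (C e : ℕ) (f : (Fin n → ZMod p) → ZMod p)
    (vs : List (Fin n → ZMod p)) : Prop where
  length_le : vs.length ≤ Module.finrank (ZMod p) (Submodule.span (ZMod p) {v | v ∈ vs})
  foldr_eq_zero : ∀ L : List (Fin n → ZMod p), L ≠ [] → (∀ u ∈ L, u ∈ vs) →
    L.foldr fwdDiff f 0 = 0
  hereditarilyConstant : ∀ σ : List (Fin n → ZMod p), σ.Sublist vs → ∀ j, σ.length + j = e + 2 →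
    HereditarilyConstant C j (σ.foldr fwdDiff f)

/-- Repeat the first entry of a list. -/
def List.doubleHead {α : Type} : List α → List α
  | [] => []
  | a :: l => a :: a :: l

lemma exists_perm_doubleHead_of_not_nodup {α : Type} {L : List α} (h : ¬ L.Nodup) :
    ∃ M : List α, L.Perm M.doubleHead ∧ M.length + 1 = L.length := by
  obtain ⟨x, hx⟩ := List.exists_duplicate_iff_not_nodup.2 h
  obtain ⟨l, hl⟩ := (List.duplicate_iff_sublist.1 hx).exists_perm_append
  refine ⟨x :: l, hl, ?_⟩
  simpa using hl.length_eq.symm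

lemma IsFlatList.exists_cons {n C e : ℕ} {f : (Fin n → ZMod p) → ZMod p}
    {vs : List (Fin n → ZMod p)} (hvs : IsFlatList C e f vs) (hf : IsPolynomialFun (e + 3) f)
    (hn : vs.length + (C + (e + 3) * (e + 4)) * (vs.length + 1) ^ (e + 1) < n) :
    ∃ y, IsFlatList C e f (y :: vs) := by
  set LL := listsOfLengthLE vs.toFinset (e + 1) with hLL
  have hLLmem : ∀ L : List (Fin n → ZMod p), (∀ u ∈ L, u ∈ vs) → L.length ≤ e + 1 → L ∈ LL :=
    fun L hL he => mem_listsOfLengthLE (fun u hu => List.mem_toFinset.2 (hL u hu)) he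
  have hLLcard : LL.card ≤ (vs.length + 1) ^ (e + 1) :=
    (card_listsOfLengthLE_le _ _).trans
      (Nat.pow_le_pow_left (Nat.succ_le_succ (List.toFinset_card_le vs)) _)
  have hW : ∀ L : List (Fin n → ZMod p), ∃ W : Submodule (ZMod p) (Fin n → ZMod p),
      Module.finrank (ZMod p) (Fin n → ZMod p) ≤ Module.finrank (ZMod p) W + C ∧
      ∀ j, L.length + (j + 1) = e + 2 → HereditarilyConstant C (j + 1) (L.foldr fwdDiff f) →
        ∀ h ∈ W, HereditarilyConstant C j (fwdDiff h (L.foldr fwdDiff f)) := by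
    intro L
    by_cases h : ∃ j, L.length + (j + 1) = e + 2 ∧
        HereditarilyConstant C (j + 1) (L.foldr fwdDiff f)
    · obtain ⟨j, hj, W, hW, hW'⟩ := h
      refine ⟨W, hW, fun j' hj' _ => ?_⟩
      obtain rfl : j = j' := by omega
      exact hW'
    · exact ⟨⊤, by simp, fun j hj hj' => absurd ⟨j, hj, hj'⟩ h⟩
  choose W hW hW' using hW
  set V := Submodule.span (ZMod p) {v | v ∈ vs} with hV
  obtain ⟨Q, hQ⟩ := Submodule.exists_isCompl V
  have hVle : Module.finrank (ZMod p) V ≤ vs.length := by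
    have := finrank_span_finset_le_card (R := ZMod p) vs.toFinset
    rw [List.coe_toFinset] at this
    exact this.trans (List.toFinset_card_le vs)
  set WW : Submodule (ZMod p) (Fin n → ZMod p) := ⨅ L ∈ LL, W L with hWW
  have hWWrank := finrank_le_finrank_iInf_add LL W C hW
  rw [← hWW, Module.finrank_fin_fun] at hWWrank
  have hY : (LL ×ˢ Finset.range (e + 4)).card * (e + 3) <
      Module.finrank (ZMod p) (WW ⊓ Q : Submodule (ZMod p) (Fin n → ZMod p)) := by
    have h1 := Submodule.finrank_sup_add_finrank_inf_eq WW Q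
    have h2 := Submodule.finrank_le (WW ⊔ Q)
    have h3 := Submodule.finrank_add_eq_of_isCompl hQ
    rw [Module.finrank_fin_fun] at h2 h3
    have h4 := Nat.mul_le_mul_left (C + (e + 3) * (e + 4)) hLLcard
    rw [Finset.card_product, Finset.card_range]
    have h5 : (C + (e + 3) * (e + 4)) * LL.card =
      C * LL.card + LL.card * (e + 4) * (e + 3) := by ring
    omega
  let g : List (Fin n → ZMod p) × ℕ → (Fin n → ZMod p) → ZMod p := fun i y =>
    if i.2 = 0 then (fwdDiff y)^[1] (i.1.doubleHead.foldr fwdDiff f) 0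
    else (fwdDiff y)^[i.2] (i.1.foldr fwdDiff f) 0
  obtain ⟨y, hyY, hy0, hyg⟩ := exists_ne_zero_of_card_lt (d := e + 3)
    (LL ×ˢ Finset.range (e + 4)) g (fun i _ => by
      by_cases hi : i.2 = 0
      · simp [g, hi, fwdDiff_zero_dir]
      · obtain ⟨s, hs⟩ := Nat.exists_eq_succ_of_ne_zero hi
        simp only [g, hi, if_false]
        rw [hs, Function.iterate_succ_apply', fwdDiff_zero_dir]
        rfl) (fun i _ r φ => by
      by_cases hi : i.2 = 0
      · simp only [g, hi, if_true]
        exact (hf.foldr_fwdDiff _).fwdDiff_iterate_comp φ 1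
      · simp only [g, hi, if_false]
        exact (hf.foldr_fwdDiff _).fwdDiff_iterate_comp φ _) (WW ⊓ Q) hY
  have hyV : y ∉ V := fun h => hy0 (Submodule.disjoint_def.1 hQ.disjoint y h hyY.2)
  have hyW : ∀ L ∈ LL, y ∈ W L := by
    intro L hL
    have := hyY.1
    rw [hWW] at this
    exact (Submodule.mem_iInf _).1 ((Submodule.mem_iInf _).1 this L) hL
  refine ⟨y, ?_, ?_, ?_⟩
  · have hlt : V < Submodule.span (ZMod p) {v | v ∈ y :: vs} := by
      refine lt_of_le_of_ne (Submodule.span_mono fun v hv => by simp_all) fun h => hyV ?_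
      rw [h]
      exact Submodule.subset_span (by simp)
    have := Submodule.finrank_lt_finrank_of_lt hlt
    have hlen := hvs.length_le
    rw [← hV] at hlen
    rw [List.length_cons]
    omega
  · intro L hL0 hL
    by_cases hlen : e + 4 ≤ L.length
    · rw [hf.fwdDiffVanish.foldr_eq_zero L hlen]
      rfl
    set α := L.filter (fun u => ¬ (u = y)) with hα
    set s := (L.filter (fun u => u = y)).length with hs
    have hperm : L.Perm (List.replicate s y ++ α) := by
      have h1 := (List.filter_append_perm (fun u => decide (u = y)) L).symm
      have h2 : L.filter (fun u => u = y) = List.replicate s y := by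
        rw [List.eq_replicate_iff]
        exact ⟨rfl, fun b hb => by simpa using (List.mem_filter.1 hb).2⟩
      rw [h2] at h1
      simpa [hα] using h1
    have hαmem : ∀ u ∈ α, u ∈ vs := by
      intro u hu
      obtain ⟨h1, h2⟩ := List.mem_filter.1 hu
      have := hL u h1
      simp_all
    have hsum : s + α.length = L.length := by
      have := hperm.length_eq
      simp at this
      omega
    rw [hperm.foldr_eq, List.foldr_append, foldr_fwdDiff_replicate]
    rcases Nat.eq_zero_or_pos s with hs0 | hs0
    · rw [hs0]
      refine hvs.foldr_eq_zero α ?_ hαmem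
      rintro h
      rw [h, hs0] at hsum
      exact hL0 (List.length_eq_zero_iff.1 (by simpa using hsum.symm))
    by_cases hαlen : α.length ≤ e + 1
    · have := hyg (α, s) (Finset.mem_product.2
        ⟨hLLmem α hαmem hαlen, Finset.mem_range.2 (by simp only; omega)⟩)
      simpa [g, hs0.ne'] using this
    obtain ⟨hs1, hα2⟩ : s = 1 ∧ α.length = e + 2 := by omega
    rw [hs1]
    by_cases hnd : α.Nodup
    · obtain ⟨σ, hσα, hσ⟩ := List.subperm_of_subset hnd hαmem
      have hc := hvs.hereditarilyConstant σ hσ 0 (by rw [hσα.length_eq, hα2])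
      rw [← hσα.foldr_eq]
      simp [fwdDiff, hc y 0]
    · obtain ⟨M, hM, hMlen⟩ := exists_perm_doubleHead_of_not_nodup hnd
      have hMmem : ∀ u ∈ M, u ∈ vs := by
        intro u hu
        refine hαmem u (hM.mem_iff.2 ?_)
        cases M with
        | nil => simp at hu
        | cons a l => exact List.mem_cons_of_mem _ hu
      have := hyg (M, 0) (Finset.mem_product.2
        ⟨hLLmem M hMmem (by omega), Finset.mem_range.2 (by simp)⟩)
      rw [hM.foldr_eq]
      simpa [g] using this
  · intro σ hσ j hj
    cases hσ with
    | cons _ h => exact hvs.hereditarilyConstant σ h j hj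
    | cons_cons _ h =>
      rename_i τ
      rw [List.length_cons] at hj
      rw [List.foldr_cons]
      have hτ := hvs.hereditarilyConstant τ h (j + 1) (by omega)
      exact hW' τ j (by omega) hτ y (hyW τ (hLLmem τ (fun u hu => h.subset hu) (by omega)))

/-- A hereditarily constant polynomial is constant on a large subspace. -/
lemma HereditarilyConstant.exists_finrank_eq {n C e k : ℕ} {f : (Fin n → ZMod p) → ZMod p}
    (hC : HereditarilyConstant C (e + 2) f) (hf : IsPolynomialFun (e + 3) f)
    (hn : k + (C + (e + 3) * (e + 4)) * k ^ (e + 1) ≤ n) :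
    ∃ V : Submodule (ZMod p) (Fin n → ZMod p), Module.finrank (ZMod p) V = k ∧
      ∀ v ∈ V, f v = f 0 := by
  have key : ∀ m ≤ k, ∃ vs : List (Fin n → ZMod p), vs.length = m ∧ IsFlatList C e f vs := by
    intro m
    induction m with
    | zero =>
      refine fun _ => ⟨[], rfl, by simp, fun L hL h => ?_, fun σ hσ j hj => ?_⟩
      · exact absurd (List.eq_nil_iff_forall_not_mem.2 fun u hu => by simpa using h u hu) hL
      · obtain rfl := List.sublist_nil.1 hσ
        obtain rfl : j = e + 2 := by simpa using hj
        exact hC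
    | succ m ih =>
      intro hm
      obtain ⟨vs, hlen, hvs⟩ := ih (by omega)
      obtain ⟨y, hy⟩ := hvs.exists_cons hf (by
        rw [hlen]
        have := Nat.mul_le_mul_left (C + (e + 3) * (e + 4)) (Nat.pow_le_pow_left hm (e + 1))
        omega)
      exact ⟨y :: vs, by simp [hlen], hy⟩
  obtain ⟨vs, hlen, hvs⟩ := key k le_rfl
  refine ⟨Submodule.span (ZMod p) {v | v ∈ vs}, le_antisymm ?_ ?_, fun v hv => ?_⟩
  · have := finrank_span_finset_le_card (R := ZMod p) vs.toFinset
    rw [List.coe_toFinset] at this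
    exact this.trans ((List.toFinset_card_le vs).trans hlen.le)
  · exact hlen ▸ hvs.length_le
  · exact eq_apply_zero_of_mem_span (X := {v | v ∈ vs}) hvs.foldr_eq_zero hv

lemma exists_injective_range_eq {n K : ℕ} (U : Submodule (ZMod p) (Fin n → ZMod p))
    (hU : Module.finrank (ZMod p) U = K) :
    ∃ φ : (Fin K → ZMod p) →ₗ[ZMod p] (Fin n → ZMod p),
      Function.Injective φ ∧ LinearMap.range φ = U := by
  subst hU
  let b := (Module.finBasis (ZMod p) U).equivFun.symm
  refine ⟨U.subtype ∘ₗ b.toLinearMap, ?_, ?_⟩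
  · exact Subtype.val_injective.comp b.injective
  · rw [LinearMap.range_comp, LinearEquiv.range, Submodule.map_top, Submodule.range_subtype]

/-- A form of the XOR lemma: if all nontrivial characters of `f` have small average on `S`,
then `f` is close to uniform on `S`. -/
lemma closeToUniform_of_norm_sum_le {D : Type} (f : D → ZMod p) (S : Finset D) (η : ℝ)
    (hS : S.Nonempty)
    (h : ∀ a : ZMod p, a ≠ 0 → ‖∑ x ∈ S, ZMod.stdAddChar (a * f x)‖ ≤ η * S.card) :
    CloseToUniform f S (p * η) := by
  have hp : (0 : ℝ) < p := by exact_mod_cast (Fact.out : p.Prime).pos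
  have hScard : (0 : ℝ) < S.card := by exact_mod_cast hS.card_pos
  have hη : 0 ≤ η := by
    have := (norm_nonneg _).trans (h 1 one_ne_zero)
    exact nonneg_of_mul_nonneg_left this hScard
  have hfib : ∀ z : ZMod p,
      |((S.filter fun x => f x = z).card : ℝ) / S.card - 1 / p| ≤ η := by
    intro z
    have h1 : ((p * (S.filter fun x => f x = z).card : ℝ) : ℂ) =
        ∑ a : ZMod p, ZMod.stdAddChar (-(a * z)) * ∑ x ∈ S, ZMod.stdAddChar (a * f x) := by
      simp_rw [Finset.mul_sum, ← AddChar.map_add_eq_mul]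
      rw [Finset.sum_comm]
      have h2 : ∀ x, ∑ a : ZMod p, (ZMod.stdAddChar (-(a * z) + a * f x) : ℂ) =
          if f x = z then (p : ℂ) else 0 := by
        intro x
        have := AddChar.sum_mulShift (f x - z) (ZMod.isPrimitive_stdAddChar p)
        simp only [sub_eq_zero, ZMod.card] at this
        convert this using 3
        · ring
        · simp
      simp_rw [h2, ← Finset.sum_filter, Finset.sum_const]
      simp [mul_comm]
    rw [← Finset.add_sum_erase _ _ (Finset.mem_univ (0 : ZMod p))] at h1
    have h3 : |(p * (S.filter fun x => f x = z).card : ℝ) - S.card| ≤ p * (η * S.card) := by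
      rw [← Real.norm_eq_abs, ← Complex.norm_real, Complex.ofReal_sub, h1]
      simp only [zero_mul, neg_zero, AddChar.map_zero_eq_one, Finset.sum_const, nsmul_eq_mul,
        mul_one, one_mul, Complex.ofReal_natCast, add_sub_cancel_left]
      refine (norm_sum_le _ _).trans ?_
      refine (Finset.sum_le_card_nsmul _ _ (η * S.card) fun a ha => ?_).trans ?_
      · rw [norm_mul, AddChar.norm_apply, one_mul]
        exact h a (Finset.ne_of_mem_erase ha)
      · rw [nsmul_eq_mul]
        refine mul_le_mul_of_nonneg_right ?_ (by positivity)
        have := Finset.card_le_univ (Finset.univ.erase (0 : ZMod p))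
        rw [ZMod.card] at this
        exact_mod_cast this
    have h4 : ((S.filter fun x => f x = z).card : ℝ) / S.card - 1 / p =
        (p * (S.filter fun x => f x = z).card - S.card) / (p * S.card) := by
      field_simp
    rw [h4, abs_div, abs_of_pos (mul_pos hp hScard), div_le_iff₀ (mul_pos hp hScard)]
    linarith
  intro A
  have h5 : ((S.filter fun x => f x ∈ A).card : ℝ) =
      ∑ z ∈ A, ((S.filter fun x => f x = z).card : ℝ) := by
    rw [← Nat.cast_sum, Finset.card_eq_sum_card_fiberwise (s := S.filter fun x => f x ∈ A)
      (f := f) (t := A) (fun x hx => by simpa using (Finset.mem_filter.1 hx).2)]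
    congr 1
    refine Finset.sum_congr rfl fun z hz => ?_
    congr 1
    ext x
    simp only [Finset.mem_filter]
    constructor
    · rintro ⟨⟨hx, _⟩, rfl⟩
      exact ⟨hx, rfl⟩
    · rintro ⟨hx, rfl⟩
      exact ⟨⟨hx, hz⟩, rfl⟩
  have h6 : ((S.filter fun x => f x ∈ A).card : ℝ) / S.card - A.card / Fintype.card (ZMod p) =
      ∑ z ∈ A, (((S.filter fun x => f x = z).card : ℝ) / S.card - 1 / p) := by
    rw [h5, Finset.sum_sub_distrib, Finset.sum_div, Finset.sum_const, ZMod.card, nsmul_eq_mul,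
      mul_one_div]
  have h7 : |((S.filter fun x => f x ∈ A).card : ℝ) / S.card -
      A.card / Fintype.card (ZMod p)| ≤ p * η := by
    rw [h6]
    refine (Finset.abs_sum_le_sum_abs _ _).trans ?_
    refine (Finset.sum_le_card_nsmul _ _ η fun z _ => hfib z).trans ?_
    rw [nsmul_eq_mul]
    refine mul_le_mul_of_nonneg_right ?_ hη
    have := Finset.card_le_univ A
    rw [ZMod.card] at this
    exact_mod_cast this
  convert h7

end Structure

theorem stmt_14 (p : ℕ) [Fact p.Prime] (d : ℕ) (hd : 3 ≤ d)
    (δ : ℝ) (hδ : δ ∈ Set.Ioo (0 : ℝ) 1) :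
    ∃ c : ℝ, 0 < c ∧
      ∀ (n k : ℕ) (f : MvPolynomial (Fin n) (ZMod p)),
        f.totalDegree ≤ d →
        AffineDisperser (fun x => eval x f) k →
        AffineExtractor (fun x => eval x f) ⌈c * (k : ℝ) ^ (d - 2)⌉₊ δ := by
  obtain ⟨e, rfl⟩ : ∃ e, d = e + 3 := ⟨d - 3, by omega⟩
  have hp : (0 : ℝ) < p := by exact_mod_cast (Fact.out : p.Prime).pos
  have hε : 0 < δ / p := div_pos hδ.1 hp
  obtain ⟨C, hC⟩ := exists_hereditarilyConstant_of_biased (p := p) (e + 2) (δ / p) hε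
  refine ⟨((1 + (C + (e + 3) * (e + 4)) : ℕ) : ℝ), by positivity, fun n k f hf hdisp u₀ U hU => ?_⟩
  have hK : ⌈((1 + (C + (e + 3) * (e + 4)) : ℕ) : ℝ) * (k : ℝ) ^ (e + 3 - 2)⌉₊ =
      (1 + (C + (e + 3) * (e + 4))) * k ^ (e + 1) := by
    rw [show e + 3 - 2 = e + 1 by omega]
    exact_mod_cast Nat.ceil_natCast (R := ℝ) ((1 + (C + (e + 3) * (e + 4))) * k ^ (e + 1))
  rw [hK] at hU
  set K := (1 + (C + (e + 3) * (e + 4))) * k ^ (e + 1) with hKdef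
  have hkK : k + (C + (e + 3) * (e + 4)) * k ^ (e + 1) ≤ K := by
    have := Nat.le_self_pow (Nat.succ_ne_zero e) k
    calc _ ≤ k ^ (e + 1) + (C + (e + 3) * (e + 4)) * k ^ (e + 1) := Nat.add_le_add_right this _
      _ = K := by rw [hKdef]; ring
  obtain ⟨φ, hφ, hφU⟩ := exists_injective_range_eq U hU
  have hinj : Function.Injective fun t => u₀ + φ t := (add_right_injective u₀).comp hφ
  have hS : cosetFinset u₀ U = Finset.univ.image fun t => u₀ + φ t := by
    ext x
    simp [cosetFinset, ← hφU, eq_comm]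
  rw [show δ = p * (δ / p) by field_simp]
  refine closeToUniform_of_norm_sum_le _ _ _ (by simp [hS]) fun a ha => ?_
  by_contra! hlt
  rw [hS, Finset.sum_image hinj.injOn, Finset.card_image_of_injective _ hinj,
    Finset.card_univ] at hlt
  have hg : IsPolynomialFun (e + 3) fun t : Fin K → ZMod p => a * eval (u₀ + φ t) f :=
    IsPolynomialFun.const_mul
      (IsPolynomialFun.comp_affine (f := fun x => eval x f) ⟨f, hf, fun _ => rfl⟩ u₀ φ) a
  obtain ⟨V, hV, hVc⟩ := (hC K _ hg.fwdDiffVanish hlt.le).exists_finrank_eq hg hkK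
  obtain ⟨_, ⟨s, hs, rfl⟩, _, ⟨t, ht, rfl⟩, hne⟩ := hdisp u₀ (V.map φ) (by
    rw [← hV]
    exact (Submodule.equivMapOfInjective φ hφ V).finrank_eq.symm)
  exact hne (mul_left_cancel₀ ha ((hVc s hs).trans (hVc t ht).symm))
end
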